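/- arXiv:2010.10304 — 6 statements merged into one kernel-verified Lean document; each statement's English description precedes it below -/
import Mathlib

section
/- A countable amenable group Γ is uniformly HS stable if and only if there exists d ∈ ℕ such that every finite dimensional irreducible unitary representation of Γ has dimension at most d. -/
open scoped Matrix

/-- Normalized Hilbert–Schmidt norm: ‖A‖_{HS,n} = ((1/n)·Tr(A Aᴴ))^{1/2}. -/
noncomputable def hsNorm {n m : ℕ} (A : Matrix (Fin n) (Fin m) ℂ) : ℝ :=
  Real.sqrt ((1 / (n : ℝ)) * (Matrix.trace (A * Aᴴ)).re)

/-- Operator norm (largest singular value) of a rectangular complex matrix. -/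
noncomputable def opNorm {n m : ℕ} (A : Matrix (Fin n) (Fin m) ℂ) : ℝ :=
  ‖LinearMap.toContinuousLinearMap (Matrix.toEuclideanLin A)‖

/-- Γ is uniformly HS stable: for every δ>0 there is ε>0 such that every
ε-homomorphism into some U(n) (w.r.t. the normalized HS metric) is δ-close to a
genuine unitary representation of the same dimension. -/
def UniformlyHSStable (Γ : Type*) [Group Γ] : Prop :=
  ∀ δ : ℝ, 0 < δ → ∃ ε : ℝ, 0 < ε ∧
    ∀ (n : ℕ) (φ : Γ → Matrix.unitaryGroup (Fin n) ℂ),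
      (∀ g h : Γ, hsNorm ((φ g : Matrix (Fin n) (Fin n) ℂ) * (φ h : Matrix (Fin n) (Fin n) ℂ)
        - (φ (g * h) : Matrix (Fin n) (Fin n) ℂ)) < ε) →
      ∃ π : Γ →* Matrix.unitaryGroup (Fin n) ℂ,
        ∀ g : Γ, hsNorm ((φ g : Matrix (Fin n) (Fin n) ℂ) - (π g : Matrix (Fin n) (Fin n) ℂ)) < δ

/-- A unitary representation is irreducible if ℂⁿ has no nonzero proper invariant subspace. -/
def IsIrreducibleRep {Γ : Type*} [Group Γ] {n : ℕ}
    (π : Γ →* Matrix.unitaryGroup (Fin n) ℂ) : Prop :=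
  ∀ W : Submodule ℂ (Fin n → ℂ),
    (∀ g : Γ, ∀ v ∈ W, Matrix.mulVec (π g : Matrix (Fin n) (Fin n) ℂ) v ∈ W) →
    W = ⊥ ∨ W = ⊤

/-- Residual finiteness: every nonidentity element avoids some finite index normal subgroup. -/
def ResiduallyFinite (Γ : Type*) [Group Γ] : Prop :=
  ∀ x : Γ, x ≠ 1 → ∃ N : Subgroup Γ, N.Normal ∧ N.FiniteIndex ∧ x ∉ N

/-- Virtually abelian: there is an abelian subgroup of finite index. -/
def VirtuallyAbelian (Γ : Type*) [Group Γ] : Prop :=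
  ∃ A : Subgroup Γ, A.FiniteIndex ∧ ∀ x ∈ A, ∀ y ∈ A, x * y = y * x

/-- Amenability: a finitely additive, left-invariant probability measure on all subsets. -/
def IsAmenable (Γ : Type*) [Group Γ] : Prop :=
  ∃ μ : Set Γ → ℝ,
    (∀ S : Set Γ, 0 ≤ μ S) ∧
    μ Set.univ = 1 ∧
    (∀ S T : Set Γ, Disjoint S T → μ (S ∪ T) = μ S + μ T) ∧
    (∀ (g : Γ) (S : Set Γ), μ ((fun x => g * x) '' S) = μ S)

section Mean

open Filter Topology

/-- A finitely additive probability measure agrees on any finite family of sets with a finitely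
supported one. -/
theorem exists_finite_weights {X : Type*} [Nonempty X] {μ : Set X → ℝ} (h0 : ∀ S, 0 ≤ μ S)
    (h1 : μ Set.univ = 1) (hadd : ∀ S T, Disjoint S T → μ (S ∪ T) = μ S + μ T)
    (𝒮 : Finset (Set X)) :
    ∃ (w : (𝒮 → Prop) → ℝ) (x : (𝒮 → Prop) → X), (∀ p, 0 ≤ w p) ∧ ∑ p, w p = 1 ∧
      ∀ S ∈ 𝒮, ∑ p, w p * S.indicator 1 (x p) = μ S := by
  classical
  have hempty : μ ∅ = 0 := by simpa using hadd ∅ ∅ (by simp)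
  have hsum : ∀ (s : Finset (𝒮 → Prop)) (A : (𝒮 → Prop) → Set X),
      (∀ p q, p ≠ q → Disjoint (A p) (A q)) → μ (⋃ p ∈ s, A p) = ∑ p ∈ s, μ (A p) := by
    intro s A hA
    induction s using Finset.induction_on with
    | empty => simpa using hempty
    | insert a s ha ih =>
      rw [Finset.set_biUnion_insert, hadd, ih, Finset.sum_insert ha]
      rw [Set.disjoint_iUnion₂_right]
      intro p hp
      exact hA a p (fun h => ha (h ▸ hp))
  let r : X → 𝒮 → Prop := fun x S => x ∈ S.1
  have hsplit : ∀ T : Set X, μ T = ∑ p, μ (T ∩ r ⁻¹' {p}) := by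
    intro T
    rw [← hsum Finset.univ (fun p => T ∩ r ⁻¹' {p})]
    · congr 1
      ext x
      simp
    · intro p q hpq
      rw [Set.disjoint_left]
      rintro x ⟨-, hx⟩ ⟨-, hx'⟩
      exact hpq (hx.symm.trans hx')
  have hx : ∀ p : 𝒮 → Prop, ∃ x, (r ⁻¹' {p}).Nonempty → r x = p := by
    intro p
    by_cases h : (r ⁻¹' {p}).Nonempty
    · exact ⟨h.some, fun _ => h.some_mem⟩
    · exact ⟨Classical.arbitrary X, fun h' => absurd h' h⟩
  choose x hx using hx
  refine ⟨fun p => μ (r ⁻¹' {p}), x, fun p => h0 _, ?_, ?_⟩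
  · rw [← h1, hsplit Set.univ]
    simp
  · intro S hS
    rw [hsplit S]
    refine Finset.sum_congr rfl fun p _ => ?_
    rcases (r ⁻¹' {p}).eq_empty_or_nonempty with h | h
    · simp [h, hempty]
    · have hp := hx p h
      by_cases hxS : x p ∈ S
      · have : S ∩ r ⁻¹' {p} = r ⁻¹' {p} := by
          refine Set.inter_eq_right.2 fun y hy => ?_
          have h2 : r y = r (x p) := by rw [hp]; exact hy
          have h3 := congrFun h2 ⟨S, hS⟩
          exact h3.mpr hxS
        simp [this, hxS]
      · have : S ∩ r ⁻¹' {p} = ∅ := by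
          rw [Set.eq_empty_iff_forall_notMem]
          rintro y ⟨hyS, hy⟩
          have h2 : r y = r (x p) := by rw [hp]; exact hy
          have h3 := congrFun h2 ⟨S, hS⟩
          exact hxS (h3.mp hyS)
        simp [this, hxS, hempty]

/-- A bounded function is uniformly close to one with finitely many values. -/
theorem exists_finite_range_approx {X : Type*} {f : X → ℂ} {C : ℝ} (hf : ∀ x, ‖f x‖ ≤ C)
    {ε : ℝ} (hε : 0 < ε) :
    ∃ (F : Finset ℂ) (q : X → ℂ), (∀ x, q x ∈ F) ∧ ∀ x, ‖f x - q x‖ ≤ ε := by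
  obtain ⟨t, ht, htc⟩ := Metric.totallyBounded_iff.1
    (isCompact_closedBall (0 : ℂ) C).totallyBounded ε hε
  have h : ∀ x, ∃ c ∈ t, ‖f x - c‖ ≤ ε := by
    intro x
    have := htc (show f x ∈ Metric.closedBall 0 C by simpa using hf x)
    simp only [Set.mem_iUnion, Metric.mem_ball] at this
    obtain ⟨c, hc, hd⟩ := this
    exact ⟨c, hc, by rw [← dist_eq_norm]; exact hd.le⟩
  choose q hq hq' using h
  exact ⟨ht.toFinset, q, by simpa using hq, hq'⟩

/-- A finitely additive probability measure extends to a positive functional on bounded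
functions. -/
theorem exists_integral_functional {X : Type*} [Nonempty X] {μ : Set X → ℝ} (h0 : ∀ S, 0 ≤ μ S)
    (h1 : μ Set.univ = 1) (hadd : ∀ S T, Disjoint S T → μ (S ∪ T) = μ S + μ T) :
    ∃ M : (X → ℂ) →ₗ[ℂ] ℂ, (∀ S, M (S.indicator 1) = μ S) ∧
      (∀ f C, (∀ x, ‖f x‖ ≤ C) → (∀ x, 0 ≤ (f x).re) → 0 ≤ (M f).re) ∧
      (∀ f C, (∀ x, ‖f x‖ ≤ C) → ‖M f‖ ≤ C) := by
  choose w x hw hw1 hwS using exists_finite_weights h0 h1 hadd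
  let 𝒰 : Ultrafilter (Finset (Set X)) := Ultrafilter.of atTop
  let L : Finset (Set X) → (X → ℂ) → ℂ := fun 𝒮 f => ∑ p, (w 𝒮 p : ℂ) * f (x 𝒮 p)
  have hLb : ∀ 𝒮 f C, (∀ x, ‖f x‖ ≤ C) → ‖L 𝒮 f‖ ≤ C := by
    intro 𝒮 f C hC
    calc ‖L 𝒮 f‖ ≤ ∑ p, w 𝒮 p * C := by
          refine norm_sum_le_of_le _ fun p _ => ?_
          rw [norm_mul, Complex.norm_real, Real.norm_of_nonneg (hw 𝒮 p)]
          exact mul_le_mul_of_nonneg_left (hC _) (hw 𝒮 p)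
      _ = C := by rw [← Finset.sum_mul, hw1, one_mul]
  let V : Submodule ℂ (X → ℂ) :=
    { carrier := {f | ∃ C, ∀ x, ‖f x‖ ≤ C}
      add_mem' := by
        rintro f g ⟨C, hC⟩ ⟨D, hD⟩
        exact ⟨C + D, fun x => (norm_add_le _ _).trans (add_le_add (hC x) (hD x))⟩
      zero_mem' := ⟨0, by simp⟩
      smul_mem' := by
        rintro c f ⟨C, hC⟩
        refine ⟨‖c‖ * C, fun x => ?_⟩
        rw [Pi.smul_apply, norm_smul]
        exact mul_le_mul_of_nonneg_left (hC x) (norm_nonneg c) }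
  have hlim : ∀ f : V, ∃ l, Tendsto (fun 𝒮 => L 𝒮 f) 𝒰 (𝓝 l) := by
    rintro ⟨f, C, hC⟩
    obtain ⟨l, -, hl⟩ := (isCompact_closedBall (0 : ℂ) C).ultrafilter_le_nhds
      (𝒰.map fun 𝒮 => L 𝒮 f) (by
        rw [le_principal_iff]
        exact Filter.mem_map.2 (Filter.univ_mem' fun 𝒮 => by simpa using hLb 𝒮 f C hC))
    exact ⟨l, hl⟩
  choose m hm using hlim
  let M₀ : V →ₗ[ℂ] ℂ :=
    { toFun := m
      map_add' := fun f g => tendsto_nhds_unique (hm (f + g)) (by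
        simpa [L, mul_add, Finset.sum_add_distrib] using (hm f).add (hm g))
      map_smul' := fun c f => tendsto_nhds_unique (hm (c • f)) (by
        simpa [L, Finset.mul_sum, mul_left_comm] using (hm f).const_mul c) }
  obtain ⟨M, hM⟩ := M₀.exists_extend
  have hMlim : ∀ f C, (∀ x, ‖f x‖ ≤ C) → Tendsto (fun 𝒮 => L 𝒮 f) 𝒰 (𝓝 (M f)) := by
    intro f C hC
    have h2 : M f = m ⟨f, C, hC⟩ := LinearMap.congr_fun hM ⟨f, C, hC⟩
    rw [h2]
    exact hm ⟨f, C, hC⟩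
  refine ⟨M, ?_, ?_, ?_⟩
  · intro S
    refine tendsto_nhds_unique (hMlim (S.indicator 1) 1 fun y => ?_) ?_
    · by_cases hy : y ∈ S <;> simp [hy]
    · refine tendsto_const_nhds.congr' ?_
      have : ∀ᶠ 𝒮 in atTop, S ∈ (𝒮 : Finset (Set X)) :=
        (eventually_ge_atTop {S}).mono fun 𝒮 h => h (Finset.mem_singleton_self S)
      filter_upwards [Ultrafilter.of_le atTop this] with 𝒮 h𝒮
      rw [← hwS 𝒮 S h𝒮, Complex.ofReal_sum]
      refine Finset.sum_congr rfl fun p _ => ?_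
      by_cases hy : x 𝒮 p ∈ S <;> simp [hy]
  · intro f C hC hf
    refine ge_of_tendsto ((Complex.continuous_re.tendsto _).comp (hMlim f C hC))
      (Eventually.of_forall fun 𝒮 => ?_)
    simp only [Function.comp, L, Complex.re_sum, Complex.re_ofReal_mul]
    exact Finset.sum_nonneg fun p _ => mul_nonneg (hw 𝒮 p) (hf _)
  · intro f C hC
    exact le_of_tendsto (hMlim f C hC).norm (Eventually.of_forall fun 𝒮 => hLb 𝒮 f C hC)

/-- An invariant mean on an amenable group; linearity is extended to unbounded functions. -/
structure InvariantMean (Γ : Type*) [Group Γ] where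
  avg : (Γ → ℂ) →ₗ[ℂ] ℂ
  map_const_one : avg (fun _ => 1) = 1
  re_nonneg : ∀ f C, (∀ x, ‖f x‖ ≤ C) → (∀ x, 0 ≤ (f x).re) → 0 ≤ (avg f).re
  norm_le : ∀ f C, (∀ x, ‖f x‖ ≤ C) → ‖avg f‖ ≤ C
  map_mul_left : ∀ f C, (∀ x, ‖f x‖ ≤ C) → ∀ g, avg (fun x => f (g * x)) = avg f

theorem IsAmenable.nonempty_invariantMean {Γ : Type*} [Group Γ] (h : IsAmenable Γ) :
    Nonempty (InvariantMean Γ) := by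
  classical
  obtain ⟨μ, h0, h1, hadd, hinv⟩ := h
  obtain ⟨M, hMi, hMpos, hMb⟩ := exists_integral_functional h0 h1 hadd
  refine ⟨⟨M, ?_, hMpos, hMb, ?_⟩⟩
  · have := hMi Set.univ
    rw [h1, Set.indicator_univ] at this
    simp only [Complex.ofReal_one] at this
    exact this
  · intro f C hC g
    refine eq_of_forall_dist_le fun ε hε => ?_
    obtain ⟨F, q, hqF, hq⟩ := exists_finite_range_approx hC (half_pos hε)
    have hq1 : q = ∑ c ∈ F, c • (q ⁻¹' {c}).indicator 1 := by
      ext x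
      simp only [Finset.sum_apply, Pi.smul_apply, Set.indicator_apply, Set.mem_preimage,
        Set.mem_singleton_iff, Pi.one_apply, smul_eq_mul, mul_ite, mul_one, mul_zero]
      rw [Finset.sum_ite_eq F (q x), if_pos (hqF x)]
    have hq2 : (fun x => q (g * x)) =
        ∑ c ∈ F, c • ((fun x => g⁻¹ * x) '' (q ⁻¹' {c})).indicator 1 := by
      ext x
      simp only [Finset.sum_apply, Pi.smul_apply, Set.indicator_apply, Set.mem_preimage,
        Set.mem_singleton_iff, Pi.one_apply, smul_eq_mul, mul_ite, mul_one, mul_zero,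
        Set.image_mul_left, inv_inv]
      rw [Finset.sum_ite_eq F (q (g * x)), if_pos (hqF _)]
    have hMq : M (fun x => q (g * x)) = M q := by
      rw [hq2, map_sum]
      conv_rhs => rw [hq1, map_sum]
      refine Finset.sum_congr rfl fun c _ => ?_
      rw [map_smul, map_smul, hMi, hMi, hinv]
    have e : M (fun x => f (g * x)) - M f =
        M (fun x => f (g * x) - q (g * x)) - M (fun x => f x - q x) := by
      have e1 : M (fun x => f (g * x) - q (g * x)) =
        M (fun x => f (g * x)) - M (fun x => q (g * x)) := map_sub M _ _
      have e2 : M (fun x => f x - q x) = M f - M q := map_sub M _ _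
      rw [e1, e2, hMq]
      ring
    rw [dist_eq_norm, e]
    refine (norm_sub_le _ _).trans ?_
    linarith [hMb _ _ hq, hMb (fun x => f (g * x) - q (g * x)) _ fun x => hq (g * x)]

end Mean

section Averaging

open scoped InnerProductSpace ComplexConjugate

variable {Γ : Type*} [Group Γ] (M : InvariantMean Γ)

namespace InvariantMean

theorem avg_const (c : ℂ) : M.avg (fun _ => c) = c := by
  have h : (fun _ : Γ => c) = c • (fun _ => (1 : ℂ)) := by ext; simp
  rw [h, map_smul, M.map_const_one, smul_eq_mul, mul_one]

theorem re_avg_mono {f g : Γ → ℂ} {C D : ℝ} (hf : ∀ x, ‖f x‖ ≤ C) (hg : ∀ x, ‖g x‖ ≤ D)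
    (h : ∀ x, (f x).re ≤ (g x).re) : (M.avg f).re ≤ (M.avg g).re := by
  have := M.re_nonneg (g - f) (D + C)
    (fun x => (norm_sub_le _ _).trans (add_le_add (hg x) (hf x))) (fun x => by simpa using h x)
  simpa using this

theorem re_avg_le {f : Γ → ℂ} {C c : ℝ} (hf : ∀ x, ‖f x‖ ≤ C) (h : ∀ x, (f x).re ≤ c) :
    (M.avg f).re ≤ c := by
  have := M.re_avg_mono (g := fun _ => (c : ℂ)) hf (fun _ => le_rfl) (by simpa using h)
  rwa [avg_const, Complex.ofReal_re] at this

theorem le_re_avg {f : Γ → ℂ} {C c : ℝ} (hf : ∀ x, ‖f x‖ ≤ C) (h : ∀ x, c ≤ (f x).re) :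
    c ≤ (M.avg f).re := by
  have := M.re_avg_mono (f := fun _ => (c : ℂ)) (fun _ => le_rfl) hf (by simpa using h)
  rwa [avg_const, Complex.ofReal_re] at this

theorem im_avg_eq_zero {f : Γ → ℂ} {C : ℝ} (hf : ∀ x, ‖f x‖ ≤ C) (h : ∀ x, (f x).im = 0) :
    (M.avg f).im = 0 := by
  have key : ∀ c : ℂ, c.re = 0 → 0 ≤ (c * M.avg f).re := fun c hc => by
    rw [← smul_eq_mul, ← map_smul]
    refine M.re_nonneg _ (‖c‖ * C) (fun x => ?_) fun x => ?_
    · rw [Pi.smul_apply, norm_smul]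
      exact mul_le_mul_of_nonneg_left (hf x) (norm_nonneg c)
    · simp [hc, h x]
  have h1 := key Complex.I (by simp)
  have h2 := key (-Complex.I) (by simp)
  simp at h1 h2
  exact le_antisymm h1 h2

theorem avg_conj {f : Γ → ℂ} {C : ℝ} (hf : ∀ x, ‖f x‖ ≤ C) :
    M.avg (fun x => conj (f x)) = conj (M.avg f) := by
  have hf' : ∀ x, ‖conj (f x)‖ ≤ C := fun x => by simpa using hf x
  have hadd : M.avg (fun x => conj (f x)) + M.avg f = M.avg (fun x => conj (f x) + f x) :=
    (map_add M.avg _ _).symm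
  have hsub : M.avg (fun x => conj (f x)) - M.avg f = M.avg (fun x => conj (f x) - f x) :=
    (map_sub M.avg _ _).symm
  have h1 : (M.avg (fun x => conj (f x) + f x)).im = 0 :=
    M.im_avg_eq_zero (fun x => (norm_add_le _ _).trans (add_le_add (hf' x) (hf x))) (by simp)
  have h2 : (M.avg (Complex.I • fun x => conj (f x) - f x)).im = 0 :=
    M.im_avg_eq_zero (C := C + C) (fun x => by
      simpa using (norm_sub_le _ _).trans (add_le_add (hf' x) (hf x))) (by simp)
  rw [map_smul, ← hsub] at h2
  rw [← hadd] at h1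
  simp at h1 h2
  apply Complex.ext
  · simp; linarith
  · simp; linarith

/-- The weak average of a bounded family of operators. -/
theorem exists_average {E F : Type*} [NormedAddCommGroup E] [InnerProductSpace ℂ E]
    [NormedAddCommGroup F] [InnerProductSpace ℂ F] [CompleteSpace F] (S : Γ → E →L[ℂ] F) {C : ℝ}
    (hS : ∀ g v, ‖S g v‖ ≤ C * ‖v‖) :
    ∃ T : E →L[ℂ] F, ∀ v w, ⟪T v, w⟫_ℂ = M.avg fun g => ⟪S g v, w⟫_ℂ := by
  have hb : ∀ v w g, ‖⟪S g v, w⟫_ℂ‖ ≤ C * ‖v‖ * ‖w‖ := fun v w g =>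
    (norm_inner_le_norm _ _).trans (mul_le_mul_of_nonneg_right (hS g v) (norm_nonneg w))
  let B : E →L⋆[ℂ] F →L[ℂ] ℂ :=
    LinearMap.mkContinuous₂ (LinearMap.mk₂'ₛₗ (starRingEnd ℂ) (RingHom.id ℂ)
      (fun v w => M.avg fun g => ⟪S g v, w⟫_ℂ)
      (fun v v' w => by
        rw [← map_add]
        congr 1
        ext g
        simp)
      (fun c v w => by
        rw [← map_smul]
        congr 1
        ext g
        simp [mul_comm])
      (fun v w w' => by
        rw [← map_add]
        congr 1
        ext g
        simp)
      (fun c v w => by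
        rw [← map_smul]
        congr 1
        ext g
        simp)) C
      (fun v w => M.norm_le _ _ (hb v w))
  refine ⟨((InnerProductSpace.toDual ℂ F).symm.toContinuousLinearEquiv :
    StrongDual ℂ F →L⋆[ℂ] F).comp B, fun v w => ?_⟩
  simp only [ContinuousLinearMap.comp_apply, ContinuousLinearEquiv.coe_coe,
    LinearIsometryEquiv.coe_toContinuousLinearEquiv, InnerProductSpace.toDual_symm_apply]
  rfl

end InvariantMean

/-- The bounded functions on a group with values in an inner product space. -/
def boundedFunctions (Γ H : Type*) [NormedAddCommGroup H] [InnerProductSpace ℂ H] :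
    Submodule ℂ (Γ → H) where
  carrier := {f | ∃ C, ∀ x, ‖f x‖ ≤ C}
  add_mem' := by
    rintro f g ⟨C, hC⟩ ⟨D, hD⟩
    exact ⟨C + D, fun x => (norm_add_le _ _).trans (add_le_add (hC x) (hD x))⟩
  zero_mem' := ⟨0, by simp⟩
  smul_mem' := by
    rintro c f ⟨C, hC⟩
    refine ⟨‖c‖ * C, fun x => ?_⟩
    rw [Pi.smul_apply, norm_smul]
    exact mul_le_mul_of_nonneg_left (hC x) (norm_nonneg c)

variable (H : Type*) [NormedAddCommGroup H] [InnerProductSpace ℂ H]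

set_option linter.unusedVariables false in
/-- The bounded functions with the semi-inner product given by a mean. -/
def MeanSpace (M : InvariantMean Γ) (H : Type*) [NormedAddCommGroup H] [InnerProductSpace ℂ H] :
    Type _ :=
  boundedFunctions Γ H

namespace MeanSpace

instance : AddCommGroup (MeanSpace M H) := inferInstanceAs (AddCommGroup (boundedFunctions Γ H))

noncomputable instance : Module ℂ (MeanSpace M H) :=
  inferInstanceAs (Module ℂ (boundedFunctions Γ H))

variable {M H}

/-- The function underlying an element of `MeanSpace`. -/
def val : MeanSpace M H →ₗ[ℂ] (Γ → H) := (boundedFunctions Γ H).subtype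

/-- A bounded function as an element of `MeanSpace`. -/
def mk (f : Γ → H) (hf : ∃ C, ∀ x, ‖f x‖ ≤ C) : MeanSpace M H := ⟨f, hf⟩

@[simp]
theorem val_mk (f : Γ → H) (hf : ∃ C, ∀ x, ‖f x‖ ≤ C) : val (mk f hf : MeanSpace M H) = f := rfl

theorem val_injective : Function.Injective (val : MeanSpace M H → Γ → H) :=
  Subtype.val_injective

theorem exists_bound (f : MeanSpace M H) : ∃ C, ∀ x, ‖val f x‖ ≤ C := f.2

theorem exists_inner_bound (f g : MeanSpace M H) :
    ∃ C, ∀ x, ‖⟪val f x, val g x⟫_ℂ‖ ≤ C := by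
  obtain ⟨C, hC⟩ := exists_bound f
  obtain ⟨D, hD⟩ := exists_bound g
  refine ⟨C * D, fun x => (norm_inner_le_norm _ _).trans ?_⟩
  exact mul_le_mul (hC x) (hD x) (norm_nonneg _) ((norm_nonneg _).trans (hC x))

variable (M H) in
/-- The semi-inner product given by a mean. -/
noncomputable abbrev core : PreInnerProductSpace.Core ℂ (MeanSpace M H) where
  inner f g := M.avg fun x => ⟪val f x, val g x⟫_ℂ
  conj_inner_symm f g := by
    obtain ⟨C, hC⟩ := exists_inner_bound g f
    rw [← M.avg_conj hC]
    simp
  re_inner_nonneg f := by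
    obtain ⟨C, hC⟩ := exists_inner_bound f f
    exact M.re_nonneg _ C hC fun x => inner_self_nonneg (𝕜 := ℂ)
  add_left f g h := by
    rw [← map_add]
    congr 1
    ext x
    simp
  smul_left f g c := by
    rw [← smul_eq_mul, ← map_smul]
    congr 1
    ext x
    simp [mul_comm]

noncomputable instance : SeminormedAddCommGroup (MeanSpace M H) :=
  InnerProductSpace.Core.toSeminormedAddCommGroup (c := core M H)

noncomputable instance : InnerProductSpace ℂ (MeanSpace M H) :=
  InnerProductSpace.ofCore (core M H)

theorem inner_def (f g : MeanSpace M H) :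
    ⟪f, g⟫_ℂ = M.avg fun x => ⟪val f x, val g x⟫_ℂ := rfl

theorem norm_sq (f : MeanSpace M H) :
    ‖f‖ ^ 2 = (M.avg fun x => ⟪val f x, val f x⟫_ℂ).re := by
  rw [← inner_def, ← inner_self_eq_norm_sq (𝕜 := ℂ) f]
  rfl

/-- Left translation. -/
noncomputable def translate (g : Γ) : MeanSpace M H →ₗᵢ[ℂ] MeanSpace M H where
  toFun f := mk (fun x => val f (g⁻¹ * x)) (by
    obtain ⟨C, hC⟩ := exists_bound f
    exact ⟨C, fun x => hC _⟩)
  map_add' f f' := val_injective (by ext x; simp)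
  map_smul' c f := val_injective (by ext x; simp)
  norm_map' f := by
    obtain ⟨C, hC⟩ := exists_inner_bound f f
    rw [← sq_eq_sq₀ (norm_nonneg _) (norm_nonneg _), norm_sq, norm_sq]
    exact congrArg Complex.re (M.map_mul_left _ C hC g⁻¹)

@[simp]
theorem val_translate (g : Γ) (f : MeanSpace M H) (x : Γ) :
    val (translate g f) x = val f (g⁻¹ * x) := rfl

open UniformSpace Completion in
/-- The unitary representation by left translations on the completion of `MeanSpace`. -/
noncomputable def translation :
    Γ →* (Completion (MeanSpace M H) →ₗᵢ[ℂ] Completion (MeanSpace M H)) where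
  toFun g :=
    { toLinearMap := (translate g).toContinuousLinearMap.completion.toLinearMap
      norm_map' := fun v => by
        induction v using induction_on with
        | hp => apply isClosed_eq <;> fun_prop
        | ih f => simp }
  map_one' := by
    ext v
    induction v using induction_on with
    | hp => apply isClosed_eq <;> fun_prop
    | ih f =>
      simp
      congr 1
      exact val_injective (by ext x; simp)
  map_mul' g h := by
    ext v
    induction v using induction_on with
    | hp => apply isClosed_eq <;> fun_prop
    | ih f =>
      simp
      congr 1
      exact val_injective (by ext x; simp [mul_assoc])

theorem translation_coe (g : Γ) (f : MeanSpace M H) :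
    translation g (f : UniformSpace.Completion (MeanSpace M H)) = translate g f := by
  simp [translation]

end MeanSpace

/-- An approximate representation is close to a genuine one on a larger Hilbert space. -/
theorem exists_dilation.{u, v} {Γ : Type u} [Group Γ] (M : InvariantMean Γ) {H : Type v}
    [NormedAddCommGroup H] [InnerProductSpace ℂ H] (φ : Γ → H →ₗᵢ[ℂ] H) :
    ∃ (K : Type (max u v)) (_ : NormedAddCommGroup K) (_ : InnerProductSpace ℂ K) (_ : CompleteSpace K)
      (Θ : Γ →* (K →ₗᵢ[ℂ] K)) (W : H →ₗᵢ[ℂ] K),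
      ∀ (k : ℕ) (b : Fin k → H) (g : Γ) (c : ℝ),
        (∀ h, ∑ i, ‖φ h (φ g (b i)) - φ (h * g) (b i)‖ ^ 2 ≤ c) →
          ∑ i, ‖W (φ g (b i)) - Θ g (W (b i))‖ ^ 2 ≤ c := by
  let W₀ : H →ₗᵢ[ℂ] MeanSpace M H :=
    { toFun := fun v => MeanSpace.mk (fun x => φ x⁻¹ v) ⟨‖v‖, fun x => by simp⟩
      map_add' := fun v w => MeanSpace.val_injective (by ext x; simp)
      map_smul' := fun c v => MeanSpace.val_injective (by ext x; simp)
      norm_map' := fun v => by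
        rw [← sq_eq_sq₀ (norm_nonneg _) (norm_nonneg _), MeanSpace.norm_sq]
        change (M.avg fun x => ⟪φ x⁻¹ v, φ x⁻¹ v⟫_ℂ).re = _
        simp only [LinearIsometry.inner_map_map, M.avg_const]
        exact inner_self_eq_norm_sq (𝕜 := ℂ) v }
  refine ⟨UniformSpace.Completion (MeanSpace M H), inferInstance, inferInstance, inferInstance,
    MeanSpace.translation, UniformSpace.Completion.toComplₗᵢ.comp W₀, fun k b g c hc => ?_⟩
  have h1 : ∀ i, ‖UniformSpace.Completion.toComplₗᵢ.comp W₀ (φ g (b i)) -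
      MeanSpace.translation g (UniformSpace.Completion.toComplₗᵢ.comp W₀ (b i))‖ ^ 2 =
      (M.avg fun x => ⟪φ x⁻¹ (φ g (b i)) - φ (x⁻¹ * g) (b i),
        φ x⁻¹ (φ g (b i)) - φ (x⁻¹ * g) (b i)⟫_ℂ).re := by
    intro i
    change ‖((W₀ (φ g (b i)) : MeanSpace M H) : UniformSpace.Completion (MeanSpace M H)) -
      MeanSpace.translation g ((W₀ (b i) : MeanSpace M H) :
        UniformSpace.Completion (MeanSpace M H))‖ ^ 2 = _
    rw [MeanSpace.translation_coe, ← UniformSpace.Completion.coe_sub,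
      UniformSpace.Completion.norm_coe, MeanSpace.norm_sq]
    simp [W₀, map_sub]
  simp only [h1]
  rw [← Complex.re_sum, ← map_sum]
  refine M.re_avg_le (C := c) (fun x => ?_) (fun x => ?_)
  · simp only [Finset.sum_apply, inner_self_eq_norm_sq_to_K]
    refine (norm_sum_le _ _).trans (le_trans (le_of_eq ?_) (hc x⁻¹))
    simp
  · simp only [Finset.sum_apply, Complex.re_sum]
    refine le_trans (le_of_eq (Finset.sum_congr rfl fun i _ => ?_)) (hc x⁻¹)
    exact inner_self_eq_norm_sq (𝕜 := ℂ) _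

end Averaging

section InvariantSubspace

open scoped InnerProductSpace ComplexConjugate

variable {K : Type*} [NormedAddCommGroup K] [InnerProductSpace ℂ K]

theorem exists_spectral_subspace [CompleteSpace K] {T : K →L[ℂ] K} (hT : IsSelfAdjoint T)
    (a : ℝ) :
    ∃ E : Submodule ℂ K, (∀ v ∈ E, a * ‖v‖ ^ 2 ≤ (⟪T v, v⟫_ℂ).re) ∧
      (∀ v ∈ Eᗮ, (⟪T v, v⟫_ℂ).re ≤ a * ‖v‖ ^ 2) ∧
      ∀ S : K →L[ℂ] K, Commute T S → ∀ v ∈ E, S v ∈ E := by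
  set S : K →L[ℂ] K := T - (a : ℂ) • 1 with hS
  have hSsa : IsSelfAdjoint S := by
    refine hT.sub ?_
    rw [isSelfAdjoint_iff, star_smul, star_one]
    simp
  have hsub : S⁺ - S⁻ = S := CFC.posPart_sub_negPart S hSsa
  have hSv : ∀ v, S v = S⁺ v - S⁻ v := fun v => by rw [← sub_apply, hsub]
  have hpos : (S⁺).IsPositive :=
    (ContinuousLinearMap.nonneg_iff_isPositive _).1 (CFC.posPart_nonneg S)
  have hneg : (S⁻).IsPositive :=
    (ContinuousLinearMap.nonneg_iff_isPositive _).1 (CFC.negPart_nonneg S)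
  have hNP : S⁻ * S⁺ = 0 := CFC.negPart_mul_posPart S
  have hST : ∀ v, (⟪T v, v⟫_ℂ).re = (⟪S v, v⟫_ℂ).re + a * ‖v‖ ^ 2 := by
    intro v
    have h : ⟪v, v⟫_ℂ = ((‖v‖ ^ 2 : ℝ) : ℂ) := by
      rw [inner_self_eq_norm_sq_to_K]
      push_cast
      rfl
    simp only [hS, sub_apply, smul_apply, one_apply_eq_self,
      inner_sub_left, inner_smul_left, Complex.conj_ofReal, h, Complex.sub_re,
      Complex.re_ofReal_mul, Complex.ofReal_re]
    ring
  refine ⟨LinearMap.range (S⁺).toLinearMap, ?_, ?_, ?_⟩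
  · rintro _ ⟨u, rfl⟩
    rw [hST]
    have h0 : S⁻ (S⁺ u) = 0 := by
      rw [← mul_apply_eq_comp, hNP, zero_apply]
    have h1 : S (S⁺ u) = S⁺ (S⁺ u) := by
      rw [hSv, h0, sub_zero]
    have h2 := hpos.re_inner_nonneg_left (S⁺ u)
    change _ ≤ (⟪S (S⁺ u), S⁺ u⟫_ℂ).re + _
    rw [h1]
    simpa using h2
  · intro v hv
    have h0 : S⁺ v = 0 := by
      refine ext_inner_right ℂ fun w => ?_
      have h1 := (Submodule.mem_orthogonal' _ _).1 hv (S⁺ w) ⟨w, rfl⟩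
      rw [inner_zero_left, ← h1]
      exact hpos.isSymmetric v w
    have h1 : S v = - S⁻ v := by
      rw [hSv, h0, zero_sub]
    have h2 := hneg.re_inner_nonneg_left v
    rw [hST, h1]
    simpa using h2
  · rintro R hR _ ⟨u, rfl⟩
    have h1 : Commute S R := by
      rw [hS]
      exact hR.sub_left ((Commute.one_left R).smul_left _)
    have h2 : Commute S⁺ R := Commute.cfcₙ_real h1 _
    exact ⟨R u, DFunLike.congr_fun h2.eq u⟩

theorem finiteDimensional_of_orthonormal_card_le (E : Submodule ℂ K) (N : ℕ)
    (h : ∀ (k : ℕ) (u : Fin k → K), Orthonormal ℂ u → (∀ i, u i ∈ E) → k ≤ N) :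
    FiniteDimensional ℂ E := by
  by_contra hE
  have hrank : ((N + 1 : ℕ) : Cardinal) ≤ Module.rank ℂ E := by
    refine le_trans (Cardinal.natCast_lt_aleph0).le ?_
    rw [← not_lt]
    exact fun h' => hE (Module.rank_lt_aleph0_iff.1 h')
  obtain ⟨s, hs, hli⟩ := le_rank_iff_exists_linearIndependent_finset.1 hrank
  have hf := finrank_span_finset_eq_card (R := ℂ) hli
  let b := stdOrthonormalBasis ℂ (Submodule.span ℂ (s : Set E))
  have hb := (b.orthonormal.comp_linearIsometry (Submodule.subtypeₗᵢ _)).comp_linearIsometry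
    E.subtypeₗᵢ
  have := h _ _ hb fun i => (b i).1.2
  rw [hf, hs] at this
  omega

/-- Averaging the conjugates of a finite rank projection over the group. -/
theorem InvariantMean.exists_average_projection [CompleteSpace K] {Γ : Type*} [Group Γ]
    (M : InvariantMean Γ) (Θ : Γ →* (K →ₗᵢ[ℂ] K)) {n : ℕ} {w : Fin n → K}
    (hw : Orthonormal ℂ w) :
    ∃ T : K →L[ℂ] K, IsSelfAdjoint T ∧ (∀ g v, T (Θ g v) = Θ g (T v)) ∧
      (∀ v, (⟪T v, v⟫_ℂ).re ≤ ‖v‖ ^ 2) ∧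
      (∀ (ι : Type) [Fintype ι] (u : ι → K), Orthonormal ℂ u →
        ∑ i, (⟪T (u i), u i⟫_ℂ).re ≤ n) ∧
      ∀ c, (∀ g, ∑ j, (1 - ∑ i, ‖⟪w i, Θ g (w j)⟫_ℂ‖ ^ 2) ≤ c) →
        n - c ≤ ∑ i, (⟪T (w i), w i⟫_ℂ).re := by
  have hΘw : ∀ g, Orthonormal ℂ (Θ g ∘ w) := fun g => hw.comp_linearIsometry (Θ g)
  let S : Γ → K →L[ℂ] K := fun g => ∑ j, InnerProductSpace.rankOne ℂ (Θ g (w j)) (Θ g (w j))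
  have hSa : ∀ g v, S g v = ∑ j, ⟪Θ g (w j), v⟫_ℂ • Θ g (w j) := fun g v => by simp [S]
  have hSn : ∀ g v, ‖S g v‖ ≤ n * ‖v‖ := by
    intro g v
    rw [hSa]
    refine (norm_sum_le_of_le (f := fun j => ⟪Θ g (w j), v⟫_ℂ • Θ g (w j))
      (n := fun _ => ‖v‖) Finset.univ fun j _ => ?_).trans (by simp)
    have h1 : ‖Θ g (w j)‖ = 1 := (hΘw g).1 j
    rw [norm_smul, h1, mul_one]
    simpa [h1] using norm_inner_le_norm (𝕜 := ℂ) (Θ g (w j)) v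
  obtain ⟨T, hT⟩ := M.exists_average S hSn
  have hSb : ∀ v u g, ‖⟪S g v, u⟫_ℂ‖ ≤ n * ‖v‖ * ‖u‖ := fun v u g =>
    (norm_inner_le_norm _ _).trans (mul_le_mul_of_nonneg_right (hSn g v) (norm_nonneg u))
  have hSvv : ∀ g v, (⟪S g v, v⟫_ℂ).re = ∑ j, ‖⟪Θ g (w j), v⟫_ℂ‖ ^ 2 := by
    intro g v
    rw [hSa, sum_inner, Complex.re_sum]
    refine Finset.sum_congr rfl fun j _ => ?_
    rw [inner_smul_left, ← Complex.normSq_eq_conj_mul_self, Complex.ofReal_re,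
      Complex.normSq_eq_norm_sq]
  have hSsymm : ∀ g v u, ⟪S g v, u⟫_ℂ = conj ⟪S g u, v⟫_ℂ := by
    intro g v u
    simp only [hSa, sum_inner, inner_smul_left, map_sum, map_mul, inner_conj_symm]
    exact Finset.sum_congr rfl fun j _ => mul_comm _ _
  have hΘS : ∀ h g v, Θ h (S g v) = S (h * g) (Θ h v) := by
    intro h g v
    simp only [hSa, map_sum, map_smul, map_mul, LinearIsometry.coe_mul, Function.comp_apply,
      LinearIsometry.inner_map_map]
  have hΘinv : ∀ g v, Θ g (Θ g⁻¹ v) = v := fun g v => by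
    rw [← Function.comp_apply (f := Θ g), ← LinearIsometry.coe_mul, ← map_mul]
    simp
  refine ⟨T, ?_, ?_, ?_, ?_, ?_⟩
  · rw [ContinuousLinearMap.isSelfAdjoint_iff_isSymmetric]
    intro v u
    change ⟪T v, u⟫_ℂ = ⟪v, T u⟫_ℂ
    rw [← inner_conj_symm v, hT, hT, ← M.avg_conj (hSb u v)]
    congr 1
    ext g
    exact hSsymm g v u
  · intro h v
    refine ext_inner_right ℂ fun u => ?_
    have h1 : ⟪Θ h (T v), u⟫_ℂ = ⟪T v, Θ h⁻¹ u⟫_ℂ := by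
      rw [← (Θ h).inner_map_map (T v), hΘinv]
    rw [h1, hT, hT, ← M.map_mul_left _ _ (hSb (Θ h v) u) h]
    congr 1
    ext g
    rw [← hΘS, ← (Θ h).inner_map_map (S g v), hΘinv]
  · intro v
    rw [hT]
    refine M.re_avg_le (hSb v v) fun g => ?_
    rw [hSvv]
    exact (hΘw g).sum_inner_products_le v
  · intro ι _ u hu
    rw [← Complex.re_sum]
    simp only [hT]
    rw [← map_sum]
    refine M.re_avg_le (C := ∑ i, n * ‖u i‖ * ‖u i‖) (fun g => ?_) fun g => ?_
    · rw [Finset.sum_apply]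
      exact norm_sum_le_of_le _ fun i _ => hSb _ _ g
    · rw [Finset.sum_apply, Complex.re_sum]
      simp only [hSvv]
      rw [Finset.sum_comm]
      calc _ ≤ ∑ j : Fin n, (1 : ℝ) := Finset.sum_le_sum fun j _ => by
            have := hu.sum_inner_products_le (s := Finset.univ) (Θ g (w j))
            have h1 : ‖Θ g (w j)‖ = 1 := (hΘw g).1 j
            rw [h1, one_pow] at this
            simpa only [norm_inner_symm] using this
        _ = n := by simp
  · intro c hc
    rw [← Complex.re_sum]
    simp only [hT]
    rw [← map_sum]
    refine M.le_re_avg (C := ∑ i, n * ‖w i‖ * ‖w i‖) (fun g => ?_) fun g => ?_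
    · rw [Finset.sum_apply]
      exact norm_sum_le_of_le _ fun i _ => hSb _ _ g
    · rw [Finset.sum_apply, Complex.re_sum]
      simp only [hSvv]
      rw [Finset.sum_comm]
      have := hc g
      rw [Finset.sum_sub_distrib] at this
      simp only [Finset.sum_const, Finset.card_univ, Fintype.card_fin, nsmul_eq_mul, mul_one]
        at this
      simp only [norm_inner_symm (Θ g _)]
      linarith

/-- An almost invariant finite-dimensional subspace is close to a finite-dimensional invariant
one. -/
theorem InvariantMean.exists_invariant_subspace [CompleteSpace K] {Γ : Type*} [Group Γ]
    (M : InvariantMean Γ) (Θ : Γ →* (K →ₗᵢ[ℂ] K)) {n : ℕ} {w : Fin n → K}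
    (hw : Orthonormal ℂ w) {c : ℝ}
    (hc : ∀ g, ∑ j, (1 - ∑ i, ‖⟪w i, Θ g (w j)⟫_ℂ‖ ^ 2) ≤ c) :
    ∃ (E : Submodule ℂ K) (_ : FiniteDimensional ℂ E), (∀ g, ∀ v ∈ E, Θ g v ∈ E) ∧
      (Module.finrank ℂ E : ℝ) ≤ n + 4 * c ∧
      ∑ i, ‖w i - E.starProjection (w i)‖ ^ 2 ≤ 4 / 3 * c := by
  obtain ⟨T, hTsa, hTΘ, hT1, hTtr, hTw⟩ := M.exists_average_projection Θ hw
  obtain ⟨E, hE, hE', hEinv⟩ := exists_spectral_subspace hTsa (1 / 4)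
  have hEfd : FiniteDimensional ℂ E := by
    refine finiteDimensional_of_orthonormal_card_le E (4 * n) fun k u hu huE => ?_
    have h1 := hTtr (Fin k) u hu
    have h2 : ∑ i : Fin k, (1 / 4 : ℝ) ≤ ∑ i, (⟪T (u i), u i⟫_ℂ).re :=
      Finset.sum_le_sum fun i _ => by simpa [hu.1 i] using hE (u i) (huE i)
    simp at h2
    have h3 : (k : ℝ) ≤ 4 * n := by linarith
    exact_mod_cast h3
  have hTE : ∀ v ∈ E, T v ∈ E := hEinv T (Commute.refl T)
  have hTw' := hTw c hc
  refine ⟨E, hEfd, fun g v hv => ?_, ?_, ?_⟩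
  · exact hEinv (Θ g).toContinuousLinearMap
      (ContinuousLinearMap.ext fun u => hTΘ g u) v hv
  · let Y : Submodule ℂ K := Submodule.span ℂ (Set.range fun i => E.starProjection (w i))
    have hYE : Y ≤ E := by
      rw [Submodule.span_le]
      rintro _ ⟨i, rfl⟩
      exact E.starProjection_apply_mem _
    have hY : Module.finrank ℂ Y ≤ n := by
      have := finrank_range_le_card (R := ℂ) (fun i => E.starProjection (w i))
      rwa [Fintype.card_fin] at this
    have hfr := Submodule.finrank_add_inf_finrank_orthogonal hYE
    have : FiniteDimensional ℂ ↥(Yᗮ ⊓ E) :=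
      Submodule.finiteDimensional_of_le (inf_le_right : Yᗮ ⊓ E ≤ E)
    let b := stdOrthonormalBasis ℂ ↥(Yᗮ ⊓ E)
    have hb := b.orthonormal.comp_linearIsometry (Submodule.subtypeₗᵢ _)
    have hperp : ∀ i j, ⟪w i, (b j : K)⟫_ℂ = 0 := by
      intro i j
      have h1 : ⟪E.starProjection (w i), (b j : K)⟫_ℂ = 0 :=
        (Submodule.mem_orthogonal _ _).1 (b j).2.1 _ (Submodule.subset_span ⟨i, rfl⟩)
      have h2 := E.starProjection_inner_eq_zero (w i) (b j : K) (b j).2.2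
      rw [inner_sub_left, h1, sub_zero] at h2
      exact h2
    have hsum : Orthonormal ℂ (Sum.elim w fun j => (b j : K)) := by
      refine ⟨?_, ?_⟩
      · rintro (i | j)
        · exact hw.1 i
        · exact hb.1 j
      · rintro (i | i) (j | j) hij
        · exact hw.2 fun h => hij (h ▸ rfl)
        · exact hperp i j
        · exact inner_eq_zero_symm.1 (hperp j i)
        · exact hb.2 fun h => hij (h ▸ rfl)
    have h1 := hTtr _ _ hsum
    rw [Fintype.sum_sum_type] at h1
    simp only [Sum.elim_inl, Sum.elim_inr] at h1
    have h2 : ∑ j : Fin (Module.finrank ℂ ↥(Yᗮ ⊓ E)), (1 / 4 : ℝ) ≤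
        ∑ j, (⟪T (b j : K), (b j : K)⟫_ℂ).re :=
      Finset.sum_le_sum fun j _ => by
        have h3 : ‖(b j : K)‖ = 1 := hb.1 j
        simpa [h3] using hE (b j) (b j).2.2
    simp only [Finset.sum_const, Finset.card_univ, Fintype.card_fin, nsmul_eq_mul] at h2
    rw [← hfr]
    push_cast
    have h4 : (Module.finrank ℂ Y : ℝ) ≤ n := by exact_mod_cast hY
    linarith
  · have key : ∀ v, ‖v - E.starProjection v‖ ^ 2 ≤ 4 / 3 * (‖v‖ ^ 2 - (⟪T v, v⟫_ℂ).re) := by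
      intro v
      set q := E.starProjection v with hq
      set r := v - q with hr
      have hqE : q ∈ E := E.starProjection_apply_mem v
      have hrE : r ∈ Eᗮ := E.sub_starProjection_mem_orthogonal v
      have hv : v = q + r := by rw [hr]; abel
      have h1 : ⟪T q, r⟫_ℂ = 0 := (Submodule.mem_orthogonal _ _).1 hrE _ (hTE q hqE)
      have h2 : ⟪T r, q⟫_ℂ = 0 := by
        have h3 : ⟪T r, q⟫_ℂ = ⟪r, T q⟫_ℂ :=
          (ContinuousLinearMap.isSelfAdjoint_iff_isSymmetric.1 hTsa) r q
        rw [h3]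
        exact inner_eq_zero_symm.1 h1
      have h3 : ‖v‖ ^ 2 = ‖q‖ ^ 2 + ‖r‖ ^ 2 := by
        have h4 : ⟪q, r⟫_ℂ = 0 := (Submodule.mem_orthogonal _ _).1 hrE _ hqE
        have := norm_add_sq_eq_norm_sq_add_norm_sq_of_inner_eq_zero q r h4
        rw [hv, sq, sq, sq, this]
      have h5 : ⟪T v, v⟫_ℂ = ⟪T q, q⟫_ℂ + ⟪T r, r⟫_ℂ := by
        rw [hv, map_add, inner_add_left, inner_add_right, inner_add_right, h1, h2]
        ring
      rw [h5, h3, Complex.add_re]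
      linarith [hT1 q, hE' r hrE]
    calc _ ≤ ∑ i, 4 / 3 * (‖w i‖ ^ 2 - (⟪T (w i), w i⟫_ℂ).re) :=
          Finset.sum_le_sum fun i _ => key (w i)
      _ = 4 / 3 * (n - ∑ i, (⟪T (w i), w i⟫_ℂ).re) := by
          rw [← Finset.mul_sum, Finset.sum_sub_distrib]
          simp [hw.1]
      _ ≤ 4 / 3 * c := by linarith

end InvariantSubspace

section FiniteDimensional

open scoped InnerProductSpace ComplexConjugate

variable {E F : Type*} [NormedAddCommGroup E] [InnerProductSpace ℂ E]
  [NormedAddCommGroup F] [InnerProductSpace ℂ F]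

/-- The Hilbert–Schmidt norm of an operator does not depend on the orthonormal basis. -/
theorem OrthonormalBasis.sum_norm_sq_map_eq {ι ι' : Type*} [Fintype ι] [Fintype ι']
    (b : OrthonormalBasis ι ℂ E) (b' : OrthonormalBasis ι' ℂ E) (A : E →ₗ[ℂ] F) :
    ∑ i, ‖A (b i)‖ ^ 2 = ∑ j, ‖A (b' j)‖ ^ 2 := by
  have hn : ∀ v : F, ⟪v, v⟫_ℂ = ((‖v‖ ^ 2 : ℝ) : ℂ) := fun v => by
    rw [inner_self_eq_norm_sq_to_K]
    push_cast
    rfl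
  have hA : ∀ v, A v = ∑ j, ⟪b' j, v⟫_ℂ • A (b' j) := fun v => by
    conv_lhs => rw [← b'.sum_repr' v]
    simp
  have key : (∑ i, ⟪A (b i), A (b i)⟫_ℂ) = ∑ j, ⟪A (b' j), A (b' j)⟫_ℂ := by
    calc _ = ∑ i, ∑ j, ∑ k, ⟪b i, b' j⟫_ℂ * ⟪b' k, b i⟫_ℂ * ⟪A (b' j), A (b' k)⟫_ℂ := by
          refine Finset.sum_congr rfl fun i _ => ?_
          rw [hA (b i), sum_inner]
          refine Finset.sum_congr rfl fun j _ => ?_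
          rw [inner_sum]
          refine Finset.sum_congr rfl fun k _ => ?_
          rw [inner_smul_left, inner_smul_right, inner_conj_symm]
          ring
      _ = ∑ j, ∑ k, (∑ i, ⟪b' k, b i⟫_ℂ * ⟪b i, b' j⟫_ℂ) * ⟪A (b' j), A (b' k)⟫_ℂ := by
          rw [Finset.sum_comm]
          refine Finset.sum_congr rfl fun j _ => ?_
          rw [Finset.sum_comm]
          refine Finset.sum_congr rfl fun k _ => ?_
          rw [Finset.sum_mul]
          exact Finset.sum_congr rfl fun i _ => by ring
      _ = _ := by
          classical
          refine Finset.sum_congr rfl fun j _ => ?_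
          simp only [b.sum_inner_mul_inner, orthonormal_iff_ite.1 b'.orthonormal, ite_mul,
            one_mul, zero_mul]
          simp
  simp only [hn] at key
  exact_mod_cast key

/-- A contraction between spaces of the same finite dimension is close to an isometry. -/
theorem exists_linearIsometry_near_contraction [FiniteDimensional ℂ E] [FiniteDimensional ℂ F]
    (hEF : Module.finrank ℂ F = Module.finrank ℂ E) (X : E →ₗ[ℂ] F) (hX : ∀ v, ‖X v‖ ≤ ‖v‖) :
    ∃ U : E →ₗᵢ[ℂ] F, ∀ {ι : Type} [Fintype ι] (b : OrthonormalBasis ι ℂ E),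
      ∑ i, ‖U (b i) - X (b i)‖ ^ 2 ≤ ∑ i, (1 - ‖X (b i)‖ ^ 2) := by
  have hsymm : (LinearMap.adjoint X ∘ₗ X).IsSymmetric :=
    (LinearMap.isPositive_adjoint_comp_self X).isSymmetric
  let e := hsymm.eigenvectorBasis rfl
  have horth : ∀ i j, i ≠ j → ⟪X (e i), X (e j)⟫_ℂ = 0 := by
    intro i j hij
    have h := hsymm.apply_eigenvectorBasis rfl j
    rw [← LinearMap.adjoint_inner_right, ← LinearMap.comp_apply]
    change ⟪e i, (LinearMap.adjoint X ∘ₗ X) (e j)⟫_ℂ = 0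
    rw [h, inner_smul_right]
    have := e.orthonormal.2 hij
    change _ * ⟪e i, e j⟫_ℂ = 0
    rw [this, mul_zero]
  let s : Set (Fin (Module.finrank ℂ E)) := {i | X (e i) ≠ 0}
  let v : Fin (Module.finrank ℂ E) → F := fun i => ((‖X (e i)‖⁻¹ : ℝ) : ℂ) • X (e i)
  have hv : Orthonormal ℂ (s.domRestrict v) := by
    refine ⟨fun i => ?_, fun i j hij => ?_⟩
    · have : ‖X (e i)‖ ≠ 0 := norm_ne_zero_iff.2 i.2
      simp [v, norm_smul, this]
    · have : (i : Fin (Module.finrank ℂ E)) ≠ j := fun h => hij (Subtype.ext h)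
      simp [v, inner_smul_left, inner_smul_right, horth _ _ this]
  obtain ⟨f, hf⟩ := hv.exists_orthonormalBasis_extension_of_card_eq (by simpa using hEF)
  let U : E ≃ₗᵢ[ℂ] F := e.equiv f (Equiv.refl _)
  have hU : ∀ i, U (e i) = f i := fun i => by simp [U]
  have hX1 : ∀ i, ‖X (e i)‖ ≤ 1 := fun i => by simpa using hX (e i)
  have hXf : ∀ i, X (e i) = ((‖X (e i)‖ : ℝ) : ℂ) • f i := by
    intro i
    by_cases hi : X (e i) = 0
    · simp [hi]
    · have h0 : ((‖X (e i)‖ : ℝ) : ℂ) ≠ 0 := by simpa using hi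
      rw [hf i hi, smul_smul, Complex.ofReal_inv, mul_inv_cancel₀ h0, one_smul]
  refine ⟨U.toLinearIsometry, fun {ι} _ b => ?_⟩
  have h1 := b.sum_norm_sq_map_eq e (U.toLinearEquiv.toLinearMap - X)
  have h2 := b.sum_norm_sq_map_eq e X
  have h3 := b.sum_norm_sq_map_eq e LinearMap.id
  simp only [LinearMap.id_apply, OrthonormalBasis.norm_eq_one] at h3
  simp only [one_pow] at h3
  rw [Finset.sum_sub_distrib, h2, h3, ← Finset.sum_sub_distrib]
  refine h1.le.trans (Finset.sum_le_sum fun i _ => ?_)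
  have h4 : (U.toLinearEquiv.toLinearMap - X) (e i) = ((1 - ‖X (e i)‖ : ℝ) : ℂ) • f i := by
    change U (e i) - X (e i) = _
    rw [hU]
    conv_lhs => rw [hXf i]
    push_cast
    rw [sub_smul, one_smul]
  rw [h4, norm_smul, f.norm_eq_one, Complex.norm_real, mul_one, Real.norm_eq_abs, sq_abs]
  nlinarith [norm_nonneg (X (e i)), hX1 i]

end FiniteDimensional

section UnitaryGroup

open scoped InnerProductSpace ComplexConjugate

/-- The isometry of `ℂⁿ` given by a unitary matrix. -/
noncomputable def unitaryIsometry (n : ℕ) :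
    Matrix.unitaryGroup (Fin n) ℂ →*
      (EuclideanSpace ℂ (Fin n) →ₗᵢ[ℂ] EuclideanSpace ℂ (Fin n)) where
  toFun A := (Matrix.toEuclideanLin (A : Matrix (Fin n) (Fin n) ℂ)).isometryOfInner fun x y => by
    rw [← LinearMap.adjoint_inner_right, ← Matrix.toEuclideanLin_conjTranspose_eq_adjoint,
      ← LinearMap.comp_apply, ← Matrix.toLpLin_mul, ← Matrix.star_eq_conjTranspose,
      Matrix.UnitaryGroup.star_mul_self, Matrix.toLpLin_one, LinearMap.id_apply]
  map_one' := by
    ext1 v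
    change Matrix.toEuclideanLin (1 : Matrix (Fin n) (Fin n) ℂ) v = v
    rw [Matrix.toLpLin_one, LinearMap.id_apply]
  map_mul' A B := by
    ext1 v
    change Matrix.toEuclideanLin ((A : Matrix (Fin n) (Fin n) ℂ) * (B : Matrix (Fin n) (Fin n) ℂ)) v = _
    rw [Matrix.toLpLin_mul (q := 2)]
    rfl

theorem unitaryIsometry_bijective (n : ℕ) : Function.Bijective (unitaryIsometry n) := by
  refine ⟨fun A B h => Subtype.ext (Matrix.toEuclideanLin.injective ?_), fun U => ?_⟩
  · ext1 v
    exact DFunLike.congr_fun h v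
  · have hA : Matrix.toEuclideanLin (Matrix.toEuclideanLin.symm U.toLinearMap) = U.toLinearMap :=
      LinearEquiv.apply_symm_apply _ _
    refine ⟨⟨Matrix.toEuclideanLin.symm U.toLinearMap, ?_⟩, ?_⟩
    · rw [Matrix.mem_unitaryGroup_iff', Matrix.star_eq_conjTranspose]
      refine Matrix.toEuclideanLin.injective ?_
      rw [Matrix.toLpLin_mul (q := 2), Matrix.toEuclideanLin_conjTranspose_eq_adjoint, hA,
        Matrix.toLpLin_one]
      ext1 v
      refine ext_inner_right ℂ fun w => ?_
      rw [LinearMap.comp_apply, LinearMap.adjoint_inner_left]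
      exact U.inner_map_map v w
    · ext1 v
      exact DFunLike.congr_fun hA v

/-- Unitary matrices are the same as linear isometries of `ℂⁿ`. -/
noncomputable def unitaryIsometryEquiv (n : ℕ) :
    Matrix.unitaryGroup (Fin n) ℂ ≃*
      (EuclideanSpace ℂ (Fin n) →ₗᵢ[ℂ] EuclideanSpace ℂ (Fin n)) :=
  MulEquiv.ofBijective (unitaryIsometry n) (unitaryIsometry_bijective n)

theorem unitaryIsometryEquiv_apply {n : ℕ} (A : Matrix.unitaryGroup (Fin n) ℂ)
    (v : EuclideanSpace ℂ (Fin n)) :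
    unitaryIsometryEquiv n A v = Matrix.toEuclideanLin (A : Matrix (Fin n) (Fin n) ℂ) v :=
  rfl

theorem hsNorm_eq_sqrt_sum {n : ℕ} (A : Matrix (Fin n) (Fin n) ℂ) :
    hsNorm A = Real.sqrt (1 / n *
      ∑ i, ‖Matrix.toEuclideanLin A (EuclideanSpace.basisFun (Fin n) ℂ i)‖ ^ 2) := by
  rw [hsNorm, Matrix.trace, Complex.re_sum]
  congr 2
  simp only [EuclideanSpace.norm_sq_eq]
  rw [Finset.sum_comm]
  refine Finset.sum_congr rfl fun i _ => ?_
  rw [Matrix.diag_apply, Matrix.mul_apply, Complex.re_sum]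
  refine Finset.sum_congr rfl fun j _ => ?_
  rw [Matrix.conjTranspose_apply, Complex.star_def, Complex.mul_conj, Complex.ofReal_re,
    Complex.normSq_eq_norm_sq]
  simp [Matrix.toLpLin_apply]

theorem sum_le_of_hsNorm_lt {n : ℕ} {A : Matrix (Fin n) (Fin n) ℂ} {ε : ℝ} (h : hsNorm A < ε) :
    ∑ i, ‖Matrix.toEuclideanLin A (EuclideanSpace.basisFun (Fin n) ℂ i)‖ ^ 2 ≤ ε ^ 2 * n := by
  rcases Nat.eq_zero_or_pos n with rfl | hn
  · simp
  have hn' : (0 : ℝ) < n := Nat.cast_pos.2 hn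
  rw [hsNorm_eq_sqrt_sum] at h
  have h1 := (Real.sqrt_lt' ((Real.sqrt_nonneg _).trans_lt h)).1 h
  rw [one_div, inv_mul_lt_iff₀ hn'] at h1
  linarith

theorem hsNorm_lt_of_sum_le {n : ℕ} {A : Matrix (Fin n) (Fin n) ℂ} {ε c : ℝ} (hε : 0 < ε)
    (hc : c < ε ^ 2)
    (h : ∑ i, ‖Matrix.toEuclideanLin A (EuclideanSpace.basisFun (Fin n) ℂ i)‖ ^ 2 ≤ c * n) :
    hsNorm A < ε := by
  rw [hsNorm_eq_sqrt_sum, Real.sqrt_lt' hε]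
  rcases Nat.eq_zero_or_pos n with rfl | hn
  · simpa using pow_pos hε 2
  have hn' : (0 : ℝ) < n := Nat.cast_pos.2 hn
  rw [one_div, inv_mul_lt_iff₀ hn']
  nlinarith

theorem isIrreducibleRep_iff {Γ : Type*} [Group Γ] {n : ℕ}
    (π : Γ →* Matrix.unitaryGroup (Fin n) ℂ) :
    IsIrreducibleRep π ↔ ∀ W : Submodule ℂ (EuclideanSpace ℂ (Fin n)),
      (∀ g, ∀ v ∈ W, unitaryIsometryEquiv n (π g) v ∈ W) → W = ⊥ ∨ W = ⊤ := by
  let e := WithLp.linearEquiv 2 ℂ (Fin n → ℂ)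
  constructor
  · intro h W hW
    have := h (W.map e.toLinearMap) (by
      rintro g _ ⟨v, hv, rfl⟩
      exact ⟨_, hW g v hv, rfl⟩)
    refine this.imp (fun h => ?_) fun h => ?_
    · simpa using h
    · refine Submodule.eq_top_iff'.2 fun v => ?_
      have : e v ∈ W.map e.toLinearMap := by rw [h]; trivial
      obtain ⟨w, hw, hwv⟩ := this
      rwa [← e.injective hwv]
  · intro h W hW
    have := h (W.comap e.toLinearMap) fun g v hv => hW g _ hv
    refine this.imp (fun h => ?_) fun h => ?_
    · refine (Submodule.eq_bot_iff _).2 fun v hv => ?_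
      have : e.symm v ∈ W.comap e.toLinearMap := by simpa using hv
      rw [h, Submodule.mem_bot] at this
      simpa using this
    · refine Submodule.eq_top_iff'.2 fun v => ?_
      have : e.symm v ∈ W.comap e.toLinearMap := by rw [h]; trivial
      simpa using this

end UnitaryGroup

section Decomposition

open scoped InnerProductSpace ComplexConjugate

variable {Γ : Type*} [Group Γ] {K L : Type*} [NormedAddCommGroup K] [InnerProductSpace ℂ K]
  [NormedAddCommGroup L] [InnerProductSpace ℂ L]

/-- The restriction of a unitary representation to an invariant subspace. -/
def restrictIsometries (Θ : Γ →* (K →ₗᵢ[ℂ] K)) (E : Submodule ℂ K)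
    (hE : ∀ g, ∀ v ∈ E, Θ g v ∈ E) : Γ →* (E →ₗᵢ[ℂ] E) where
  toFun g := ⟨(Θ g).toLinearMap.restrict (hE g), fun v => (Θ g).norm_map v⟩
  map_one' := by
    ext1 v
    refine Subtype.ext ?_
    change Θ 1 (v : K) = v
    rw [map_one]
    rfl
  map_mul' g h := by
    ext1 v
    refine Subtype.ext ?_
    change Θ (g * h) (v : K) = Θ g (Θ h v)
    rw [map_mul]
    rfl

/-- The conjugate of a unitary representation by an isometric isomorphism. -/
def conjIsometries (Θ : Γ →* (L →ₗᵢ[ℂ] L)) (U : K ≃ₗᵢ[ℂ] L) : Γ →* (K →ₗᵢ[ℂ] K) where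
  toFun g := U.symm.toLinearIsometry.comp ((Θ g).comp U.toLinearIsometry)
  map_one' := by
    ext1 v
    simp
  map_mul' g h := by
    ext1 v
    simp

theorem conjIsometries_apply (Θ : Γ →* (L →ₗᵢ[ℂ] L)) (U : K ≃ₗᵢ[ℂ] L) (g : Γ) (v : K) :
    conjIsometries Θ U g v = U.symm (Θ g (U v)) :=
  rfl

theorem apply_apply_inv (Θ : Γ →* (K →ₗᵢ[ℂ] K)) (g : Γ) (v : K) : Θ g (Θ g⁻¹ v) = v := by
  rw [← Function.comp_apply (f := Θ g), ← LinearIsometry.coe_mul, ← map_mul]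
  simp

theorem map_mem_orthogonal (Θ : Γ →* (K →ₗᵢ[ℂ] K)) {E : Submodule ℂ K}
    (hE : ∀ g, ∀ v ∈ E, Θ g v ∈ E) (g : Γ) {v : K} (hv : v ∈ Eᗮ) : Θ g v ∈ Eᗮ := by
  refine (Submodule.mem_orthogonal _ _).2 fun u hu => ?_
  rw [← apply_apply_inv Θ g u, LinearIsometry.inner_map_map]
  exact (Submodule.mem_orthogonal _ _).1 hv _ (hE _ _ hu)

theorem finrank_le_of_minimal_invariant {d : ℕ}
    (hd : ∀ (k : ℕ) (π : Γ →* Matrix.unitaryGroup (Fin k) ℂ), IsIrreducibleRep π → k ≤ d)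
    (Θ : Γ →* (K →ₗᵢ[ℂ] K)) {E : Submodule ℂ K} [FiniteDimensional ℂ E]
    (hE : ∀ g, ∀ v ∈ E, Θ g v ∈ E)
    (hmin : ∀ S ≤ E, (∀ g, ∀ v ∈ S, Θ g v ∈ S) → S = ⊥ ∨ S = E) :
    Module.finrank ℂ E ≤ d := by
  let U := (stdOrthonormalBasis ℂ E).repr.symm
  let Ψ := conjIsometries (restrictIsometries Θ E hE) U
  refine hd _ ((unitaryIsometryEquiv _).symm.toMonoidHom.comp Ψ) ?_
  rw [isIrreducibleRep_iff]
  intro W hW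
  have hW' : ∀ g, ∀ v ∈ W, Ψ g v ∈ W := fun g v hv => by
    have := hW g v hv
    simpa using this
  let J : _ →ₗ[ℂ] K := E.subtype ∘ₗ U.toLinearEquiv.toLinearMap
  have hJ : Function.Injective J := E.injective_subtype.comp U.injective
  refine (hmin (W.map J) ?_ ?_).imp (fun h => ?_) fun h => ?_
  · rintro _ ⟨v, _, rfl⟩
    exact (U v).2
  · rintro g _ ⟨v, hv, rfl⟩
    refine ⟨Ψ g v, hW' g v hv, ?_⟩
    change ((U (U.symm (restrictIsometries Θ E hE g (U v))) : E) : K) = _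
    rw [LinearIsometryEquiv.apply_symm_apply]
    rfl
  · exact Submodule.map_injective_of_injective hJ (h.trans (Submodule.map_bot _).symm)
  · refine Submodule.eq_top_iff'.2 fun v => ?_
    have : J v ∈ W.map J := by
      rw [h]
      exact (U v).2
    obtain ⟨w, hw, hwv⟩ := this
    rwa [← hJ hwv]

theorem exists_small_invariant {d : ℕ}
    (hd : ∀ (k : ℕ) (π : Γ →* Matrix.unitaryGroup (Fin k) ℂ), IsIrreducibleRep π → k ≤ d)
    (Θ : Γ →* (K →ₗᵢ[ℂ] K)) (E : Submodule ℂ K) [FiniteDimensional ℂ E]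
    (hE : ∀ g, ∀ v ∈ E, Θ g v ∈ E) (hE0 : E ≠ ⊥) :
    ∃ S ≤ E, (∀ g, ∀ v ∈ S, Θ g v ∈ S) ∧ S ≠ ⊥ ∧ Module.finrank ℂ S ≤ d := by
  classical
  have hex : ∃ m, ∃ S ≤ E, (∀ g, ∀ v ∈ S, Θ g v ∈ S) ∧ S ≠ ⊥ ∧ Module.finrank ℂ S = m :=
    ⟨_, E, le_rfl, hE, hE0, rfl⟩
  obtain ⟨S, hSE, hS, hS0, hSm⟩ := Nat.find_spec hex
  have : FiniteDimensional ℂ S := Submodule.finiteDimensional_of_le hSE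
  refine ⟨S, hSE, hS, hS0, finrank_le_of_minimal_invariant hd Θ hS fun R hRS hR => ?_⟩
  refine or_iff_not_imp_left.2 fun hR0 => Submodule.eq_of_le_of_finrank_le hRS ?_
  rw [hSm]
  exact Nat.find_min' hex ⟨R, hRS.trans hSE, hR, hR0, rfl⟩

/-- When irreducible representations have dimension at most `d`, one can shrink an invariant
subspace by at least `j` and at most `d * j` dimensions. -/
theorem exists_invariant_le_of_finrank {d : ℕ}
    (hd : ∀ (k : ℕ) (π : Γ →* Matrix.unitaryGroup (Fin k) ℂ), IsIrreducibleRep π → k ≤ d)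
    (Θ : Γ →* (K →ₗᵢ[ℂ] K)) (E : Submodule ℂ K) [FiniteDimensional ℂ E]
    (hE : ∀ g, ∀ v ∈ E, Θ g v ∈ E) (j : ℕ) :
    ∃ E' ≤ E, (∀ g, ∀ v ∈ E', Θ g v ∈ E') ∧
      Module.finrank ℂ E' ≤ Module.finrank ℂ E - j ∧
      Module.finrank ℂ E ≤ Module.finrank ℂ E' + d * j := by
  induction j with
  | zero => exact ⟨E, le_rfl, hE, by simp, by simp⟩
  | succ j ih =>
    obtain ⟨E', hE'E, hE', h1, h2⟩ := ih
    have : FiniteDimensional ℂ E' := Submodule.finiteDimensional_of_le hE'E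
    by_cases h0 : E' = ⊥
    · refine ⟨E', hE'E, hE', ?_, h2.trans ?_⟩
      · rw [Submodule.finrank_eq_zero.2 h0]
        exact Nat.zero_le _
      · gcongr
        omega
    · obtain ⟨S, hSE, hS, hS0, hSd⟩ := exists_small_invariant hd Θ E' hE' h0
      have : FiniteDimensional ℂ S := Submodule.finiteDimensional_of_le hSE
      have hpos : Module.finrank ℂ S ≠ 0 := fun h => hS0 (Submodule.finrank_eq_zero.1 h)
      have hsum := Submodule.finrank_add_inf_finrank_orthogonal hSE
      refine ⟨Sᗮ ⊓ E', inf_le_right.trans hE'E,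
        fun g v hv => ⟨map_mem_orthogonal Θ hS g hv.1, hE' g v hv.2⟩, by omega, ?_⟩
      rw [mul_add]
      omega

theorem Orthonormal.sum_norm_sub_starProjection_le {n : ℕ} {w : Fin n → K}
    (hw : Orthonormal ℂ w) {E₀ E : Submodule ℂ K} [FiniteDimensional ℂ E₀]
    [FiniteDimensional ℂ E] (hE : E₀ ≤ E) :
    ∑ i, ‖w i - E₀.starProjection (w i)‖ ^ 2 ≤ ∑ i, ‖w i - E.starProjection (w i)‖ ^ 2 +
      ((Module.finrank ℂ E : ℝ) - Module.finrank ℂ E₀) := by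
  have hfr := Submodule.finrank_add_inf_finrank_orthogonal hE
  have : FiniteDimensional ℂ ↥(E₀ᗮ ⊓ E) :=
    Submodule.finiteDimensional_of_le (inf_le_right : E₀ᗮ ⊓ E ≤ E)
  let b := stdOrthonormalBasis ℂ ↥(E₀ᗮ ⊓ E)
  have hb : ∀ k, ‖(b k : K)‖ = 1 := fun k => b.norm_eq_one k
  have key : ∀ v, ‖v - E₀.starProjection v‖ ^ 2 =
      ‖v - E.starProjection v‖ ^ 2 + ∑ k, ‖⟪v, (b k : K)⟫_ℂ‖ ^ 2 := by
    intro v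
    set x := E.starProjection v - E₀.starProjection v with hx
    have hv : v - E.starProjection v ∈ Eᗮ := E.sub_starProjection_mem_orthogonal v
    have hv₀ : v - E₀.starProjection v ∈ E₀ᗮ := E₀.sub_starProjection_mem_orthogonal v
    have hxE : x ∈ E := E.sub_mem (E.starProjection_apply_mem v)
      (hE (E₀.starProjection_apply_mem v))
    have hx₀ : x ∈ E₀ᗮ := by
      have : x = (v - E₀.starProjection v) - (v - E.starProjection v) := by rw [hx]; abel
      rw [this]
      exact E₀ᗮ.sub_mem hv₀ (Submodule.orthogonal_le hE hv)
    have h1 : v - E₀.starProjection v = x + (v - E.starProjection v) := by rw [hx]; abel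
    have h2 := norm_add_sq_eq_norm_sq_add_norm_sq_of_inner_eq_zero (𝕜 := ℂ) x _
      ((Submodule.mem_orthogonal _ _).1 hv x hxE)
    rw [h1, sq, h2, ← sq, ← sq, add_comm]
    congr 1
    have h3 := b.sum_sq_norm_inner_left ⟨x, hx₀, hxE⟩
    rw [Submodule.coe_norm] at h3
    rw [← h3]
    refine Finset.sum_congr rfl fun k _ => ?_
    rw [Submodule.coe_inner]
    have h4 : ⟪v - E.starProjection v, (b k : K)⟫_ℂ = 0 :=
      (Submodule.mem_orthogonal' _ _).1 hv _ (b k).2.2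
    have h5 : ⟪E₀.starProjection v, (b k : K)⟫_ℂ = 0 :=
      (Submodule.mem_orthogonal _ _).1 (b k).2.1 _ (E₀.starProjection_apply_mem v)
    rw [inner_sub_left, sub_eq_zero] at h4
    change ‖⟪x, (b k : K)⟫_ℂ‖ ^ 2 = _
    rw [hx, inner_sub_left, h5, sub_zero, h4]
  simp only [key]
  rw [Finset.sum_add_distrib, Finset.sum_comm]
  gcongr
  calc _ ≤ ∑ k : Fin (Module.finrank ℂ ↥(E₀ᗮ ⊓ E)), (1 : ℝ) := by
        refine Finset.sum_le_sum fun k _ => ?_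
        have := hw.sum_inner_products_le (s := Finset.univ) (b k : K)
        rwa [hb, one_pow] at this
    _ = _ := by
        rw [← hfr]
        simp

/-- The direct sum of a unitary representation and a trivial one. -/
def addTrivialIsometries (Θ : Γ →* (K →ₗᵢ[ℂ] K)) (L : Type*) [NormedAddCommGroup L]
    [InnerProductSpace ℂ L] : Γ →* (WithLp 2 (K × L) →ₗᵢ[ℂ] WithLp 2 (K × L)) where
  toFun g :=
    { toFun := fun v => WithLp.toLp 2 (Θ g v.fst, v.snd)
      map_add' := fun v w => by
        change WithLp.toLp 2 (Θ g (v.fst + w.fst), v.snd + w.snd) = _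
        rw [map_add]
        rfl
      map_smul' := fun a v => by
        change WithLp.toLp 2 (Θ g (a • v.fst), a • v.snd) = _
        rw [map_smul]
        rfl
      norm_map' := fun v => by
        rw [← sq_eq_sq₀ (norm_nonneg _) (norm_nonneg _), WithLp.prod_norm_sq_eq_of_L2,
          WithLp.prod_norm_sq_eq_of_L2]
        simp }
  map_one' := by
    ext1 v
    change WithLp.toLp 2 (Θ 1 v.fst, v.snd) = v
    rw [map_one]
    rfl
  map_mul' g h := by
    ext1 v
    change WithLp.toLp 2 (Θ (g * h) v.fst, v.snd) = _
    rw [map_mul]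
    rfl

end Decomposition

section Stability

open scoped InnerProductSpace ComplexConjugate

theorem norm_add_add_sq_le {E : Type*} [SeminormedAddCommGroup E] (x y z : E) :
    ‖x + y + z‖ ^ 2 ≤ 3 * (‖x‖ ^ 2 + ‖y‖ ^ 2 + ‖z‖ ^ 2) := by
  have h := norm_add₃_le (a := x) (b := y) (c := z)
  nlinarith [norm_nonneg (x + y + z), sq_nonneg (‖x‖ - ‖y‖), sq_nonneg (‖y‖ - ‖z‖),
    sq_nonneg (‖x‖ - ‖z‖)]

variable {Γ : Type*} [Group Γ] {H K : Type*} [NormedAddCommGroup H] [InnerProductSpace ℂ H]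
  [NormedAddCommGroup K] [InnerProductSpace ℂ K]

theorem one_sub_sum_inner_le_norm_sub_sq [CompleteSpace H] [CompleteSpace K] {n : ℕ}
    (e : OrthonormalBasis (Fin n) ℂ H)
    (W : H →ₗᵢ[ℂ] K) {x : K} (hx : ‖x‖ = 1) (y : H) :
    1 - ∑ i, ‖⟪W (e i), x⟫_ℂ‖ ^ 2 ≤ ‖W y - x‖ ^ 2 := by
  set ζ := ContinuousLinearMap.adjoint W.toContinuousLinearMap x with hζ
  have hin : ∀ v, ⟪W v, x⟫_ℂ = ⟪v, ζ⟫_ℂ := fun v => by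
    rw [hζ, ContinuousLinearMap.adjoint_inner_right]
    rfl
  have h1 : ∑ i, ‖⟪W (e i), x⟫_ℂ‖ ^ 2 = ‖ζ‖ ^ 2 := by
    simp only [hin]
    exact e.sum_sq_norm_inner_right ζ
  have h2 := norm_sub_sq (𝕜 := ℂ) (W y) x
  have h3 := norm_sub_sq (𝕜 := ℂ) y ζ
  rw [hin, W.norm_map, hx] at h2
  rw [h1, h2]
  nlinarith [sq_nonneg ‖y - ζ‖]

theorem starProjection_map_comm (Θ : Γ →* (K →ₗᵢ[ℂ] K)) {E : Submodule ℂ K}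
    [E.HasOrthogonalProjection] (hE : ∀ g, ∀ v ∈ E, Θ g v ∈ E) (g : Γ) (v : K) :
    E.starProjection (Θ g v) = Θ g (E.starProjection v) := by
  refine Submodule.eq_starProjection_of_mem_orthogonal (hE g _ (E.starProjection_apply_mem v)) ?_
  rw [← map_sub]
  exact map_mem_orthogonal Θ hE g (E.sub_starProjection_mem_orthogonal v)

/-- If the irreducible unitary representations have dimension at most `d`, then unitary
almost representations of an amenable group are close to representations. -/
theorem InvariantMean.exists_representation_near [FiniteDimensional ℂ H] {n d : ℕ}
    (M : InvariantMean Γ)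
    (hd : ∀ (k : ℕ) (π : Γ →* Matrix.unitaryGroup (Fin k) ℂ), IsIrreducibleRep π → k ≤ d)
    (e : OrthonormalBasis (Fin n) ℂ H) (φ : Γ → (H →ₗᵢ[ℂ] H)) {c : ℝ}
    (hφ : ∀ g h, ∑ i, ‖φ g (φ h (e i)) - φ (g * h) (e i)‖ ^ 2 ≤ c) :
    ∃ π : Γ →* (H →ₗᵢ[ℂ] H), ∀ g, ∑ i, ‖φ g (e i) - π g (e i)‖ ^ 2 ≤ (11 + 24 * d) * c := by
  have hc : 0 ≤ c := le_trans (Finset.sum_nonneg fun i _ => sq_nonneg _) (hφ 1 1)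
  have : CompleteSpace H := FiniteDimensional.complete ℂ H
  obtain ⟨K, _, _, _, Θ, W, hW⟩ := exists_dilation M φ
  have hWe : ∀ g, ∑ i, ‖W (φ g (e i)) - Θ g (W (e i))‖ ^ 2 ≤ c := fun g =>
    hW n e g c fun h => hφ h g
  have hw : Orthonormal ℂ (W ∘ e) := e.orthonormal.comp_linearIsometry W
  have hfrH : Module.finrank ℂ H = n := by simpa using Module.finrank_eq_card_basis e.toBasis
  obtain ⟨E, _, hEinv, hEn, hEw⟩ := M.exists_invariant_subspace Θ hw (c := c) fun g =>
    (Finset.sum_le_sum fun j _ => one_sub_sum_inner_le_norm_sub_sq e W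
      (by simp) _).trans (hWe g)
  obtain ⟨E₀, hE₀E, hE₀inv, hE₀n, hEE₀⟩ :=
    exists_invariant_le_of_finrank hd Θ E hEinv (Module.finrank ℂ E - n)
  have : FiniteDimensional ℂ E₀ := Submodule.finiteDimensional_of_le hE₀E
  have hdiff : (Module.finrank ℂ E : ℝ) - Module.finrank ℂ E₀ ≤ 4 * d * c := by
    have h1 : ((Module.finrank ℂ E - n : ℕ) : ℝ) ≤ 4 * c := by
      rcases le_total (Module.finrank ℂ E) n with h | h
      · rw [Nat.sub_eq_zero_of_le h]
        push_cast
        positivity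
      · rw [Nat.cast_sub h]
        linarith
    have h2 : (Module.finrank ℂ E : ℝ) ≤
        Module.finrank ℂ E₀ + d * (Module.finrank ℂ E - n : ℕ) := by exact_mod_cast hEE₀
    nlinarith [mul_le_mul_of_nonneg_left h1 (Nat.cast_nonneg (α := ℝ) d)]
  have hη : ∑ i, ‖W (e i) - E₀.starProjection (W (e i))‖ ^ 2 ≤ (4 / 3 + 4 * d) * c :=
    (hw.sum_norm_sub_starProjection_le hE₀E).trans (by linarith)
  let r := n - Module.finrank ℂ E₀
  let X : H →ₗ[ℂ] WithLp 2 (E₀ × EuclideanSpace ℂ (Fin r)) :=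
    (WithLp.linearEquiv 2 ℂ (E₀ × EuclideanSpace ℂ (Fin r))).symm.toLinearMap ∘ₗ
      LinearMap.inl ℂ E₀ (EuclideanSpace ℂ (Fin r)) ∘ₗ
        E₀.orthogonalProjectionOnto.toLinearMap ∘ₗ W.toLinearMap
  have hXn : ∀ v, ‖X v‖ = ‖E₀.starProjection (W v)‖ := by
    intro v
    rw [← sq_eq_sq₀ (norm_nonneg _) (norm_nonneg _), WithLp.prod_norm_sq_eq_of_L2]
    change ‖E₀.orthogonalProjectionOnto (W v)‖ ^ 2 + ‖(0 : EuclideanSpace ℂ (Fin r))‖ ^ 2 = _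
    rw [norm_zero, zero_pow two_ne_zero, add_zero]
    rfl
  have hX1 : ∀ v, ‖X v‖ ≤ ‖v‖ := fun v => by
    rw [hXn, ← W.norm_map v]
    exact E₀.norm_starProjection_apply_le _
  have hfr : Module.finrank ℂ (WithLp 2 (E₀ × EuclideanSpace ℂ (Fin r))) =
      Module.finrank ℂ H := by
    rw [(WithLp.linearEquiv 2 ℂ (E₀ × EuclideanSpace ℂ (Fin r))).finrank_eq,
      Module.finrank_prod, finrank_euclideanSpace_fin, hfrH]
    omega
  obtain ⟨U₀, hU₀⟩ := exists_linearIsometry_near_contraction hfr X hX1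
  let U := U₀.toLinearIsometryEquiv hfr.symm
  have hUX : ∑ i, ‖U (e i) - X (e i)‖ ^ 2 ≤ (4 / 3 + 4 * d) * c := by
    refine (hU₀ e).trans (le_trans (Finset.sum_le_sum fun i _ => ?_) hη)
    have h1 := Submodule.norm_sq_eq_add_norm_sq_projection (W (e i)) E₀
    have h2 : ‖W (e i)‖ = 1 := hw.1 i
    have h3 : ‖E₀.starProjection (W (e i))‖ = ‖E₀.orthogonalProjectionOnto (W (e i))‖ := rfl
    have h4 : ‖W (e i) - E₀.starProjection (W (e i))‖ =
        ‖E₀ᗮ.orthogonalProjectionOnto (W (e i))‖ := by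
      rw [← Submodule.starProjection_orthogonal_val]
      rfl
    rw [hXn, h3, h4]
    rw [h2] at h1
    linarith
  let Ψ := addTrivialIsometries (restrictIsometries Θ E₀ hE₀inv) (EuclideanSpace ℂ (Fin r))
  have hXΨ : ∀ g u v, ‖X u - Ψ g (X v)‖ ≤ ‖W u - Θ g (W v)‖ := by
    intro g u v
    have h1 : ‖X u - Ψ g (X v)‖ =
        ‖E₀.starProjection (W u) - Θ g (E₀.starProjection (W v))‖ := by
      rw [← sq_eq_sq₀ (norm_nonneg _) (norm_nonneg _), WithLp.prod_norm_sq_eq_of_L2]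
      change ‖E₀.orthogonalProjectionOnto (W u) - restrictIsometries Θ E₀ hE₀inv g
        (E₀.orthogonalProjectionOnto (W v))‖ ^ 2 +
          ‖(0 : EuclideanSpace ℂ (Fin r)) - 0‖ ^ 2 = _
      rw [sub_zero, norm_zero, zero_pow two_ne_zero, add_zero]
      rfl
    rw [h1, ← starProjection_map_comm Θ hE₀inv, ← map_sub]
    exact E₀.norm_starProjection_apply_le _
  refine ⟨conjIsometries Ψ U, fun g => ?_⟩
  let b := e.map ((φ g).toLinearIsometryEquiv rfl)
  have hb : ∀ i, b i = φ g (e i) := fun i => by simp [b]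
  have hUXb : ∑ i, ‖U (φ g (e i)) - X (φ g (e i))‖ ^ 2 ≤ (4 / 3 + 4 * d) * c := by
    have := e.sum_norm_sq_map_eq b (U.toLinearEquiv.toLinearMap - X)
    simp only [hb] at this
    exact this.symm.le.trans hUX
  calc ∑ i, ‖φ g (e i) - conjIsometries Ψ U g (e i)‖ ^ 2
      ≤ ∑ i, 3 * (‖U (φ g (e i)) - X (φ g (e i))‖ ^ 2 +
          ‖W (φ g (e i)) - Θ g (W (e i))‖ ^ 2 + ‖U (e i) - X (e i)‖ ^ 2) := by
        refine Finset.sum_le_sum fun i _ => ?_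
        have h1 : ‖φ g (e i) - conjIsometries Ψ U g (e i)‖ =
            ‖(U (φ g (e i)) - X (φ g (e i))) + (X (φ g (e i)) - Ψ g (X (e i))) +
              Ψ g (X (e i) - U (e i))‖ := by
          rw [← U.norm_map, map_sub, conjIsometries_apply, U.apply_symm_apply, map_sub]
          congr 1
          abel
        rw [h1]
        refine (norm_add_add_sq_le _ _ _).trans ?_
        rw [(Ψ g).norm_map, norm_sub_rev (X (e i))]
        have := hXΨ g (φ g (e i)) (e i)
        gcongr
    _ ≤ (11 + 24 * d) * c := by
        rw [← Finset.mul_sum, Finset.sum_add_distrib, Finset.sum_add_distrib]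
        linarith [hWe g]

end Stability

theorem IsAmenable.uniformlyHSStable {Γ : Type*} [Group Γ] (ham : IsAmenable Γ) {d : ℕ}
    (hd : ∀ (k : ℕ) (π : Γ →* Matrix.unitaryGroup (Fin k) ℂ), IsIrreducibleRep π → k ≤ d) :
    UniformlyHSStable Γ := by
  obtain ⟨M⟩ := ham.nonempty_invariantMean
  intro δ hδ
  have hA : (1 : ℝ) < 11 + 24 * d := by
    have := Nat.cast_nonneg (α := ℝ) d
    linarith
  refine ⟨δ / (11 + 24 * d), by positivity, fun n φ hφ => ?_⟩
  obtain ⟨π, hπ⟩ := M.exists_representation_near hd (EuclideanSpace.basisFun (Fin n) ℂ)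
    (fun g => unitaryIsometryEquiv n (φ g)) (c := (δ / (11 + 24 * d)) ^ 2 * n) fun g h => by
      have := sum_le_of_hsNorm_lt (hφ g h)
      rw [map_sub, Matrix.toLpLin_mul (q := 2)] at this
      exact this
  refine ⟨(unitaryIsometryEquiv n).symm.toMonoidHom.comp π, fun g => ?_⟩
  refine hsNorm_lt_of_sum_le hδ (c := (11 + 24 * d) * (δ / (11 + 24 * d)) ^ 2) ?_ ?_
  · have : (11 + 24 * (d : ℝ)) * (δ / (11 + 24 * d)) ^ 2 = δ ^ 2 / (11 + 24 * d) := by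
      field_simp
    rw [this, div_lt_iff₀ (by linarith)]
    nlinarith [pow_pos hδ 2]
  · rw [mul_assoc]
    refine le_trans (Finset.sum_le_sum fun i _ => le_of_eq ?_) (hπ g)
    rw [map_sub, LinearMap.sub_apply, ← unitaryIsometryEquiv_apply, ← unitaryIsometryEquiv_apply]
    simp

section Instability

open scoped InnerProductSpace ComplexConjugate

variable {Γ : Type*} [Group Γ] {H G : Type*} [NormedAddCommGroup H] [InnerProductSpace ℂ H]
  [NormedAddCommGroup G] [InnerProductSpace ℂ G]

theorem norm_add_sq_le_two_mul {E : Type*} [SeminormedAddCommGroup E] (x y : E) :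
    ‖x + y‖ ^ 2 ≤ 2 * (‖x‖ ^ 2 + ‖y‖ ^ 2) := by
  have h := norm_add_le x y
  nlinarith [norm_nonneg (x + y), sq_nonneg (‖x‖ - ‖y‖)]

/-- Compressing a unitary representation to a subspace of codimension one gives an almost
representation. -/
theorem exists_almost_representation [FiniteDimensional ℂ H] [FiniteDimensional ℂ G] {n : ℕ}
    (hG : Module.finrank ℂ G = n + 1) (e : OrthonormalBasis (Fin n) ℂ H)
    (Θ : Γ →* (G →ₗᵢ[ℂ] G)) (V : H →ₗᵢ[ℂ] G) :
    ∃ U : Γ → (H →ₗᵢ[ℂ] H), (∀ g, ∑ i, ‖V (U g (e i)) - Θ g (V (e i))‖ ^ 2 ≤ 4) ∧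
      ∀ g h, ∑ i, ‖U g (U h (e i)) - U (g * h) (e i)‖ ^ 2 ≤ 16 := by
  let C : G →ₗ[ℂ] H := LinearMap.adjoint V.toLinearMap
  have hC : ∀ x v, ⟪C x, v⟫_ℂ = ⟪x, V v⟫_ℂ := fun x v => LinearMap.adjoint_inner_left _ _ _
  let R := LinearMap.range V.toLinearMap
  have hfrR : Module.finrank ℂ R = n := by
    rw [LinearMap.finrank_range_of_inj V.injective]
    simpa using Module.finrank_eq_card_basis e.toBasis
  have hproj : ∀ x, R.starProjection x = V (C x) := fun x =>
    Submodule.eq_starProjection_of_mem_of_inner_eq_zero ⟨C x, rfl⟩ <| by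
      rintro _ ⟨v, rfl⟩
      change ⟪x - V (C x), V v⟫_ℂ = 0
      rw [inner_sub_left, V.inner_map_map, hC, sub_self]
  have hpyth : ∀ x, ‖x‖ ^ 2 - ‖C x‖ ^ 2 = ‖x - V (C x)‖ ^ 2 := by
    intro x
    have h1 := Submodule.norm_sq_eq_add_norm_sq_projection x R
    have h2 : ‖R.orthogonalProjectionOnto x‖ = ‖C x‖ := by
      rw [← V.norm_map, ← hproj]
      rfl
    have h3 : ‖Rᗮ.orthogonalProjectionOnto x‖ = ‖x - V (C x)‖ := by
      rw [← hproj, ← Submodule.starProjection_orthogonal_val]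
      rfl
    rw [h2, h3] at h1
    linarith
  have hCn : ∀ x, ‖C x‖ ≤ ‖x‖ := fun x => by
    refine le_of_sq_le_sq ?_ (norm_nonneg x)
    nlinarith [hpyth x, sq_nonneg ‖x - V (C x)‖]
  have hgap : ∀ g, ∑ i, ‖Θ g (V (e i)) - V (C (Θ g (V (e i))))‖ ^ 2 ≤ 1 := by
    intro g
    have hw : Orthonormal ℂ (Θ g ∘ V ∘ e) :=
      (e.orthonormal.comp_linearIsometry V).comp_linearIsometry (Θ g)
    have := hw.sum_norm_sub_starProjection_le (E₀ := R) (E := ⊤) le_top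
    simp only [Submodule.starProjection_top', finrank_top, hG, hfrR, hproj] at this
    simpa using this
  let X : Γ → H →ₗ[ℂ] H := fun g => C ∘ₗ (Θ g).toLinearMap ∘ₗ V.toLinearMap
  have hXa : ∀ g v, X g v = C (Θ g (V v)) := fun _ _ => rfl
  have hX1 : ∀ g v, ‖X g v‖ ≤ ‖v‖ := fun g v => by
    simpa [hXa] using hCn (Θ g (V v))
  choose U hU using fun g => exists_linearIsometry_near_contraction rfl (X g) (hX1 g)
  have hUX : ∀ g, ∑ i, ‖U g (e i) - X g (e i)‖ ^ 2 ≤ 1 := by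
    intro g
    refine (hU g e).trans (le_trans (Finset.sum_le_sum fun i _ => le_of_eq ?_) (hgap g))
    rw [← hpyth, hXa]
    simp
  refine ⟨U, fun g => ?_, fun g h => ?_⟩
  · calc _ ≤ ∑ i, 2 * (‖U g (e i) - X g (e i)‖ ^ 2 +
          ‖Θ g (V (e i)) - V (C (Θ g (V (e i))))‖ ^ 2) := by
          refine Finset.sum_le_sum fun i _ => ?_
          have h1 : V (U g (e i)) - Θ g (V (e i)) = V (U g (e i) - X g (e i)) +
              -(Θ g (V (e i)) - V (C (Θ g (V (e i))))) := by
            rw [map_sub, hXa]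
            abel
          rw [h1]
          refine (norm_add_sq_le_two_mul _ _).trans ?_
          rw [V.norm_map, norm_neg]
      _ ≤ 4 := by
          rw [← Finset.mul_sum, Finset.sum_add_distrib]
          linarith [hUX g, hgap g]
  · let b := e.map ((U h).toLinearIsometryEquiv rfl)
    have hb : ∀ i, b i = U h (e i) := fun i => by simp [b]
    have hUXb : ∑ i, ‖U g (U h (e i)) - X g (U h (e i))‖ ^ 2 ≤ 1 := by
      have := e.sum_norm_sq_map_eq b ((U g).toLinearMap - X g)
      simp only [hb] at this
      exact this.symm.le.trans (hUX g)
    calc _ ≤ ∑ i, 2 * (2 * (‖U g (U h (e i)) - X g (U h (e i))‖ ^ 2 +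
          ‖U h (e i) - X h (e i)‖ ^ 2) +
          2 * (‖Θ h (V (e i)) - V (C (Θ h (V (e i))))‖ ^ 2 +
          ‖U (g * h) (e i) - X (g * h) (e i)‖ ^ 2)) := by
          refine Finset.sum_le_sum fun i _ => ?_
          have h1 : U g (U h (e i)) - U (g * h) (e i) =
              ((U g (U h (e i)) - X g (U h (e i))) + X g (U h (e i) - X h (e i))) +
              (-C (Θ g (Θ h (V (e i)) - V (C (Θ h (V (e i)))))) +
                -(U (g * h) (e i) - X (g * h) (e i))) := by
            simp only [hXa, map_sub, map_mul, LinearIsometry.coe_mul, Function.comp_apply]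
            abel
          have h2 : ‖C (Θ g (Θ h (V (e i)) - V (C (Θ h (V (e i))))))‖ ≤
              ‖Θ h (V (e i)) - V (C (Θ h (V (e i))))‖ :=
            (hCn _).trans_eq ((Θ g).norm_map _)
          rw [h1]
          refine (norm_add_sq_le_two_mul _ _).trans ?_
          refine mul_le_mul_of_nonneg_left (add_le_add ?_ ?_) zero_le_two
          · refine (norm_add_sq_le_two_mul _ _).trans ?_
            have := hX1 g (U h (e i) - X h (e i))
            gcongr
          · refine (norm_add_sq_le_two_mul _ _).trans ?_
            rw [norm_neg, norm_neg]
            gcongr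
      _ ≤ 16 := by
          simp only [← Finset.mul_sum, Finset.sum_add_distrib]
          linarith [hUX h, hUX (g * h), hgap h]

/-- Two representations that are close on a space have a nonzero intertwiner. -/
theorem InvariantMean.exists_intertwiner [FiniteDimensional ℂ H] [CompleteSpace G] {n : ℕ}
    (M : InvariantMean Γ) (e : OrthonormalBasis (Fin n) ℂ H) (σ : Γ →* (H →ₗᵢ[ℂ] H))
    (Θ : Γ →* (G →ₗᵢ[ℂ] G)) (V : H →ₗᵢ[ℂ] G) {c : ℝ} (hcn : c < 2 * n)
    (hc : ∀ g, ∑ i, ‖V (σ g (e i)) - Θ g (V (e i))‖ ^ 2 ≤ c) :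
    ∃ T : H →L[ℂ] G, T ≠ 0 ∧ ∀ g v, Θ g (T v) = T (σ g v) := by
  let S : Γ → H →L[ℂ] G := fun g =>
    ((Θ g).comp (V.comp (σ g⁻¹))).toContinuousLinearMap
  have hSa : ∀ g v, S g v = Θ g (V (σ g⁻¹ v)) := fun _ _ => rfl
  have hSn : ∀ g v, ‖S g v‖ = ‖v‖ := fun g v => by simp [hSa]
  obtain ⟨T, hT⟩ := M.exists_average S (C := 1) fun g v => by rw [hSn, one_mul]
  have hSb : ∀ v u g, ‖⟪S g v, u⟫_ℂ‖ ≤ ‖v‖ * ‖u‖ := fun v u g => by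
    rw [← hSn g v]
    exact norm_inner_le_norm _ _
  refine ⟨T, fun hT0 => ?_, fun h v => ?_⟩
  · have hlow : n - c / 2 ≤ (∑ i, ⟪T (e i), V (e i)⟫_ℂ).re := by
      simp only [hT]
      rw [← map_sum]
      refine M.le_re_avg (C := ∑ i, ‖e i‖ * ‖V (e i)‖) (fun g => ?_) fun g => ?_
      · rw [Finset.sum_apply]
        exact norm_sum_le_of_le _ fun i _ => hSb _ _ g
      · rw [Finset.sum_apply, Complex.re_sum]
        let b := e.map ((σ g).toLinearIsometryEquiv rfl)
        have hb : ∀ i, b i = σ g (e i) := fun i => by simp [b]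
        have h1 := e.sum_norm_sq_map_eq b ((S g).toLinearMap - V.toLinearMap)
        have h2 : ∀ i, ((S g).toLinearMap - V.toLinearMap) (b i) =
            -(V (σ g (e i)) - Θ g (V (e i))) := by
          intro i
          change S g (b i) - V (b i) = _
          have h3 : σ g⁻¹ (σ g (e i)) = e i := by simpa only [inv_inv] using apply_apply_inv σ g⁻¹ (e i)
          rw [hb, hSa, h3]
          abel
        simp only [h2, norm_neg] at h1
        have h4 : ∀ i, (⟪S g (e i), V (e i)⟫_ℂ).re =
            1 - ‖((S g).toLinearMap - V.toLinearMap) (e i)‖ ^ 2 / 2 := by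
          intro i
          change _ = 1 - ‖S g (e i) - V (e i)‖ ^ 2 / 2
          have h5 := norm_sub_sq (𝕜 := ℂ) (S g (e i)) (V (e i))
          rw [hSn, V.norm_map, e.norm_eq_one] at h5
          rw [h5]
          change _ = 1 - (1 ^ 2 - 2 * (⟪S g (e i), V (e i)⟫_ℂ).re + 1 ^ 2) / 2
          ring
        simp only [h4]
        rw [Finset.sum_sub_distrib, ← Finset.sum_div, h1]
        have := hc g
        simp
        linarith
    rw [hT0] at hlow
    simp at hlow
    linarith
  · refine ext_inner_right ℂ fun u => ?_
    have h1 : ⟪Θ h (T v), u⟫_ℂ = ⟪T v, Θ h⁻¹ u⟫_ℂ := by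
      rw [← (Θ h).inner_map_map (T v), apply_apply_inv]
    rw [h1, hT, hT, ← M.map_mul_left _ _ (hSb (σ h v) u) h]
    congr 1
    ext g
    have h2 : S (h * g) (σ h v) = Θ h (S g v) := by
      have h3 : σ h⁻¹ (σ h v) = v := by simpa only [inv_inv] using apply_apply_inv σ h⁻¹ v
      simp only [hSa, mul_inv_rev, map_mul, LinearIsometry.coe_mul, Function.comp_apply, h3]
    rw [h2, ← (Θ h).inner_map_map (S g v), apply_apply_inv]

end Instability

theorem IsAmenable.exists_bound_of_uniformlyHSStable {Γ : Type*} [Group Γ] (ham : IsAmenable Γ)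
    (hst : UniformlyHSStable Γ) :
    ∃ d : ℕ, ∀ (k : ℕ) (π : Γ →* Matrix.unitaryGroup (Fin k) ℂ), IsIrreducibleRep π → k ≤ d := by
  obtain ⟨M⟩ := ham.nonempty_invariantMean
  obtain ⟨ε, hε, hst⟩ := hst (1 / 2) (by norm_num)
  obtain ⟨N, hN⟩ := exists_nat_gt (32 / ε ^ 2)
  refine ⟨N + 8, fun k π hπ => ?_⟩
  by_contra! hk
  obtain ⟨n, rfl⟩ : ∃ n, k = n + 1 := ⟨k - 1, by omega⟩
  have hn8 : (8 : ℝ) ≤ n := by exact_mod_cast (by omega : 8 ≤ n)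
  have hnN : (N : ℝ) ≤ n := by exact_mod_cast (by omega : N ≤ n)
  let e := EuclideanSpace.basisFun (Fin n) ℂ
  let f := EuclideanSpace.basisFun (Fin (n + 1)) ℂ
  let V : EuclideanSpace ℂ (Fin n) →ₗᵢ[ℂ] EuclideanSpace ℂ (Fin (n + 1)) :=
    (e.toBasis.constr ℂ fun i => f i.castSucc).isometryOfOrthonormal (v := e.toBasis)
      (by simp) (by
        have : (e.toBasis.constr ℂ fun i => f i.castSucc) ∘ e.toBasis =
            fun i => f i.castSucc := by
          ext1 i
          simp only [Function.comp_apply, Module.Basis.constr_basis]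
        rw [this]
        exact f.orthonormal.comp _ (Fin.castSucc_injective n))
  let Θ := (unitaryIsometryEquiv (n + 1)).toMonoidHom.comp π
  obtain ⟨U, hUV, hU⟩ := exists_almost_representation (by simp) e Θ V
  obtain ⟨ρ, hρ⟩ := hst n (fun g => (unitaryIsometryEquiv n).symm (U g)) fun g h => by
    refine hsNorm_lt_of_sum_le hε (c := ε ^ 2 / 2) (by linarith [pow_pos hε 2]) ?_
    have h1 : (16 : ℝ) ≤ ε ^ 2 / 2 * n := by
      have := hN.trans_le hnN
      rw [div_lt_iff₀ (pow_pos hε 2)] at this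
      linarith
    refine le_trans (Finset.sum_le_sum fun i _ => le_of_eq ?_) ((hU g h).trans h1)
    rw [map_sub, Matrix.toLpLin_mul (q := 2), LinearMap.sub_apply, LinearMap.comp_apply]
    simp only [← unitaryIsometryEquiv_apply, MulEquiv.apply_symm_apply]
    rfl
  let σ := (unitaryIsometryEquiv n).toMonoidHom.comp ρ
  have hσ : ∀ g, ∑ i, ‖U g (e i) - σ g (e i)‖ ^ 2 ≤ (1 / 2) ^ 2 * n := fun g => by
    have := sum_le_of_hsNorm_lt (hρ g)
    rw [map_sub] at this
    simp only [LinearMap.sub_apply, ← unitaryIsometryEquiv_apply, MulEquiv.apply_symm_apply]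
      at this
    exact this
  obtain ⟨T, hT0, hT⟩ := M.exists_intertwiner e σ Θ V (c := (n : ℝ) / 2 + 8) (by linarith) fun g => by
    calc _ ≤ ∑ i, 2 * (‖U g (e i) - σ g (e i)‖ ^ 2 + ‖V (U g (e i)) - Θ g (V (e i))‖ ^ 2) := by
          refine Finset.sum_le_sum fun i _ => ?_
          have h1 : V (σ g (e i)) - Θ g (V (e i)) = -V (U g (e i) - σ g (e i)) +
              (V (U g (e i)) - Θ g (V (e i))) := by
            rw [map_sub]
            abel
          rw [h1]
          refine (norm_add_sq_le_two_mul _ _).trans ?_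
          rw [norm_neg, V.norm_map]
      _ ≤ (n : ℝ) / 2 + 8 := by
          rw [← Finset.mul_sum, Finset.sum_add_distrib]
          linarith [hσ g, hUV g]
  rcases (isIrreducibleRep_iff π).1 hπ (LinearMap.range T.toLinearMap) (by
    rintro g _ ⟨v, rfl⟩
    exact ⟨σ g v, (hT g v).symm⟩) with h | h
  · refine hT0 (ContinuousLinearMap.ext fun v => ?_)
    exact DFunLike.congr_fun (LinearMap.range_eq_bot.1 h) v
  · have h1 := LinearMap.finrank_range_le T.toLinearMap
    rw [h, finrank_top, finrank_euclideanSpace_fin, finrank_euclideanSpace_fin] at h1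
    omega

/-- A countable amenable group is uniformly HS stable iff the dimensions of its
finite dimensional irreducible unitary representations are bounded. -/
theorem stmt_3 (Γ : Type*) [Group Γ] [Countable Γ] (ham : IsAmenable Γ) :
    UniformlyHSStable Γ ↔
      ∃ d : ℕ, ∀ (k : ℕ) (π : Γ →* Matrix.unitaryGroup (Fin k) ℂ),
        IsIrreducibleRep π → k ≤ d := by
  exact ⟨ham.exists_bound_of_uniformlyHSStable, fun ⟨_, hd⟩ => ham.uniformlyHSStable hd⟩
end

section
/- Let Γ be a group admitting finite dimensional irreducible unitary representations of arbitrarily large dimensions (i.e., for every d ∈ ℕ there exist n > d and an irreducible unitary representation Γ → U(n)). Then Γ is not uniformly HS stable. -/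
open scoped Matrix

open scoped Matrix.Norms.Frobenius

/-- A linear isometric group action that moves a point by at most `r` has a fixed point within
distance `r` of it. -/
lemma exists_fixed_of_orbit_near {G E : Type*} [Group G] [NormedAddCommGroup E] [NormedSpace ℝ E]
    [StrictConvexSpace ℝ E] [ProperSpace E] (ρ : G →* (E →ₗ[ℝ] E))
    (hρ : ∀ g x, ‖ρ g x‖ = ‖x‖) {p : E} {r : ℝ} (hr : ∀ g, ‖ρ g p - p‖ ≤ r) :
    ∃ x, ‖x - p‖ ≤ r ∧ ∀ g, ρ g x = x := by
  have hmul : ∀ g h x, ρ (g * h) x = ρ g (ρ h x) := fun g h x => by rw [map_mul]; rfl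
  set K : Set E := ⋂ g, Metric.closedBall (ρ g p) r with hK
  have hpK : p ∈ K := Set.mem_iInter.2 fun g => by
    rw [mem_closedBall_iff_norm']; exact hr g
  have hcomp : IsCompact K :=
    (isCompact_closedBall (ρ 1 p) r).of_isClosed_subset
      (isClosed_iInter fun g => Metric.isClosed_closedBall) (Set.iInter_subset _ 1)
  have hconv : Convex ℝ K := convex_iInter fun g => convex_closedBall _ _
  have hinv : ∀ h, ∀ x ∈ K, ρ h x ∈ K := fun h x hx => Set.mem_iInter.2 fun g => by
    have h1 := Set.mem_iInter.1 hx (h⁻¹ * g)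
    rw [mem_closedBall_iff_norm] at h1 ⊢
    rwa [← hρ h, map_sub, ← hmul, mul_inv_cancel_left] at h1
  obtain ⟨x, hxK, hmin⟩ := hcomp.exists_isMinOn ⟨p, hpK⟩ continuous_norm.continuousOn
  refine ⟨x, ?_, fun g => ?_⟩
  · simpa [dist_eq_norm] using Set.mem_iInter.1 hxK 1
  · by_contra hne
    have h1 := combo_mem_ball_of_ne (z := (0 : E)) (r := ‖x‖) (a := 1 / 2) (b := 1 / 2)
      (by simp [hρ]) (by simp) hne (by norm_num) (by norm_num) (by norm_num)
    have h2 := hmin (hconv (hinv g x hxK) hxK (by norm_num : (0 : ℝ) ≤ 1 / 2)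
      (by norm_num : (0 : ℝ) ≤ 1 / 2) (by norm_num))
    rw [mem_ball_zero_iff] at h1
    exact absurd h1 (not_lt.2 h2)

section Frobenius

variable {l m n : Type*} [Fintype l] [Fintype m] [Fintype n]

lemma frobenius_norm_sq (A : Matrix m n ℂ) : ‖A‖ ^ 2 = ∑ i, ∑ j, ‖A i j‖ ^ 2 := by
  rw [Matrix.frobenius_norm_def, ← Real.sqrt_eq_rpow, Real.sq_sqrt (by positivity)]
  simp

lemma frobenius_norm_sq_eq_trace (A : Matrix m n ℂ) :
    ‖A‖ ^ 2 = (Matrix.trace (A * Aᴴ)).re := by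
  rw [frobenius_norm_sq]
  simp [Matrix.trace, Matrix.mul_apply, Complex.mul_conj, Complex.normSq_eq_norm_sq,
    -Complex.ofReal_pow]

lemma frobenius_norm_mul_right [DecidableEq m] {B : Matrix m n ℂ} (hB : B * Bᴴ = 1)
    (A : Matrix l m ℂ) : ‖A * B‖ = ‖A‖ := by
  rw [← sq_eq_sq₀ (norm_nonneg _) (norm_nonneg _), frobenius_norm_sq_eq_trace,
    frobenius_norm_sq_eq_trace, Matrix.conjTranspose_mul, Matrix.mul_assoc, ← Matrix.mul_assoc B,
    hB, Matrix.one_mul]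

lemma frobenius_norm_mul_left [DecidableEq m] {B : Matrix n m ℂ} (hB : Bᴴ * B = 1)
    (A : Matrix m l ℂ) : ‖B * A‖ = ‖A‖ := by
  rw [← Matrix.frobenius_norm_conjTranspose, Matrix.conjTranspose_mul,
    frobenius_norm_mul_right (by simpa using hB), Matrix.frobenius_norm_conjTranspose]

instance frobenius_strictConvexSpace : StrictConvexSpace ℝ (Matrix m n ℂ) := by
  have : InnerProductSpaceable (Matrix m n ℂ) := ⟨fun A B => by
    simp only [← sq, frobenius_norm_sq, ← Finset.sum_add_distrib, Finset.mul_sum]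
    refine Finset.sum_congr rfl fun i _ => Finset.sum_congr rfl fun j _ => ?_
    simpa [sq] using parallelogram_law_with_norm ℝ (A i j) (B i j)⟩
  infer_instance

end Frobenius

lemma hsNorm_eq_frobenius {m n : ℕ} (A : Matrix (Fin m) (Fin n) ℂ) :
    hsNorm A = ‖A‖ / √m := by
  rw [hsNorm, ← frobenius_norm_sq_eq_trace, one_div, inv_mul_eq_div,
    Real.sqrt_div (sq_nonneg _), Real.sqrt_sq (norm_nonneg _)]

/-- The coordinate projection `ℂᵐ⁺¹ → ℂᵐ` forgetting the last coordinate. -/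
def dropLast (m : ℕ) : Matrix (Fin m) (Fin (m + 1)) ℂ :=
  (1 : Matrix (Fin (m + 1)) (Fin (m + 1)) ℂ).submatrix Fin.castSucc id

/-- The orthogonal projection of `ℂᵐ⁺¹` onto its last coordinate. -/
def lastProj (m : ℕ) : Matrix (Fin (m + 1)) (Fin (m + 1)) ℂ :=
  Matrix.single (Fin.last m) (Fin.last m) 1

lemma dropLast_mul {m : ℕ} {n : Type*} (A : Matrix (Fin (m + 1)) n ℂ) :
    dropLast m * A = A.submatrix Fin.castSucc id := by
  ext i j
  simp [dropLast, Matrix.mul_apply, Matrix.one_apply]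

lemma dropLast_mul_conjTranspose (m : ℕ) : dropLast m * (dropLast m)ᴴ = 1 := by
  ext i j
  rw [dropLast_mul]
  simp [dropLast, Matrix.one_apply]

lemma conjTranspose_dropLast_mul (m : ℕ) : (dropLast m)ᴴ * dropLast m = 1 - lastProj m := by
  ext i j
  rw [Matrix.mul_apply]
  refine Fin.lastCases ?_ (fun i => ?_) i <;> refine Fin.lastCases ?_ (fun j => ?_) j <;>
    simp [dropLast, lastProj, Matrix.one_apply, Fin.castSucc_ne_last,
      (Fin.castSucc_ne_last _).symm, eq_comm]

lemma dropLast_mul_lastProj (m : ℕ) : dropLast m * lastProj m = 0 := by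
  ext i j
  simp [dropLast_mul, lastProj, (Fin.castSucc_ne_last _).symm]

lemma conjTranspose_lastProj (m : ℕ) : (lastProj m)ᴴ = lastProj m := by
  simp [lastProj]

lemma lastProj_mul_mul_lastProj {m : ℕ} (A : Matrix (Fin (m + 1)) (Fin (m + 1)) ℂ) :
    lastProj m * A * lastProj m = A (Fin.last m) (Fin.last m) • lastProj m := by
  simp [lastProj, Matrix.single_mul_mul_single]

lemma norm_lastProj (m : ℕ) : ‖lastProj m‖ = 1 := by
  rw [← sq_eq_sq₀ (norm_nonneg _) zero_le_one, frobenius_norm_sq]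
  simp [lastProj, Matrix.single_apply, apply_ite, ite_and]

lemma norm_dropLast_mul_le {m : ℕ} {n : Type*} [Fintype n] (A : Matrix (Fin (m + 1)) n ℂ) :
    ‖dropLast m * A‖ ≤ ‖A‖ := by
  rw [← sq_le_sq₀ (norm_nonneg _) (norm_nonneg _), frobenius_norm_sq, frobenius_norm_sq,
    Fin.sum_univ_castSucc, dropLast_mul]
  exact le_add_of_nonneg_right (by positivity)

lemma norm_mul_conjTranspose_dropLast_le {m : ℕ} {n : Type*} [Fintype n]
    (A : Matrix n (Fin (m + 1)) ℂ) : ‖A * (dropLast m)ᴴ‖ ≤ ‖A‖ := by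
  rw [← Matrix.frobenius_norm_conjTranspose, ← Matrix.frobenius_norm_conjTranspose A]
  simpa using norm_dropLast_mul_le Aᴴ

lemma norm_dropLast (m : ℕ) : ‖dropLast m‖ = √m := by
  rw [← Real.sqrt_sq (norm_nonneg (dropLast m)), frobenius_norm_sq_eq_trace,
    dropLast_mul_conjTranspose]
  simp

lemma exists_norm_le_and_norm_one_sub_mul_eq (d : ℂ) :
    ∃ t : ℂ, ‖t‖ ≤ 1 ∧ ‖1 - t * d‖ = ‖t‖ := by
  obtain ⟨s, hs, hsd⟩ : ∃ s : ℂ, ‖s‖ = 1 ∧ 1 ≤ ‖s + d‖ := by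
    rcases le_total 0 d.re with h | h
    · refine ⟨1, by simp, le_trans ?_ (Complex.abs_re_le_norm _)⟩
      exact le_trans (by simpa using h) (le_abs_self _)
    · refine ⟨-1, by simp, le_trans ?_ (Complex.abs_re_le_norm _)⟩
      exact le_trans (by simpa using h) (neg_le_abs _)
  have h0 : s + d ≠ 0 := norm_pos_iff.1 (by linarith)
  refine ⟨(s + d)⁻¹, by rw [norm_inv]; exact inv_le_one_of_one_le₀ hsd, ?_⟩
  have : 1 - (s + d)⁻¹ * d = s * (s + d)⁻¹ := by field_simp; ring
  rw [this, norm_mul, hs, one_mul]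

/-- Every unitary on `ℂᵐ⁺¹` is almost intertwined with a unitary on `ℂᵐ` by the coordinate
projection. -/
lemma exists_unitary_near_compression {m : ℕ} (U : Matrix.unitaryGroup (Fin (m + 1)) ℂ) :
    ∃ W : Matrix.unitaryGroup (Fin m) ℂ,
      ‖(W : Matrix (Fin m) (Fin m) ℂ) * dropLast m
        - dropLast m * (U : Matrix (Fin (m + 1)) (Fin (m + 1)) ℂ)‖ ≤ 2 := by
  obtain ⟨U, hU⟩ := U
  have hU1 : Uᴴ * U = 1 := Matrix.mem_unitaryGroup_iff'.1 hU
  have hU2 : U * Uᴴ = 1 := Matrix.mem_unitaryGroup_iff.1 hU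
  obtain ⟨t, ht, htd⟩ := exists_norm_le_and_norm_one_sub_mul_eq (U (Fin.last m) (Fin.last m))
  have hEUE := lastProj_mul_mul_lastProj U
  have hEE : lastProj m * lastProj m = lastProj m := by
    simpa using lastProj_mul_mul_lastProj (1 : Matrix (Fin (m + 1)) (Fin (m + 1)) ℂ)
  have hPE := dropLast_mul_lastProj m
  have hPP := dropLast_mul_conjTranspose m
  have hPP' := conjTranspose_dropLast_mul m
  have hE := conjTranspose_lastProj m
  have nE := norm_lastProj m
  have hPle := fun A : Matrix (Fin (m + 1)) (Fin (m + 1)) ℂ => norm_dropLast_mul_le A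
  have hPle' := fun A : Matrix (Fin m) (Fin (m + 1)) ℂ => norm_mul_conjTranspose_dropLast_le A
  have nP := fun A : Matrix (Fin m) (Fin m) ℂ => frobenius_norm_mul_right hPP A
  generalize U (Fin.last m) (Fin.last m) = d at *
  generalize dropLast m = P at *
  generalize lastProj m = E at *
  have hEP : E * Pᴴ = 0 := by
    have := congrArg Matrix.conjTranspose hPE
    simpa [hE] using this
  obtain ⟨X, hX⟩ : ∃ X, X = U - t • (U * E * U) := ⟨_, rfl⟩
  have hEX : E * X = (1 - t * d) • (E * U) := by
    rw [hX, mul_sub, mul_smul_comm, ← mul_assoc, ← mul_assoc, hEUE, smul_mul_assoc, smul_smul,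
      sub_smul, one_smul]
  have hXE : Xᴴ * E * X = (star (1 - t * d) * (1 - t * d)) • (Uᴴ * E * U) := by
    calc Xᴴ * E * X = (E * X)ᴴ * (E * X) := by
          rw [Matrix.conjTranspose_mul, hE, ← mul_assoc, mul_assoc Xᴴ E E, hEE]
      _ = _ := by
          rw [hEX, Matrix.conjTranspose_smul, Matrix.conjTranspose_mul, hE, smul_mul_smul_comm,
            mul_assoc, ← mul_assoc E, hEE, mul_assoc]
  have hXX : Xᴴ * X = 1 - t • (E * U) - star t • (Uᴴ * E) + (star t * t) • (Uᴴ * E * U) := by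
    have h1 : X = U * (1 - t • (E * U)) := by rw [hX, mul_sub, mul_one, mul_smul_comm, mul_assoc]
    rw [h1, Matrix.conjTranspose_mul, mul_assoc, ← mul_assoc Uᴴ, hU1, one_mul,
      Matrix.conjTranspose_sub, Matrix.conjTranspose_one, Matrix.conjTranspose_smul,
      Matrix.conjTranspose_mul, hE, sub_mul, one_mul, mul_sub, mul_one,
      smul_mul_smul_comm,
      mul_assoc Uᴴ E, ← mul_assoc E, hEE, mul_assoc]
    abel
  have hcoef : star (1 - t * d) * (1 - t * d) = star t * t := by
    have h1 := Complex.normSq_eq_conj_mul_self (z := 1 - t * d)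
    have h2 := Complex.normSq_eq_conj_mul_self (z := t)
    rw [Complex.normSq_eq_norm_sq] at h1 h2
    rw [htd] at h1
    exact h1.symm.trans h2
  have hW : (P * X * Pᴴ)ᴴ * (P * X * Pᴴ) = 1 := by
    have h1 : (P * X * Pᴴ)ᴴ * (P * X * Pᴴ) = P * (Xᴴ * X - Xᴴ * E * X) * Pᴴ := by
      have : Xᴴ * X - Xᴴ * E * X = Xᴴ * (Pᴴ * P) * X := by
        rw [hPP', Matrix.mul_sub Xᴴ, Matrix.sub_mul _ _ X, Matrix.mul_one]
      rw [this]
      simp only [Matrix.conjTranspose_mul, Matrix.conjTranspose_conjTranspose, Matrix.mul_assoc]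
    have h2 : Xᴴ * X - Xᴴ * E * X = 1 - E * (t • U) - (star t • Uᴴ) * E := by
      rw [hXX, hXE, hcoef, mul_smul_comm, smul_mul_assoc]
      abel
    rw [h1, h2, Matrix.mul_sub, Matrix.mul_sub, Matrix.sub_mul, Matrix.sub_mul, ← Matrix.mul_assoc P E,
      hPE, ← Matrix.mul_assoc P _ E, Matrix.mul_assoc _ E Pᴴ, hEP]
    simp [hPP]
  refine ⟨⟨P * X * Pᴴ, Matrix.mem_unitaryGroup_iff'.2 hW⟩, ?_⟩
  have hdiff : P * X * Pᴴ * P - P * U = -(P * (U * E)) - t • (P * (U * E) * U * Pᴴ * P) := by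
    rw [Matrix.mul_assoc _ Pᴴ, hPP', Matrix.mul_assoc _ Pᴴ, hPP', hX]
    have : P * (U - t • (U * E * U)) * (1 - E) - P * U =
        -(P * (U * E)) - t • (P * (U * E) * U * (1 - E)) := by
      simp only [Matrix.mul_sub, Matrix.sub_mul, Matrix.mul_one, Matrix.mul_smul, Matrix.smul_mul,
        Matrix.mul_assoc, smul_sub]
      abel
    exact this
  have hPUE : ‖P * (U * E)‖ ≤ 1 := (hPle _).trans (by rw [frobenius_norm_mul_left hU1, nE])
  have h2 : ‖P * (U * E) * U * Pᴴ * P‖ ≤ 1 := by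
    rw [nP]
    refine (hPle' _).trans ?_
    rwa [frobenius_norm_mul_right hU2]
  calc ‖P * X * Pᴴ * P - P * U‖ = ‖-(P * (U * E)) - t • (P * (U * E) * U * Pᴴ * P)‖ := by
        rw [hdiff]
    _ ≤ ‖P * (U * E)‖ + ‖t‖ * ‖P * (U * E) * U * Pᴴ * P‖ := by
        rw [← norm_smul, ← norm_neg (P * (U * E))]; exact norm_sub_le _ _
    _ ≤ 1 + 1 * 1 := by gcongr
    _ = 2 := by norm_num

/-- Intertwining matrices from an irreducible representation to one of smaller dimension vanish. -/
lemma eq_zero_of_intertwines {Γ : Type*} [Group Γ] {m n : ℕ} (hmn : m < n)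
    {ρ : Γ →* Matrix.unitaryGroup (Fin n) ℂ} (hρ : IsIrreducibleRep ρ)
    (π : Γ →* Matrix.unitaryGroup (Fin m) ℂ) (T : Matrix (Fin m) (Fin n) ℂ)
    (hT : ∀ g, T * (ρ g : Matrix (Fin n) (Fin n) ℂ) = (π g : Matrix (Fin m) (Fin m) ℂ) * T) :
    T = 0 := by
  have hinv : ∀ g, ∀ v ∈ LinearMap.ker T.mulVecLin,
      (ρ g : Matrix (Fin n) (Fin n) ℂ) *ᵥ v ∈ LinearMap.ker T.mulVecLin := fun g v hv => by
    rw [LinearMap.mem_ker, Matrix.mulVecLin_apply] at hv ⊢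
    rw [Matrix.mulVec_mulVec, hT, ← Matrix.mulVec_mulVec, hv, Matrix.mulVec_zero]
  rcases hρ _ hinv with h | h
  · exact absurd h (LinearMap.ker_ne_bot_of_finrank_lt (by simpa using hmn))
  · rw [LinearMap.ker_eq_top] at h
    exact (Matrix.toLin' (R := ℂ)).map_eq_zero_iff.1 h

/-- The conjugation action of a group on matrices between two unitary representations. -/
def intertwiningAction {Γ : Type*} [Group Γ] {m n : ℕ}
    (π : Γ →* Matrix.unitaryGroup (Fin m) ℂ) (ρ : Γ →* Matrix.unitaryGroup (Fin n) ℂ) :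
    Γ →* (Matrix (Fin m) (Fin n) ℂ →ₗ[ℝ] Matrix (Fin m) (Fin n) ℂ) where
  toFun g :=
    { toFun A := (π g : Matrix (Fin m) (Fin m) ℂ) * A * (ρ g⁻¹ : Matrix (Fin n) (Fin n) ℂ)
      map_add' A B := by rw [Matrix.mul_add, Matrix.add_mul]
      map_smul' c A := by simp }
  map_one' := by ext; simp
  map_mul' g h := by
    refine LinearMap.ext fun A => ?_
    simp [Matrix.mul_assoc, -map_inv]

lemma norm_le_of_near_irreducible {Γ : Type*} [Group Γ] {m n : ℕ} (hmn : m < n)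
    {ρ : Γ →* Matrix.unitaryGroup (Fin n) ℂ} (hρ : IsIrreducibleRep ρ)
    (π : Γ →* Matrix.unitaryGroup (Fin m) ℂ) (T : Matrix (Fin m) (Fin n) ℂ) {r : ℝ}
    (hr : ∀ g, ‖(π g : Matrix (Fin m) (Fin m) ℂ) * T
      - T * (ρ g : Matrix (Fin n) (Fin n) ℂ)‖ ≤ r) : ‖T‖ ≤ r := by
  have hl : ∀ (k : ℕ) (U : Matrix.unitaryGroup (Fin k) ℂ),
      (U : Matrix (Fin k) (Fin k) ℂ)ᴴ * U = 1 := fun k U => Matrix.mem_unitaryGroup_iff'.1 U.2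
  have hr' : ∀ (k : ℕ) (U : Matrix.unitaryGroup (Fin k) ℂ),
      (U : Matrix (Fin k) (Fin k) ℂ) * (U : Matrix (Fin k) (Fin k) ℂ)ᴴ = 1 :=
    fun k U => Matrix.mem_unitaryGroup_iff.1 U.2
  have hinv : ∀ g, (ρ g⁻¹ : Matrix (Fin n) (Fin n) ℂ) * (ρ g : Matrix (Fin n) (Fin n) ℂ) = 1 :=
    fun g => by simp
  have happ : ∀ g A, intertwiningAction π ρ g A * (ρ g : Matrix (Fin n) (Fin n) ℂ)
      = (π g : Matrix (Fin m) (Fin m) ℂ) * A := fun g A => by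
    change (π g : Matrix (Fin m) (Fin m) ℂ) * A * (ρ g⁻¹ : Matrix (Fin n) (Fin n) ℂ) * _ = _
    rw [Matrix.mul_assoc, hinv, Matrix.mul_one]
  have : ProperSpace (Matrix (Fin m) (Fin n) ℂ) := FiniteDimensional.proper ℂ _
  obtain ⟨x, hx, hfix⟩ := exists_fixed_of_orbit_near (intertwiningAction π ρ)
    (fun g A => by
      rw [← frobenius_norm_mul_right (hr' n (ρ g)), happ, frobenius_norm_mul_left (hl m (π g))])
    (p := T) (r := r) (fun g => by
      rw [← frobenius_norm_mul_right (hr' n (ρ g)), Matrix.sub_mul, happ]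
      exact hr g)
  have hx0 : x = 0 := eq_zero_of_intertwines hmn hρ π x fun g => by
    rw [← happ, hfix]
  simpa [hx0] using hx

/-- A group with irreducible unitary representations of arbitrarily large
dimensions is not uniformly HS stable. -/
theorem stmt_4 (Γ : Type*) [Group Γ]
    (h : ∀ d : ℕ, ∃ n : ℕ, d < n ∧
      ∃ π : Γ →* Matrix.unitaryGroup (Fin n) ℂ, IsIrreducibleRep π) :
    ¬ UniformlyHSStable Γ := by
  intro hst
  obtain ⟨ε, hε, hst⟩ := hst (1 / 2) (by norm_num)
  obtain ⟨N, hN⟩ := exists_nat_gt (max 16 ((6 / ε) ^ 2))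
  obtain ⟨n, hn, ρ, hρ⟩ := h (N + 1)
  obtain ⟨m, rfl⟩ : ∃ m, n = m + 1 := ⟨n - 1, by omega⟩
  have hm : max 16 ((6 / ε) ^ 2) < (m : ℝ) :=
    hN.trans (by exact_mod_cast (by omega : N < m))
  have hm4 : 4 < √(m : ℝ) :=
    Real.lt_sqrt_of_sq_lt (by linarith [le_max_left (16 : ℝ) ((6 / ε) ^ 2)])
  have hmε : 6 / ε < √(m : ℝ) :=
    Real.lt_sqrt_of_sq_lt ((le_max_right _ _).trans_lt hm)
  have hm0 : 0 < √(m : ℝ) := by linarith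
  choose φ hφ using fun g => exists_unitary_near_compression (ρ g)
  have hl : ∀ U : Matrix.unitaryGroup (Fin m) ℂ,
      (U : Matrix (Fin m) (Fin m) ℂ)ᴴ * U = 1 := fun U => Matrix.mem_unitaryGroup_iff'.1 U.2
  have hr : ∀ U : Matrix.unitaryGroup (Fin (m + 1)) ℂ,
      (U : Matrix (Fin (m + 1)) (Fin (m + 1)) ℂ) * (U : Matrix (Fin (m + 1)) (Fin (m + 1)) ℂ)ᴴ = 1 :=
    fun U => Matrix.mem_unitaryGroup_iff.1 U.2
  have hP := fun A : Matrix (Fin m) (Fin m) ℂ =>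
    frobenius_norm_mul_right (dropLast_mul_conjTranspose m) A
  obtain ⟨π, hπ⟩ := hst m φ fun g k => by
    rw [hsNorm_eq_frobenius, div_lt_iff₀ hm0, ← hP]
    have key : ((φ g : Matrix (Fin m) (Fin m) ℂ) * (φ k : Matrix (Fin m) (Fin m) ℂ)
        - (φ (g * k) : Matrix (Fin m) (Fin m) ℂ)) * dropLast m =
        (φ g : Matrix (Fin m) (Fin m) ℂ) * ((φ k : Matrix (Fin m) (Fin m) ℂ) * dropLast m
          - dropLast m * (ρ k : Matrix (Fin (m + 1)) (Fin (m + 1)) ℂ))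
        + ((φ g : Matrix (Fin m) (Fin m) ℂ) * dropLast m
          - dropLast m * (ρ g : Matrix (Fin (m + 1)) (Fin (m + 1)) ℂ))
            * (ρ k : Matrix (Fin (m + 1)) (Fin (m + 1)) ℂ)
        - ((φ (g * k) : Matrix (Fin m) (Fin m) ℂ) * dropLast m
          - dropLast m * (ρ (g * k) : Matrix (Fin (m + 1)) (Fin (m + 1)) ℂ)) := by
      rw [map_mul, Submonoid.coe_mul]
      simp only [Matrix.mul_sub, Matrix.sub_mul, Matrix.mul_assoc]
      abel
    rw [div_lt_iff₀' hε] at hmε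
    rw [key]
    refine lt_of_le_of_lt (norm_sub_le_of_le (norm_add_le_of_le ?_ ?_) (hφ (g * k)))
      ((by norm_num : (2 : ℝ) + 2 + 2 = 6) ▸ hmε)
    · rw [frobenius_norm_mul_left (hl _)]; exact hφ k
    · rw [frobenius_norm_mul_right (hr _)]; exact hφ g
  have hfin := norm_le_of_near_irreducible (Nat.lt_succ_self m) hρ π (dropLast m)
    (r := √m / 2 + 2) fun g => by
      have h1 := hπ g
      rw [hsNorm_eq_frobenius, div_lt_iff₀ hm0, norm_sub_rev, ← hP] at h1
      have h2 : (π g : Matrix (Fin m) (Fin m) ℂ) * dropLast m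
          - dropLast m * (ρ g : Matrix (Fin (m + 1)) (Fin (m + 1)) ℂ) =
          ((π g : Matrix (Fin m) (Fin m) ℂ) - (φ g : Matrix (Fin m) (Fin m) ℂ)) * dropLast m
          + ((φ g : Matrix (Fin m) (Fin m) ℂ) * dropLast m
            - dropLast m * (ρ g : Matrix (Fin (m + 1)) (Fin (m + 1)) ℂ)) := by
        rw [Matrix.sub_mul]; abel
      rw [h2]
      exact norm_add_le_of_le (by linarith) (hφ g)
  rw [norm_dropLast] at hfin
  linarith
end

section
/- For every matrix M ∈ M_n(ℂ) there exists a unitary matrix R ∈ U(n) such that ‖M − R‖_{HS,n} ≤ ‖M*M − I_n‖_{HS,n}. -/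
open scoped Matrix

namespace Matrix

/-- A matrix with pairwise orthogonal columns is a unitary matrix times a nonnegative diagonal
matrix. -/
theorem exists_unitary_mul_diagonal_of_isDiag {ι : Type*} [Fintype ι] [DecidableEq ι]
    (N : Matrix ι ι ℂ) (h : (Nᴴ * N).IsDiag) :
    ∃ U ∈ unitaryGroup ι ℂ, ∃ s : ι → ℝ, (∀ i, 0 ≤ s i) ∧
      N = U * diagonal (fun i => (s i : ℂ)) := by
  let c : ι → EuclideanSpace ℂ ι := fun j => WithLp.toLp 2 (fun i => N i j)
  have hc : ∀ i j, i ≠ j → inner ℂ (c i) (c j) = 0 := fun i j hij => by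
    have hN : (Nᴴ * N) i j = 0 := h hij
    rw [mul_apply] at hN
    rw [EuclideanSpace.inner_eq_star_dotProduct, ← hN]
    exact Finset.sum_congr rfl fun k _ => mul_comm _ _
  let v : ι → EuclideanSpace ℂ ι := fun j => ((‖c j‖⁻¹ : ℝ) : ℂ) • c j
  have hv : Orthonormal ℂ (Set.domRestrict {j | c j ≠ 0} v) := by
    refine ⟨fun j => ?_, fun i j hij => ?_⟩
    · have hj : ‖c j‖ ≠ 0 := norm_ne_zero_iff.mpr j.2
      simp [v, norm_smul, hj]
    · have hij' : (i : ι) ≠ j := fun e => hij (Subtype.ext e)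
      simp [v, inner_smul_left, inner_smul_right, hc _ _ hij']
  obtain ⟨b, hb⟩ := hv.exists_orthonormalBasis_extension_of_card_eq (by simp)
  have hbc : ∀ j, (‖c j‖ : ℂ) • b j = c j := fun j => by
    by_cases hj : c j = 0
    · simp [hj]
    · have hj' : (‖c j‖ : ℂ) ≠ 0 := by simpa using hj
      rw [hb j hj]
      simp [v, smul_smul, hj']
  refine ⟨(EuclideanSpace.basisFun ι ℂ).toBasis.toMatrix b,
    (EuclideanSpace.basisFun ι ℂ).toMatrix_orthonormalBasis_mem_unitary b,
    fun j => ‖c j‖, fun j => norm_nonneg _, ?_⟩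
  ext i j
  have hij : (‖c j‖ : ℂ) * b j i = N i j := congrArg (fun x : EuclideanSpace ℂ ι => x i) (hbc j)
  rw [mul_diagonal, mul_comm, ← hij]
  rfl

/-- Singular value decomposition of a square complex matrix. -/
theorem exists_singular_value_decomposition {ι : Type*} [Fintype ι] [DecidableEq ι]
    (M : Matrix ι ι ℂ) :
    ∃ U ∈ unitaryGroup ι ℂ, ∃ V ∈ unitaryGroup ι ℂ, ∃ s : ι → ℝ, (∀ i, 0 ≤ s i) ∧
      M = U * diagonal (fun i => (s i : ℂ)) * Vᴴ := by
  have hM : (Mᴴ * M).IsHermitian := isHermitian_conjTranspose_mul_self M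
  have hV := hM.eigenvectorUnitary.2
  have hdiag := hM.conjStarAlgAut_star_eigenvectorUnitary
  rw [Unitary.conjStarAlgAut_star_apply] at hdiag
  set V : Matrix ι ι ℂ := (hM.eigenvectorUnitary : Matrix ι ι ℂ)
  obtain ⟨U, hU, s, hs, h⟩ := exists_unitary_mul_diagonal_of_isDiag (M * V) (by
    rw [conjTranspose_mul, mul_assoc, ← mul_assoc Mᴴ, ← mul_assoc, ← star_eq_conjTranspose V,
      hdiag]
    exact isDiag_diagonal _)
  refine ⟨U, hU, V, hV, s, hs, ?_⟩
  rw [← h, mul_assoc, ← star_eq_conjTranspose, mem_unitaryGroup_iff.mp hV, mul_one]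

end Matrix

theorem hsNorm_unitary_mul_mul_unitary {n : ℕ} {U V : Matrix (Fin n) (Fin n) ℂ}
    (hU : U ∈ Matrix.unitaryGroup (Fin n) ℂ) (hV : V ∈ Matrix.unitaryGroup (Fin n) ℂ)
    (A : Matrix (Fin n) (Fin n) ℂ) : hsNorm (U * A * Vᴴ) = hsNorm A := by
  have hU' : Uᴴ * U = 1 := Matrix.mem_unitaryGroup_iff'.mp hU
  have hV' : Vᴴ * V = 1 := Matrix.mem_unitaryGroup_iff'.mp hV
  have h : U * A * Vᴴ * (U * A * Vᴴ)ᴴ = U * (A * Aᴴ * Uᴴ) := by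
    simp only [Matrix.conjTranspose_mul, Matrix.conjTranspose_conjTranspose, Matrix.mul_assoc]
    rw [← Matrix.mul_assoc Vᴴ, hV', Matrix.one_mul]
  rw [hsNorm, hsNorm, h, Matrix.trace_mul_comm, Matrix.mul_assoc, hU', Matrix.mul_one]

theorem hsNorm_diagonal_ofReal {n : ℕ} (d : Fin n → ℝ) :
    hsNorm (Matrix.diagonal fun i => (d i : ℂ)) = Real.sqrt (1 / (n : ℝ) * ∑ i, d i ^ 2) := by
  simp [hsNorm, Matrix.diagonal_conjTranspose, Matrix.trace_diagonal, pow_two]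

/-- For every M ∈ M_n(ℂ) there is a unitary R with ‖M − R‖_{HS,n} ≤ ‖M*M − I_n‖_{HS,n}. -/
theorem stmt_5 (n : ℕ) (M : Matrix (Fin n) (Fin n) ℂ) :
    ∃ R ∈ Matrix.unitaryGroup (Fin n) ℂ,
      hsNorm (M - R) ≤ hsNorm (Mᴴ * M - (1 : Matrix (Fin n) (Fin n) ℂ)) := by
  obtain ⟨U, hU, V, hV, s, hs, rfl⟩ := M.exists_singular_value_decomposition
  have hU' : Uᴴ * U = 1 := Matrix.mem_unitaryGroup_iff'.mp hU
  have hV' : V * Vᴴ = 1 := Matrix.mem_unitaryGroup_iff.mp hV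
  set D : Matrix (Fin n) (Fin n) ℂ := Matrix.diagonal fun i => (s i : ℂ) with hD
  have hDD : Dᴴ = D := by
    simp [hD, Matrix.diagonal_conjTranspose, Pi.star_def]
  refine ⟨U * Vᴴ, mul_mem hU (Unitary.star_mem hV), ?_⟩
  have h₁ : U * D * Vᴴ - U * Vᴴ = U * Matrix.diagonal (fun i => ((s i - 1 : ℝ) : ℂ)) * Vᴴ := by
    have : Matrix.diagonal (fun i => ((s i - 1 : ℝ) : ℂ)) = D - 1 := by
      rw [hD, ← Matrix.diagonal_one, Matrix.diagonal_sub]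
      simp
    rw [this, Matrix.mul_sub, Matrix.sub_mul, Matrix.mul_one]
  have h₂ : (U * D * Vᴴ)ᴴ * (U * D * Vᴴ) - 1 =
      V * Matrix.diagonal (fun i => ((s i ^ 2 - 1 : ℝ) : ℂ)) * Vᴴ := by
    have : Matrix.diagonal (fun i => ((s i ^ 2 - 1 : ℝ) : ℂ)) = D * D - 1 := by
      rw [hD, ← Matrix.diagonal_one, Matrix.diagonal_mul_diagonal, Matrix.diagonal_sub]
      simp [pow_two]
    rw [this, Matrix.mul_sub, Matrix.sub_mul, Matrix.mul_one, hV']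
    simp only [Matrix.conjTranspose_mul, Matrix.conjTranspose_conjTranspose, hDD,
      Matrix.mul_assoc]
    rw [← Matrix.mul_assoc Uᴴ, hU', Matrix.one_mul]
  rw [h₁, h₂, hsNorm_unitary_mul_mul_unitary hU hV, hsNorm_unitary_mul_mul_unitary hV hV,
    hsNorm_diagonal_ofReal, hsNorm_diagonal_ofReal]
  gcongr Real.sqrt (_ * ∑ i, ?_) with i
  nlinarith [mul_nonneg (sq_nonneg (s i - 1)) (mul_nonneg (hs i) (by linarith [hs i] : 0 ≤ s i + 2))]
end

section
/- Let Γ be a finitely generated residually finite group that is not virtually abelian. Then Γ has finite dimensional irreducible unitary representations of arbitrarily large dimensions: for every d ∈ ℕ there exist n > d and an irreducible group homomorphism Γ → U(n). -/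
open scoped Matrix

theorem eq_one_of_norm_pow_sub_one_le {E : Type*} [NormedRing E] [NormedAlgebra ℝ E]
    [CompleteSpace E] {c : E} {m : ℕ} (hm : 0 < m) (hc : c ^ m = 1) {r : ℝ} (hr : r < 1)
    (h : ∀ k : ℕ, ‖c ^ k - 1‖ ≤ r) : c = 1 := by
  set P : E := (m : ℝ)⁻¹ • ∑ k ∈ Finset.range m, c ^ k with hP
  have hm' : (m : ℝ) ≠ 0 := by positivity
  have hcP : c * P = P := by
    have hs : (c - 1) * ∑ k ∈ Finset.range m, c ^ k = 0 := by
      rw [mul_geom_sum, hc, sub_self]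
    rw [hP, mul_smul_comm]
    rw [sub_mul, one_mul, sub_eq_zero] at hs
    rw [hs]
  have hnorm : ‖1 - P‖ < 1 := by
    have hsum : 1 - P = (m : ℝ)⁻¹ • ∑ k ∈ Finset.range m, (1 - c ^ k) := by
      rw [Finset.sum_sub_distrib, smul_sub, hP]
      congr 1
      rw [Finset.sum_const, Finset.card_range, ← Nat.cast_smul_eq_nsmul ℝ, smul_smul,
        inv_mul_cancel₀ hm', one_smul]
    have hle : ‖∑ k ∈ Finset.range m, (1 - c ^ k)‖ ≤ m * r := by
      refine (norm_sum_le_of_le _ (f := fun k => 1 - c ^ k) (n := fun _ => r) ?_).trans (by simp)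
      intro k _
      rw [norm_sub_rev]
      exact h k
    rw [hsum, norm_smul, norm_inv, Real.norm_natCast]
    calc (m : ℝ)⁻¹ * _ ≤ (m : ℝ)⁻¹ * (m * r) := by gcongr
      _ = r := by field_simp
      _ < 1 := hr
  have hunit : IsUnit P := by
    simpa using isUnit_one_sub_of_norm_lt_one hnorm
  exact hunit.mul_right_cancel (by rw [hcP, one_mul])

section Unitary

open scoped commutatorElement

variable {E : Type*} [NormedRing E] [StarRing E] [CStarRing E]

theorem norm_commutatorElement_sub_one (a b : unitary E) :
    ‖((⁅a, b⁆ : unitary E) : E) - 1‖ = ‖(a * b - b * a : E)‖ := by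
  have h : (((⁅a, b⁆ : unitary E) : E) - 1) * ((b * a : unitary E) : E) = a * b - b * a := by
    rw [sub_mul, one_mul, ← Submonoid.coe_mul, commutatorElement_def]
    simp [mul_assoc]
  rw [← h, CStarRing.norm_mul_coe_unitary]

theorem norm_commutatorElement_sub_one_le (a b : unitary E) :
    ‖((⁅a, b⁆ : unitary E) : E) - 1‖ ≤ 2 * ‖(a : E) - 1‖ * ‖(b : E) - 1‖ := by
  rw [norm_commutatorElement_sub_one]
  have h : (a * b - b * a : E) = (a - 1) * (b - 1) - (b - 1) * (a - 1) := by noncomm_ring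
  rw [h]
  refine (norm_sub_le _ _).trans ?_
  have h1 := norm_mul_le ((a : E) - 1) (b - 1)
  have h2 := norm_mul_le ((b : E) - 1) (a - 1)
  linarith

theorem norm_commutatorElement_sub_one_le_right (a b : unitary E) :
    ‖((⁅a, b⁆ : unitary E) : E) - 1‖ ≤ 2 * ‖(b : E) - 1‖ := by
  rw [norm_commutatorElement_sub_one]
  have h : (a * b - b * a : E) = a * (b - 1) - (b - 1) * a := by noncomm_ring
  rw [h]
  refine (norm_sub_le _ _).trans ?_
  rw [CStarRing.norm_mul_coe_unitary, CStarRing.norm_coe_unitary_mul]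
  linarith

theorem commutatorElement_pow_left {G : Type*} [Group G] {a b : G} (h : Commute a ⁅a, b⁆) (k : ℕ) :
    ⁅a ^ k, b⁆ = ⁅a, b⁆ ^ k := by
  induction k with
  | zero => simp
  | succ k ih =>
    have h1 : ⁅a ^ (k + 1), b⁆ = a ^ k * ⁅a, b⁆ * (a ^ k)⁻¹ * ⁅a ^ k, b⁆ := by
      simp only [commutatorElement_def, pow_succ]
      group
    rw [h1, ih, (h.pow_left k).eq, mul_inv_cancel_right, pow_succ']

theorem commute_of_norm_sub_one_lt [NormedAlgebra ℝ E] [CompleteSpace E]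
    (G : Subgroup (unitary E)) [Finite G] {a b : unitary E} (ha : a ∈ G) (hb : b ∈ G)
    (ha' : ‖(a : E) - 1‖ < 1 / 4) (hb' : ‖(b : E) - 1‖ < 1 / 4) : Commute a b := by
  by_contra hab
  let S : Set (G × G) := {p | ‖((p.1 : unitary E) : E) - 1‖ < 1 / 4 ∧
    ‖((p.2 : unitary E) : E) - 1‖ < 1 / 4 ∧ ¬ Commute (p.1 : unitary E) p.2}
  obtain ⟨⟨⟨x, hx⟩, ⟨y, hy⟩⟩, ⟨hx', hy', hxy⟩, hmin⟩ := Set.exists_min_image S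
    (fun p => ‖((⁅(p.1 : unitary E), (p.2 : unitary E)⁆ : unitary E) : E) - 1‖)
    S.toFinite ⟨(⟨a, ha⟩, ⟨b, hb⟩), ha', hb', hab⟩
  dsimp only at hx' hy' hxy hmin
  set c : unitary E := ⁅x, y⁆ with hc
  have hcG : c ∈ G := G.mul_mem (G.mul_mem (G.mul_mem hx hy) (G.inv_mem hx)) (G.inv_mem hy)
  have hc1 : c ≠ 1 := fun h => hxy (commutatorElement_eq_one_iff_commute.1 h)
  have hcpos : 0 < ‖(c : E) - 1‖ := by
    rw [norm_pos_iff, sub_ne_zero]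
    exact fun h => hc1 (Subtype.ext h)
  have hcle : ‖(c : E) - 1‖ < 1 / 4 := by
    have := norm_commutatorElement_sub_one_le_right x y
    have := norm_commutatorElement_sub_one_le x y
    nlinarith [norm_nonneg ((x : E) - 1), norm_nonneg ((y : E) - 1)]
  have hxc : Commute x c := by
    by_contra hn
    have h1 := hmin (⟨x, hx⟩, ⟨c, hcG⟩) ⟨hx', hcle, hn⟩
    have h2 := norm_commutatorElement_sub_one_le x c
    dsimp only at h1
    nlinarith
  refine hc1 (Subtype.ext ?_)
  have hfin : IsOfFinOrder (⟨c, hcG⟩ : G) := isOfFinOrder_of_finite _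
  obtain ⟨m, hm, hpow⟩ := isOfFinOrder_iff_pow_eq_one.1 hfin
  refine eq_one_of_norm_pow_sub_one_le (r := 1 / 2) hm ?_ (by norm_num) fun k => ?_
  · exact congrArg (fun u : G => ((u : unitary E) : E)) hpow
  · have := norm_commutatorElement_sub_one_le_right (x ^ k) y
    rw [commutatorElement_pow_left hxc, SubmonoidClass.coe_pow] at this
    exact this.trans (by linarith)

end Unitary

section Jordan

open scoped Matrix.Norms.L2Operator

variable {Γ : Type*} [Group Γ]

/-- The subgroup generated by the elements which a unitary representation sends close to `1`. -/
def nearOneSubgroup {n : ℕ} (π : Γ →* Matrix.unitaryGroup (Fin n) ℂ) : Subgroup Γ :=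
  Subgroup.closure {g | ‖(π g : Matrix (Fin n) (Fin n) ℂ) - 1‖ < 1 / 4}

theorem commute_of_mem_nearOneSubgroup {n : ℕ} (π : Γ →* Matrix.unitaryGroup (Fin n) ℂ)
    [Finite π.range] {x y : Γ} (hx : x ∈ nearOneSubgroup π) (hy : y ∈ nearOneSubgroup π) :
    Commute (π x) (π y) := by
  let _ : NormedAlgebra ℝ (Matrix (Fin n) (Fin n) ℂ) := NormedAlgebra.restrictScalars ℝ ℂ _
  unfold nearOneSubgroup at hx hy
  induction hx, hy using Subgroup.closure_induction₂ with
  | mem x y hx hy => exact commute_of_norm_sub_one_lt π.range ⟨x, rfl⟩ ⟨y, rfl⟩ hx hy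
  | one_left => simp
  | one_right => simp
  | mul_left x y z _ _ _ h h' => rw [map_mul]; exact h.mul_left h'
  | mul_right y z x _ _ _ h h' => rw [map_mul]; exact h.mul_right h'
  | inv_left x y _ _ h => rw [map_inv]; exact h.inv_left
  | inv_right x y _ _ h => rw [map_inv]; exact h.inv_right

theorem exists_index_nearOneSubgroup_le (n : ℕ) : ∃ K : ℕ,
    ∀ π : Γ →* Matrix.unitaryGroup (Fin n) ℂ,
      (nearOneSubgroup π).FiniteIndex ∧ (nearOneSubgroup π).index ≤ K := by
  let _ : ProperSpace (Matrix (Fin n) (Fin n) ℂ) := FiniteDimensional.proper ℂ _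
  have htb : TotallyBounded (Metric.closedBall (0 : Matrix (Fin n) (Fin n) ℂ) 1) :=
    (isCompact_closedBall _ _).totallyBounded
  obtain ⟨T, hT, hcov⟩ := Metric.totallyBounded_iff.1 htb (1 / 8) (by norm_num)
  refine ⟨T.ncard, fun π => ?_⟩
  have hball (g : Γ) : ∃ t : T, dist (π g : Matrix (Fin n) (Fin n) ℂ) t < 1 / 8 := by
    have hg : (π g : Matrix (Fin n) (Fin n) ℂ) ∈ Metric.closedBall 0 1 := by
      rw [mem_closedBall_zero_iff]
      rcases subsingleton_or_nontrivial (Matrix (Fin n) (Fin n) ℂ) with h | h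
      · rw [Subsingleton.elim (π g : Matrix (Fin n) (Fin n) ℂ) 0, norm_zero]
        exact zero_le_one
      · exact (CStarRing.norm_coe_unitary (π g)).le
    simpa using hcov hg
  choose t ht using hball
  have hinj : Function.Injective fun q : Γ ⧸ nearOneSubgroup π => t q.out := by
    intro p q hpq
    rw [← p.out_eq', ← q.out_eq']
    refine QuotientGroup.eq.2 (Subgroup.subset_closure ?_)
    have hp := ht p.out
    have hq := ht q.out
    rw [← show t p.out = t q.out from hpq, dist_comm] at hq
    have hd := dist_triangle_left (π p.out : Matrix (Fin n) (Fin n) ℂ) (π q.out) (t p.out)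
    rw [Set.mem_ofPred_eq, ← CStarRing.norm_coe_unitary_mul (π p.out), mul_sub, mul_one,
      ← Submonoid.coe_mul, ← map_mul, mul_inv_cancel_left, ← dist_eq_norm, dist_comm]
    rw [dist_comm] at hp
    linarith
  have : Finite T := hT
  have : Finite (Γ ⧸ nearOneSubgroup π) := Finite.of_injective _ hinj
  exact ⟨Subgroup.finiteIndex_of_finite_quotient, Nat.card_le_card_of_injective _ hinj⟩

end Jordan

theorem Group.FG.finite_monoidHom {Γ P : Type*} [Group Γ] [Group P] [Finite P]
    (h : Group.FG Γ) : Finite (Γ →* P) := by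
  obtain ⟨S, hS, hfin⟩ := Group.fg_iff.1 h
  have : Finite S := hfin
  refine Finite.of_injective (β := S → P) (fun f s => f s) fun f g hfg => ?_
  exact MonoidHom.eq_of_eqOn_dense hS fun s hs => congrFun hfg ⟨s, hs⟩

theorem Group.FG.exists_finiteIndex_le {Γ : Type*} [Group Γ] (h : Group.FG Γ) (K : ℕ) :
    ∃ A : Subgroup Γ, A.FiniteIndex ∧
      ∀ H : Subgroup Γ, H.FiniteIndex → H.index ≤ K → A ≤ H := by
  refine ⟨⨅ k : Fin (K + 1), ⨅ f : Γ →* Equiv.Perm (Fin k), f.ker, ?_, fun H hH hK => ?_⟩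
  · refine Subgroup.finiteIndex_iInf fun k => ?_
    have := Group.FG.finite_monoidHom (P := Equiv.Perm (Fin k)) h
    exact Subgroup.finiteIndex_iInf fun f => inferInstance
  · let e : Γ ⧸ H ≃ Fin H.index := Finite.equivFin (Γ ⧸ H)
    refine le_trans ?_ H.normalCore_le
    refine (iInf_le _ (⟨H.index, Nat.lt_succ_of_le hK⟩ : Fin (K + 1))).trans ?_
    refine (iInf_le _ (e.permCongrHom.toMonoidHom.comp (MulAction.toPermHom Γ (Γ ⧸ H)))).trans ?_
    rw [Subgroup.normalCore_eq_ker]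
    intro g hg
    rw [MonoidHom.mem_ker] at hg ⊢
    exact (map_eq_one_iff e.permCongrHom e.permCongrHom.injective).1 hg

section Separation

universe u

/-- A representation by isometries, trivial on `N`, that moves `x`. -/
structure IsIsometricSeparating {Γ : Type*} [Group Γ] (N : Subgroup Γ) (x : Γ) {V : Type*}
    [NormedAddCommGroup V] [InnerProductSpace ℂ V] (ρ : Γ →* (V →ₗ[ℂ] V)) : Prop where
  norm_map : ∀ g v, ‖ρ g v‖ = ‖v‖
  map_eq_one : ∀ g ∈ N, ρ g = 1
  map_ne_one : ρ x ≠ 1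

variable {Γ : Type u} [Group Γ] {N : Subgroup Γ} {x : Γ}
  {V : Type u} [NormedAddCommGroup V] [InnerProductSpace ℂ V] {ρ : Γ →* (V →ₗ[ℂ] V)}

/-- The restriction of a representation to an invariant subspace. -/
def MonoidHom.restrictInvariant (ρ : Γ →* (V →ₗ[ℂ] V)) (W : Submodule ℂ V)
    (hW : ∀ g, ∀ v ∈ W, ρ g v ∈ W) : Γ →* (W →ₗ[ℂ] W) where
  toFun g := (ρ g).restrict (hW g)
  map_one' := by ext; simp
  map_mul' g h := by ext; simp

namespace IsIsometricSeparating

theorem inner_map_map (h : IsIsometricSeparating N x ρ) (g : Γ) (v w : V) :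
    inner ℂ (ρ g v) (ρ g w) = inner ℂ v w :=
  LinearIsometry.inner_map_map (⟨ρ g, h.norm_map g⟩ : V →ₗᵢ[ℂ] V) v w

theorem restrictInvariant (h : IsIsometricSeparating N x ρ) {W : Submodule ℂ V}
    (hW : ∀ g, ∀ v ∈ W, ρ g v ∈ W) (hx : ∃ v ∈ W, ρ x v ≠ v) :
    IsIsometricSeparating N x (ρ.restrictInvariant W hW) where
  norm_map g v := h.norm_map g v
  map_eq_one g hg := by
    ext v
    exact DFunLike.congr_fun (h.map_eq_one g hg) (v : V)
  map_ne_one h1 := by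
    obtain ⟨v, hv, hne⟩ := hx
    have h2 := DFunLike.congr_fun h1 (⟨v, hv⟩ : W)
    exact hne (congrArg Subtype.val h2)

theorem map_mem_orthogonal (h : IsIsometricSeparating N x ρ) {W : Submodule ℂ V}
    (hW : ∀ g, ∀ v ∈ W, ρ g v ∈ W) (g : Γ) (v : V) (hv : v ∈ Wᗮ) : ρ g v ∈ Wᗮ := by
  intro w hw
  rw [← h.inner_map_map g⁻¹, ← Module.End.mul_apply, ← map_mul, inv_mul_cancel, map_one]
  exact hv _ (hW _ _ hw)

theorem exists_irreducible [FiniteDimensional ℂ V] (h : IsIsometricSeparating N x ρ) :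
    ∃ (W : Type u) (_ : NormedAddCommGroup W) (_ : InnerProductSpace ℂ W)
      (_ : FiniteDimensional ℂ W) (σ : Γ →* (W →ₗ[ℂ] W)), IsIsometricSeparating N x σ ∧
      ∀ U : Submodule ℂ W, (∀ g, ∀ v ∈ U, σ g v ∈ U) → U = ⊥ ∨ U = ⊤ := by
  induction hn : Module.finrank ℂ V using Nat.strong_induction_on generalizing V with
  | _ n ih =>
  by_cases hirr : ∀ U : Submodule ℂ V, (∀ g, ∀ v ∈ U, ρ g v ∈ U) → U = ⊥ ∨ U = ⊤
  · exact ⟨V, _, _, ‹_›, ρ, h, hirr⟩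
  push Not at hirr
  obtain ⟨U, hU, hbot, htop⟩ := hirr
  by_cases hx : ∃ v ∈ U, ρ x v ≠ v
  · exact ih _ (hn ▸ Submodule.finrank_lt htop) (h.restrictInvariant hU hx) rfl
  · have hU' : Uᗮ ≠ ⊤ := by rwa [Ne, Submodule.orthogonal_eq_top_iff]
    have hx' : ∃ v ∈ Uᗮ, ρ x v ≠ v := by
      by_contra! hx'
      push Not at hx
      refine h.map_ne_one (LinearMap.ext fun v => ?_)
      obtain ⟨a, ha, b, hb, rfl⟩ := U.exists_add_mem_mem_orthogonal v
      simp [hx a ha, hx' b hb]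
    exact ih _ (hn ▸ Submodule.finrank_lt hU')
      (h.restrictInvariant (h.map_mem_orthogonal hU) hx') rfl

theorem exists_unitary [FiniteDimensional ℂ V] (h : IsIsometricSeparating N x ρ)
    (hirr : ∀ U : Submodule ℂ V, (∀ g, ∀ v ∈ U, ρ g v ∈ U) → U = ⊥ ∨ U = ⊤) :
    ∃ (n : ℕ) (π : Γ →* Matrix.unitaryGroup (Fin n) ℂ),
      IsIrreducibleRep π ∧ N ≤ π.ker ∧ π x ≠ 1 := by
  let b := stdOrthonormalBasis ℂ V
  let e := LinearMap.toMatrixOrthonormal b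
  have hmem (g : Γ) : e (ρ g) ∈ Matrix.unitaryGroup (Fin (Module.finrank ℂ V)) ℂ := by
    rw [Matrix.mem_unitaryGroup_iff', ← map_star, ← map_mul, ← map_one e]
    congr 1
    ext v
    refine ext_inner_left ℂ fun w => ?_
    rw [Module.End.mul_apply, LinearMap.star_eq_adjoint, LinearMap.adjoint_inner_right,
      h.inner_map_map, Module.End.one_apply]
  let π : Γ →* Matrix.unitaryGroup (Fin (Module.finrank ℂ V)) ℂ :=
    { toFun g := ⟨e (ρ g), hmem g⟩
      map_one' := Subtype.ext (by simp)
      map_mul' g k := Subtype.ext (by simp) }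
  have hπ (g : Γ) : π g = 1 ↔ ρ g = 1 := by
    rw [← map_eq_one_iff e e.injective, Subtype.ext_iff]
    rfl
  refine ⟨_, π, fun W hW => ?_, fun g hg => (hπ g).2 (h.map_eq_one g hg),
    fun hx => h.map_ne_one ((hπ x).1 hx)⟩
  let f : V ≃ₗ[ℂ] (Fin (Module.finrank ℂ V) → ℂ) := b.toBasis.equivFun
  have hf (g : Γ) (v : V) : f (ρ g v) = (π g : Matrix _ _ ℂ) *ᵥ f v :=
    (LinearMap.toMatrix_mulVec_repr b.toBasis b.toBasis (ρ g) v).symm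
  have hinv : ∀ g, ∀ v ∈ W.comap f.toLinearMap, ρ g v ∈ W.comap f.toLinearMap := by
    intro g v hv
    have := hW g (f v) hv
    rw [← hf] at this
    exact this
  have hmap : (W.comap f.toLinearMap).map f.toLinearMap = W :=
    Submodule.map_comap_eq_of_surjective f.surjective W
  rcases hirr _ hinv with h0 | h1
  · left
    rw [← hmap, h0, Submodule.map_bot]
  · right
    rw [← hmap, h1, Submodule.map_top, LinearMap.range_eq_top]
    exact f.surjective

end IsIsometricSeparating

theorem exists_isIrreducibleRep_ne_one [N.Normal] [N.FiniteIndex] (hx : x ∉ N) :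
    ∃ (n : ℕ) (π : Γ →* Matrix.unitaryGroup (Fin n) ℂ),
      IsIrreducibleRep π ∧ N ≤ π.ker ∧ π x ≠ 1 := by
  have : Fintype (Γ ⧸ N) := Fintype.ofFinite _
  let L (g : Γ) : EuclideanSpace ℂ (Γ ⧸ N) ≃ₗᵢ[ℂ] EuclideanSpace ℂ (Γ ⧸ N) :=
    LinearIsometryEquiv.piLpCongrLeft 2 ℂ ℂ (MulAction.toPerm g)
  have hL (g : Γ) (v : EuclideanSpace ℂ (Γ ⧸ N)) (q : Γ ⧸ N) : L g v q = v (g⁻¹ • q) := rfl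
  let ρ : Γ →* (EuclideanSpace ℂ (Γ ⧸ N) →ₗ[ℂ] EuclideanSpace ℂ (Γ ⧸ N)) :=
    { toFun g := (L g).toLinearEquiv.toLinearMap
      map_one' := by
        ext v q
        change L 1 v q = v q
        rw [hL, inv_one, one_smul]
      map_mul' g k := by
        ext v q
        change L (g * k) v q = L g (L k v) q
        rw [hL, hL, hL, mul_inv_rev, mul_smul] }
  have hρ (g : Γ) : ρ g = 1 ↔ g ∈ N := by
    classical
    constructor
    · intro h
      have h1 : L g (EuclideanSpace.single ((1 : Γ) : Γ ⧸ N) 1) ((1 : Γ) : Γ ⧸ N) =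
          (EuclideanSpace.single ((1 : Γ) : Γ ⧸ N) 1 : EuclideanSpace ℂ (Γ ⧸ N))
            ((1 : Γ) : Γ ⧸ N) :=
        congrArg (fun w : EuclideanSpace ℂ (Γ ⧸ N) => w _) (DFunLike.congr_fun h _)
      rw [hL] at h1
      by_contra hg
      have h2 : g⁻¹ • ((1 : Γ) : Γ ⧸ N) ≠ ((1 : Γ) : Γ ⧸ N) := by
        intro h3
        have h4 : ((g⁻¹ * 1 : Γ) : Γ ⧸ N) = ((1 : Γ) : Γ ⧸ N) := h3
        rw [QuotientGroup.eq] at h4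
        exact hg (by simpa using h4)
      rw [PiLp.single_apply, PiLp.single_apply, if_neg h2, if_pos rfl] at h1
      exact zero_ne_one h1
    · intro hg
      ext v q
      change L g v q = v q
      rw [hL]
      refine congrArg v ?_
      induction q using QuotientGroup.induction_on with
      | H k =>
        change ((g⁻¹ * k : Γ) : Γ ⧸ N) = k
        rw [QuotientGroup.eq]
        simpa [mul_assoc] using ‹N.Normal›.conj_mem g hg k⁻¹
  have hsep : IsIsometricSeparating N x ρ :=
    ⟨fun g v => (L g).norm_map v, fun g hg => (hρ g).2 hg, fun h => hx ((hρ x).1 h)⟩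
  obtain ⟨W, _, _, _, σ, hσ, hirr⟩ := hsep.exists_irreducible
  exact hσ.exists_unitary hirr

end Separation

/-- A finitely generated residually finite group that is not virtually abelian
has irreducible unitary representations of arbitrarily large dimensions. -/
theorem stmt_8 (Γ : Type*) [Group Γ] (hfg : Group.FG Γ) (hrf : ResiduallyFinite Γ)
    (hna : ¬ VirtuallyAbelian Γ) :
    ∀ d : ℕ, ∃ n : ℕ, d < n ∧
      ∃ π : Γ →* Matrix.unitaryGroup (Fin n) ℂ, IsIrreducibleRep π := by
  intro d
  by_contra! hd
  choose K hK using fun n : ℕ => exists_index_nearOneSubgroup_le (Γ := Γ) n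
  obtain ⟨A, hA, hAle⟩ := hfg.exists_finiteIndex_le ((Finset.range (d + 1)).sup K)
  refine hna ⟨A, hA, fun x hx y hy => ?_⟩
  by_contra hxy
  obtain ⟨N, hN, hNfin, hmem⟩ := hrf (x * y * (y * x)⁻¹) (by rwa [Ne, mul_inv_eq_one])
  obtain ⟨n, π, hirr, hker, hne⟩ := exists_isIrreducibleRep_ne_one hmem
  have hn : n ≤ d := not_lt.1 fun h => hd n h π hirr
  have hfin : π.ker.FiniteIndex := Subgroup.finiteIndex_of_le hker
  have : Finite π.range :=
    Finite.of_equiv _ (QuotientGroup.quotientKerEquivRange π).toEquiv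
  have hle : A ≤ nearOneSubgroup π :=
    hAle _ (hK n π).1 ((hK n π).2.trans
      (Finset.le_sup (f := K) (Finset.mem_range.2 (Nat.lt_succ_of_le hn))))
  have hcomm := commute_of_mem_nearOneSubgroup π (hle hx) (hle hy)
  exact hne (by rw [map_mul, map_inv, map_mul, map_mul, hcomm.eq, mul_inv_cancel])
end

section
/- Let Γ be a group, let n ≥ 36, and suppose π: Γ → U(n) is an irreducible unitary representation. Then there exists a map ψ: Γ → U(n−1) such that ‖ψ(g)ψ(h) − ψ(gh)‖_{HS,n−1} ≤ 4/√(n−1) for all g,h ∈ Γ, and yet for every group homomorphism ρ: Γ → U(n−1) there exists g ∈ Γ with ‖ψ(g) − ρ(g)‖_{HS,n−1} ≥ 1/2. -/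
open scoped Matrix

/-- A nonempty closed convex set in a Hilbert space contains a point which is the only point of the
set of at most its norm. -/
theorem exists_unique_norm_minimizer {H : Type*} [NormedAddCommGroup H] [InnerProductSpace ℝ H]
    [CompleteSpace H] {K : Set H} (hne : K.Nonempty) (hcl : IsClosed K) (hcv : Convex ℝ K) :
    ∃ x ∈ K, ∀ y ∈ K, ‖y‖ ≤ ‖x‖ → y = x := by
  obtain ⟨x, hxK, hx⟩ := exists_norm_eq_iInf_of_complete_convex hne hcl.isComplete hcv 0
  refine ⟨x, hxK, fun y hy hyx => ?_⟩
  have h := (norm_eq_iInf_iff_real_inner_le_zero hcv hxK).1 hx y hy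
  have hexp : ‖y - x‖ ^ 2 = ‖y‖ ^ 2 - ‖x‖ ^ 2 + 2 * inner ℝ ((0 : H) - x) (y - x) := by
    rw [norm_sub_sq_real, zero_sub, inner_neg_left, inner_sub_right, real_inner_self_eq_norm_sq,
      real_inner_comm x y]
    ring
  have hsq : ‖y‖ ^ 2 ≤ ‖x‖ ^ 2 := by gcongr
  have h0 : ‖y - x‖ ^ 2 ≤ 0 := by linarith
  exact sub_eq_zero.1 (norm_eq_zero.1 (pow_eq_zero_iff two_ne_zero |>.1
    (le_antisymm h0 (sq_nonneg _))))

/-- If a set of contractions `T g` permutes an orbit contained in a ball that avoids `0`, then the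
closed convex hull of the orbit contains a nonzero common fixed point. -/
theorem exists_common_fixed_point_ne_zero {Γ H : Type*} [NormedAddCommGroup H]
    [InnerProductSpace ℝ H] [CompleteSpace H] [Nonempty Γ] (T : Γ → H →L[ℝ] H)
    (hT : ∀ g x, ‖T g x‖ ≤ ‖x‖) (o : Γ → H) (ho : ∀ g h, T g (o h) ∈ Set.range o)
    (v : H) (r : ℝ) (hr : r < ‖v‖) (hball : ∀ g, ‖o g - v‖ ≤ r) :
    ∃ x, x ≠ 0 ∧ ∀ g, T g x = x := by
  obtain ⟨x, hxK, hx⟩ := exists_unique_norm_minimizer (K := closedConvexHull ℝ (Set.range o))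
    ((Set.range_nonempty o).mono (subset_closedConvexHull ..)) isClosed_closedConvexHull
    convex_closedConvexHull
  have hsub : closedConvexHull ℝ (Set.range o) ⊆ Metric.closedBall v r :=
    closedConvexHull_min (by
      rintro _ ⟨g, rfl⟩
      simpa [dist_eq_norm] using hball g) (convex_closedBall v r) Metric.isClosed_closedBall
  refine ⟨x, ?_, fun g => hx _ ?_ (hT g x)⟩
  · rintro rfl
    have := hsub hxK
    rw [Metric.mem_closedBall, dist_zero_left] at this
    linarith
  · have hinv : closedConvexHull ℝ (Set.range o) ⊆ T g ⁻¹' closedConvexHull ℝ (Set.range o) :=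
      closedConvexHull_min (by
        rintro _ ⟨h, rfl⟩
        exact subset_closedConvexHull (ho g h))
        (convex_closedConvexHull.linear_preimage (T g).toLinearMap)
        (isClosed_closedConvexHull.preimage (T g).continuous)
    exact hinv hxK

section Frobenius

attribute [local instance] Matrix.frobeniusNormedAddCommGroup Matrix.frobeniusNormedSpace

variable {m n k : Type*} [Fintype m] [Fintype n] [Fintype k]

namespace Matrix

theorem frobenius_norm_sq (A : Matrix m n ℂ) : ‖A‖ ^ 2 = ∑ i, ∑ j, ‖A i j‖ ^ 2 := by
  rw [frobenius_norm_def, ← Real.sqrt_eq_rpow, Real.sq_sqrt]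
  · simp
  · positivity

theorem frobenius_norm_sq_eq_re_trace (A : Matrix m n ℂ) : ‖A‖ ^ 2 = (A * Aᴴ).trace.re := by
  rw [frobenius_norm_sq]
  simp [trace, mul_apply, Complex.mul_conj, Complex.sq_norm]

theorem frobenius_norm_sq_eq_re_trace' (A : Matrix m n ℂ) : ‖A‖ ^ 2 = (Aᴴ * A).trace.re := by
  rw [frobenius_norm_sq_eq_re_trace, trace_mul_comm]

theorem frobenius_norm_mul_left [DecidableEq m] {U : Matrix k m ℂ} (hU : Uᴴ * U = 1)
    (X : Matrix m n ℂ) : ‖U * X‖ = ‖X‖ := by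
  rw [← sq_eq_sq₀ (norm_nonneg _) (norm_nonneg _), frobenius_norm_sq_eq_re_trace',
    frobenius_norm_sq_eq_re_trace', conjTranspose_mul, Matrix.mul_assoc, ← Matrix.mul_assoc Uᴴ,
    hU, Matrix.one_mul]

theorem frobenius_norm_mul_right [DecidableEq n] {U : Matrix n k ℂ} (hU : U * Uᴴ = 1)
    (X : Matrix m n ℂ) : ‖X * U‖ = ‖X‖ := by
  rw [← sq_eq_sq₀ (norm_nonneg _) (norm_nonneg _), frobenius_norm_sq_eq_re_trace,
    frobenius_norm_sq_eq_re_trace, conjTranspose_mul, Matrix.mul_assoc, ← Matrix.mul_assoc U,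
    hU, Matrix.one_mul]

theorem frobenius_norm_sq_vecMulVec (b : m → ℂ) (c : n → ℂ) :
    ‖vecMulVec b c‖ ^ 2 = (∑ i, ‖b i‖ ^ 2) * ∑ j, ‖c j‖ ^ 2 := by
  simp [frobenius_norm_sq, vecMulVec_apply, mul_pow, Finset.sum_mul_sum]

theorem frobenius_norm_vecMulVec_le_one {b : m → ℂ} {c : n → ℂ} (hb : ∑ i, ‖b i‖ ^ 2 ≤ 1)
    (hc : ∑ j, ‖c j‖ ^ 2 ≤ 1) : ‖vecMulVec b c‖ ≤ 1 := by
  rw [← sq_le_one_iff₀ (norm_nonneg _), frobenius_norm_sq_vecMulVec]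
  exact mul_le_one₀ hb (by positivity) hc

/-- The real inner product `Re tr (A Bᴴ)` inducing the Frobenius norm. -/
noncomputable abbrev frobeniusRealInnerProductSpace : InnerProductSpace ℝ (Matrix m n ℂ) where
  inner A B := (A * Bᴴ).trace.re
  norm_sq_eq_re_inner A := by simpa using frobenius_norm_sq_eq_re_trace A
  conj_inner_symm A B := by
    rw [← conjTranspose_conjTranspose (B * Aᴴ), trace_conjTranspose]
    simp
  add_left A B C := by simp [Matrix.add_mul]
  smul_left A B r := by simp

/-- Two unitary representations, one of which compresses approximately to the other, have a nonzero
intertwiner. -/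
theorem exists_intertwiner_ne_zero {Γ : Type*} [Group Γ] [DecidableEq m] [DecidableEq n]
    (π : Γ →* unitaryGroup m ℂ) (ρ : Γ →* unitaryGroup n ℂ) (V : Matrix m n ℂ) (r : ℝ)
    (hr : r < ‖V‖) (h : ∀ g, ‖(π g : Matrix m m ℂ) * V - V * (ρ g : Matrix n n ℂ)‖ ≤ r) :
    ∃ X : Matrix m n ℂ, X ≠ 0 ∧ ∀ g, (π g : Matrix m m ℂ) * X = X * (ρ g : Matrix n n ℂ) := by
  have hπ (g) : (π g : Matrix m m ℂ)ᴴ * π g = 1 := (π g).2.1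
  have hρ (g) : (ρ g : Matrix n n ℂ)ᴴ * ρ g = 1 := (ρ g).2.1
  have hρ' (g) : (ρ g : Matrix n n ℂ) * (ρ g : Matrix n n ℂ)ᴴ = 1 := (ρ g).2.2
  let _ : InnerProductSpace ℝ (Matrix m n ℂ) := frobeniusRealInnerProductSpace
  let L (g : Γ) : Matrix m n ℂ →ₗ[ℝ] Matrix m n ℂ :=
    { toFun := fun X => (π g : Matrix m m ℂ) * X * (ρ g : Matrix n n ℂ)ᴴ
      map_add' := fun X Y => by rw [Matrix.mul_add, Matrix.add_mul]
      map_smul' := fun a X => by simp }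
  have hL (g X) : L g X = (π g : Matrix m m ℂ) * X * (ρ g : Matrix n n ℂ)ᴴ := rfl
  obtain ⟨X, hX0, hX⟩ := exists_common_fixed_point_ne_zero
    (fun g => (L g).mkContinuous 1 fun X => by
      rw [hL, frobenius_norm_mul_right (by simp [hρ]), frobenius_norm_mul_left (hπ g), one_mul])
    (fun g X => by
      simp only [LinearMap.mkContinuous_apply]
      rw [hL, frobenius_norm_mul_right (by simp [hρ]), frobenius_norm_mul_left (hπ g)])
    (fun g => L g V)
    (fun g h => ⟨g * h, by simp [hL, Matrix.mul_assoc]⟩) V r hr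
    (fun g => by
      have hfac : L g V - V = ((π g : Matrix m m ℂ) * V - V * (ρ g : Matrix n n ℂ)) *
          (ρ g : Matrix n n ℂ)ᴴ := by
        rw [Matrix.sub_mul, Matrix.mul_assoc V, hρ', Matrix.mul_one, hL]
      rw [hfac, frobenius_norm_mul_right (by simp [hρ])]
      exact h g)
  refine ⟨X, hX0, fun g => ?_⟩
  have hg : (π g : Matrix m m ℂ) * X * (ρ g : Matrix n n ℂ)ᴴ = X := hX g
  conv_rhs => rw [← hg]
  rw [Matrix.mul_assoc, hρ, Matrix.mul_one]

open scoped ComplexOrder in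
theorem frobenius_norm_mul_le_of_add_vecMulVec_eq_one [DecidableEq m] {A : Matrix k m ℂ} {c : m → ℂ}
    (h : Aᴴ * A + vecMulVec (star c) c = 1) (X : Matrix m n ℂ) : ‖A * X‖ ≤ ‖X‖ := by
  rw [← sq_le_sq₀ (norm_nonneg _) (norm_nonneg _), frobenius_norm_sq_eq_re_trace',
    frobenius_norm_sq_eq_re_trace', conjTranspose_mul, Matrix.mul_assoc, ← Matrix.mul_assoc Aᴴ,
    eq_sub_of_add_eq h, Matrix.sub_mul, Matrix.mul_sub, Matrix.one_mul, trace_sub, Complex.sub_re,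
    sub_le_self_iff, vecMulVec_mul, mul_vecMulVec, trace_vecMulVec, ← star_vecMul]
  exact (Complex.le_def.1 (dotProduct_star_self_nonneg (c ᵥ* X))).1.trans_eq (by
    rw [dotProduct_comm])

/-- Closing a unitary block matrix `[A, b; c, d]` with the feedback `z` gives an isometry. -/
theorem conjTranspose_mul_self_add_smul_vecMulVec [DecidableEq m] {A : Matrix k m ℂ} {b : k → ℂ}
    {c : m → ℂ} {d z t : ℂ} (h1 : Aᴴ * A + vecMulVec (star c) c = 1)
    (h2 : Aᴴ *ᵥ b = -(d • star c)) (h3 : star b ⬝ᵥ b = 1 - star d * d) (hz : star z * z = 1)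
    (ht : t * (z - d) = 1) :
    (A + t • vecMulVec b c)ᴴ * (A + t • vecMulVec b c) = 1 := by
  have h4 : star b ᵥ* A = -(star d • c) := by
    simpa [star_mulVec] using congrArg star h2
  have ht' : star t * (star z - star d) = 1 := by simpa using congrArg star ht
  have hcoef : -1 - t * d - star t * star d + star t * t * (1 - star d * d) = 0 := by
    linear_combination (t * (z - d)) * ht' + ht + t * d * ht' + star t * star d * ht
      - t * star t * hz
  have hAA := eq_sub_of_add_eq h1
  calc (A + t • vecMulVec b c)ᴴ * (A + t • vecMulVec b c)
      = Aᴴ * A + t • vecMulVec (Aᴴ *ᵥ b) c + star t • vecMulVec (star c) (star b ᵥ* A)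
        + (star t * t * (star b ⬝ᵥ b)) • vecMulVec (star c) c := by
        rw [conjTranspose_add, conjTranspose_smul, conjTranspose_vecMulVec, Matrix.add_mul,
          Matrix.mul_add, Matrix.mul_add, Matrix.mul_smul, Matrix.mul_smul, Matrix.smul_mul,
          Matrix.smul_mul, mul_vecMulVec, vecMulVec_mul, vecMulVec_mul_vecMulVec, vecMulVec_smul]
        module
    _ = 1 + (-1 - t * d - star t * star d + star t * t * (1 - star d * d)) •
          vecMulVec (star c) c := by
        rw [hAA, h2, h3, h4, neg_vecMulVec, vecMulVec_neg, smul_vecMulVec, vecMulVec_smul]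
        module
    _ = 1 := by rw [hcoef, zero_smul, add_zero]

section Compression

variable {N : ℕ}

/-- The compression of a square matrix to all but the last coordinate. -/
def compress (P : Matrix (Fin (N + 1)) (Fin (N + 1)) ℂ) : Matrix (Fin N) (Fin N) ℂ :=
  P.submatrix Fin.castSucc Fin.castSucc

/-- The off-diagonal part of the last column. -/
def lastCol (P : Matrix (Fin (N + 1)) (Fin (N + 1)) ℂ) (i : Fin N) : ℂ :=
  P i.castSucc (Fin.last N)

/-- The off-diagonal part of the last row. -/
def lastRow (P : Matrix (Fin (N + 1)) (Fin (N + 1)) ℂ) (j : Fin N) : ℂ :=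
  P (Fin.last N) j.castSucc

theorem compress_mul (P Q : Matrix (Fin (N + 1)) (Fin (N + 1)) ℂ) :
    compress (P * Q) = compress P * compress Q + vecMulVec (lastCol P) (lastRow Q) := by
  ext i j
  simp [compress, lastCol, lastRow, mul_apply, vecMulVec_apply, Fin.sum_univ_castSucc]

variable {P : Matrix (Fin (N + 1)) (Fin (N + 1)) ℂ}

theorem conjTranspose_compress_mul_compress (hP : Pᴴ * P = 1) :
    (compress P)ᴴ * compress P + vecMulVec (star (lastRow P)) (lastRow P) = 1 := by
  have h := compress_mul Pᴴ P
  rw [hP] at h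
  refine Eq.trans ?_ (h.symm.trans ?_)
  · rfl
  · ext i j
    simp [compress, one_apply]

theorem conjTranspose_compress_mulVec_lastCol (hP : Pᴴ * P = 1) :
    (compress P)ᴴ *ᵥ lastCol P = -(P (Fin.last N) (Fin.last N) • star (lastRow P)) := by
  ext j
  have h := congrFun₂ hP j.castSucc (Fin.last N)
  simp only [mul_apply, Fin.sum_univ_castSucc, conjTranspose_apply,
    one_apply_ne (Fin.castSucc_lt_last j).ne] at h
  simp only [mulVec, dotProduct, compress, lastCol, lastRow, conjTranspose_apply, submatrix_apply,
    Pi.neg_apply, Pi.smul_apply, Pi.star_apply, smul_eq_mul]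
  linear_combination h

theorem star_lastCol_dotProduct_lastCol (hP : Pᴴ * P = 1) :
    star (lastCol P) ⬝ᵥ lastCol P =
      1 - star (P (Fin.last N) (Fin.last N)) * P (Fin.last N) (Fin.last N) := by
  have h := congrFun₂ hP (Fin.last N) (Fin.last N)
  simp only [mul_apply, Fin.sum_univ_castSucc, conjTranspose_apply, one_apply_eq] at h
  simp only [dotProduct, lastCol, Pi.star_apply]
  linear_combination h

theorem sum_norm_sq_lastCol_le_one (hP : Pᴴ * P = 1) : ∑ i, ‖lastCol P i‖ ^ 2 ≤ 1 := by
  have h := congrArg Complex.re (congrFun₂ hP (Fin.last N) (Fin.last N))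
  simp only [mul_apply, Fin.sum_univ_castSucc, conjTranspose_apply, one_apply_eq, RCLike.star_def,
    Complex.conj_mul', Complex.add_re, Complex.re_sum, ← Complex.ofReal_pow, Complex.ofReal_re,
    Complex.one_re] at h
  have := sq_nonneg ‖P (Fin.last N) (Fin.last N)‖
  simp only [lastCol]
  linarith

theorem sum_norm_sq_lastRow_le_one (hP : P * Pᴴ = 1) : ∑ j, ‖lastRow P j‖ ^ 2 ≤ 1 := by
  simpa [lastRow, lastCol] using
    sum_norm_sq_lastCol_le_one (P := Pᴴ) (by rwa [conjTranspose_conjTranspose])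

/-- The compression of a unitary to all but one coordinate is at Frobenius distance at most `1` from
a unitary. -/
theorem exists_unitary_norm_sub_compress_le_one (P : unitaryGroup (Fin (N + 1)) ℂ) :
    ∃ U : unitaryGroup (Fin N) ℂ,
      ‖U.1 - compress P.1‖ ≤ 1 := by
  have hP : P.1ᴴ * P.1 = 1 := P.2.1
  have hP' : P.1 *
    P.1ᴴ = 1 := P.2.2
  set d := P.1 (Fin.last N) (Fin.last N) with hd
  obtain ⟨z, hz, hzd⟩ : ∃ z : ℂ, star z * z = 1 ∧ 1 ≤ ‖z - d‖ := by
    rcases le_total 0 d.re with h | h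
    · refine ⟨-1, by simp, le_trans ?_ (Complex.abs_re_le_norm _)⟩
      rw [Complex.sub_re, Complex.neg_re, Complex.one_re, abs_of_nonpos] <;> linarith
    · refine ⟨1, by simp, le_trans ?_ (Complex.abs_re_le_norm _)⟩
      rw [Complex.sub_re, Complex.one_re, abs_of_nonneg] <;> linarith
  have hzd0 : z - d ≠ 0 := norm_pos_iff.1 (zero_lt_one.trans_le hzd)
  refine ⟨⟨compress P.1 + (z - d)⁻¹ •
    vecMulVec (lastCol P.1) (lastRow P.1),
    mem_unitaryGroup_iff'.2 (conjTranspose_mul_self_add_smul_vecMulVec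
      (conjTranspose_compress_mul_compress hP) (conjTranspose_compress_mulVec_lastCol hP)
      (star_lastCol_dotProduct_lastCol hP) hz (inv_mul_cancel₀ hzd0))⟩, ?_⟩
  rw [add_sub_cancel_left, norm_smul, norm_inv]
  exact mul_le_one₀ (inv_le_one_of_one_le₀ hzd) (norm_nonneg _)
    (frobenius_norm_vecMulVec_le_one (sum_norm_sq_lastCol_le_one hP)
      (sum_norm_sq_lastRow_le_one hP'))

/-- Unitaries close to the compressions of `P`, `Q` and `P * Q` are almost multiplicative. -/
theorem norm_mul_sub_le_four {P Q : unitaryGroup (Fin (N + 1)) ℂ} {U V W : unitaryGroup (Fin N) ℂ}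
    (hU : ‖U.1 - compress P.1‖ ≤ 1)
    (hV : ‖V.1 - compress Q.1‖ ≤ 1)
    (hW : ‖W.1 - compress (P * Q).1‖
      ≤ 1) :
    ‖U.1 * V.1 - W.1‖ ≤ 4 := by
  have hP : P.1ᴴ * P.1 = 1 := P.2.1
  have hQ : Q.1 *
    Q.1ᴴ = 1 := Q.2.2
  have hsplit : U.1 * V.1 - W.1 =
      (U.1 - compress P.1) * V.1 +
      compress P.1 * (V.1 - compress Q.1) -
      vecMulVec (lastCol P.1) (lastRow Q.1) -
      (W.1 -
        compress (P * Q).1) := by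
    rw [UnitaryGroup.mul_val, compress_mul, Matrix.sub_mul, Matrix.mul_sub]
    abel
  have e1 : ‖(U.1 - compress P.1) * V.1‖ ≤ 1 := by
    rwa [frobenius_norm_mul_right V.2.2]
  have e2 := (frobenius_norm_mul_le_of_add_vecMulVec_eq_one
    (conjTranspose_compress_mul_compress hP)
    (V.1 - compress Q.1)).trans hV
  have e3 := frobenius_norm_vecMulVec_le_one (sum_norm_sq_lastCol_le_one hP)
    (sum_norm_sq_lastRow_le_one hQ)
  rw [hsplit]
  refine (norm_sub_le _ _).trans ?_
  have e4 := norm_sub_le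
    ((U.1 - compress P.1) * V.1 +
      compress P.1 * (V.1 - compress Q.1))
    (vecMulVec (lastCol P.1) (lastRow Q.1))
  have e5 := norm_add_le
    ((U.1 - compress P.1) * V.1)
    (compress P.1 *
      (V.1 - compress Q.1))
  linarith

/-- The isometric inclusion of the first `N` coordinates. -/
def castSuccInclusion (N : ℕ) : Matrix (Fin (N + 1)) (Fin N) ℂ :=
  (1 : Matrix (Fin (N + 1)) (Fin (N + 1)) ℂ).submatrix id Fin.castSucc

theorem norm_sq_castSuccInclusion : ‖castSuccInclusion N‖ ^ 2 = N := by
  have h (x y : Fin (N + 1)) :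
      ‖(1 : Matrix (Fin (N + 1)) (Fin (N + 1)) ℂ) x y‖ ^ 2 = if x = y then 1 else 0 := by
    rw [one_apply]
    split_ifs <;> simp
  rw [frobenius_norm_sq, Finset.sum_comm]
  simp [castSuccInclusion, h]

theorem norm_sq_mul_castSuccInclusion_sub (P : Matrix (Fin (N + 1)) (Fin (N + 1)) ℂ)
    (R : Matrix (Fin N) (Fin N) ℂ) :
    ‖P * castSuccInclusion N - castSuccInclusion N * R‖ ^ 2 =
      ‖compress P - R‖ ^ 2 + ∑ j, ‖lastRow P j‖ ^ 2 := by
  have hlast (j : Fin N) : Fin.last N ≠ j.castSucc := (Fin.castSucc_lt_last j).ne'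
  rw [frobenius_norm_sq, frobenius_norm_sq, Fin.sum_univ_castSucc]
  simp [castSuccInclusion, compress, lastRow, mul_apply, one_apply, hlast]

end Compression

end Matrix

theorem hsNorm_eq_norm_div_sqrt {a b : ℕ} (A : Matrix (Fin a) (Fin b) ℂ) :
    hsNorm A = ‖A‖ / Real.sqrt a := by
  rw [hsNorm, ← Matrix.frobenius_norm_sq_eq_re_trace, one_div_mul_eq_div,
    Real.sqrt_div (sq_nonneg _), Real.sqrt_sq (norm_nonneg _)]

/-- An irreducible representation admits no nonzero intertwiner from a smaller representation. -/
theorem IsIrreducibleRep.intertwiner_eq_zero {Γ : Type*} [Group Γ] {a b : ℕ} (hab : b < a)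
    {π : Γ →* Matrix.unitaryGroup (Fin a) ℂ} (hirr : IsIrreducibleRep π)
    (ρ : Γ → Matrix (Fin b) (Fin b) ℂ) {X : Matrix (Fin a) (Fin b) ℂ}
    (hX : ∀ g, (π g : Matrix (Fin a) (Fin a) ℂ) * X = X * ρ g) : X = 0 := by
  rcases hirr (LinearMap.range X.mulVecLin) (by
    rintro g _ ⟨v, rfl⟩
    exact ⟨(ρ g).mulVec v, by simp [← hX]⟩) with h | h
  · rw [LinearMap.range_eq_bot] at h
    exact Matrix.toLin'.map_eq_zero_iff.1 h
  · have := LinearMap.finrank_le_finrank_of_surjective (LinearMap.range_eq_top.1 h)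
    simp at this
    omega

theorem exists_far_almost_homomorphism {Γ : Type*} [Group Γ] {N : ℕ} (hN : 35 ≤ N)
    (π : Γ →* Matrix.unitaryGroup (Fin (N + 1)) ℂ) (hirr : IsIrreducibleRep π) :
    ∃ ψ : Γ → Matrix.unitaryGroup (Fin N) ℂ,
      (∀ g h : Γ, hsNorm ((ψ g : Matrix (Fin N) (Fin N) ℂ) * (ψ h : Matrix (Fin N) (Fin N) ℂ)
          - (ψ (g * h) : Matrix (Fin N) (Fin N) ℂ)) ≤ 4 / Real.sqrt N) ∧
      ∀ ρ : Γ →* Matrix.unitaryGroup (Fin N) ℂ, ∃ g : Γ,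
        (1 : ℝ) / 2 ≤ hsNorm ((ψ g : Matrix (Fin N) (Fin N) ℂ)
          - (ρ g : Matrix (Fin N) (Fin N) ℂ)) := by
  choose ψ hψ using fun g => Matrix.exists_unitary_norm_sub_compress_le_one (π g)
  have hN' : (35 : ℝ) ≤ N := by exact_mod_cast hN
  have hs : 0 < Real.sqrt N := Real.sqrt_pos.2 (by linarith)
  have hs2 : Real.sqrt N ^ 2 = N := Real.sq_sqrt (by linarith)
  refine ⟨ψ, fun g h => ?_, fun ρ => ?_⟩
  · rw [hsNorm_eq_norm_div_sqrt]
    gcongr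
    exact Matrix.norm_mul_sub_le_four (hψ g) (hψ h) (by simpa only [map_mul] using hψ (g * h))
  · by_contra! hρ
    have hρ' (g) : ‖(ψ g : Matrix (Fin N) (Fin N) ℂ) - ρ g‖ ≤ Real.sqrt N / 2 := by
      have := hρ g
      rw [hsNorm_eq_norm_div_sqrt, div_lt_iff₀ hs] at this
      linarith
    have hclose (g) : ‖(π g).1 * Matrix.castSuccInclusion N
        - Matrix.castSuccInclusion N * (ρ g).1‖
        ≤ Real.sqrt ((Real.sqrt N / 2 + 1) ^ 2 + 1) := by
      refine Real.le_sqrt_of_sq_le ?_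
      rw [Matrix.norm_sq_mul_castSuccInclusion_sub]
      have h1 := Matrix.sum_norm_sq_lastRow_le_one (π g).2.2
      have h2 : ‖Matrix.compress (π g).1 - (ρ g).1‖
          ≤ Real.sqrt N / 2 + 1 := by
        have h3 := norm_sub_le_norm_sub_add_norm_sub (Matrix.compress (π g).1)
          (ψ g).1 (ρ g).1
        have h4 := hψ g
        rw [norm_sub_rev] at h4
        linarith [hρ' g]
      gcongr
    have hlt : Real.sqrt ((Real.sqrt N / 2 + 1) ^ 2 + 1) < ‖Matrix.castSuccInclusion N‖ := by
      rw [Real.sqrt_lt' (by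
        by_contra! h
        have h0 := le_antisymm h (norm_nonneg _)
        have h1 := Matrix.norm_sq_castSuccInclusion (N := N)
        rw [h0] at h1
        linarith),
        Matrix.norm_sq_castSuccInclusion]
      nlinarith
    obtain ⟨X, hX0, hX⟩ := Matrix.exists_intertwiner_ne_zero π ρ _ _ hlt hclose
    exact hX0 (hirr.intertwiner_eq_zero (Nat.lt_succ_self N) (fun g => (ρ g).1) hX)

end Frobenius

/-- From an irreducible unitary representation of dimension n ≥ 36 one obtains a
(4/√(n−1))-homomorphism into U(n−1) that is (1/2)-far from every genuine
(n−1)-dimensional unitary representation. -/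
theorem stmt_9 (Γ : Type*) [Group Γ] (n : ℕ) (hn : 36 ≤ n)
    (π : Γ →* Matrix.unitaryGroup (Fin n) ℂ) (hirr : IsIrreducibleRep π) :
    ∃ ψ : Γ → Matrix.unitaryGroup (Fin (n - 1)) ℂ,
      (∀ g h : Γ, hsNorm ((ψ g : Matrix (Fin (n - 1)) (Fin (n - 1)) ℂ)
          * (ψ h : Matrix (Fin (n - 1)) (Fin (n - 1)) ℂ)
          - (ψ (g * h) : Matrix (Fin (n - 1)) (Fin (n - 1)) ℂ))
        ≤ 4 / Real.sqrt ((n : ℝ) - 1)) ∧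
      ∀ ρ : Γ →* Matrix.unitaryGroup (Fin (n - 1)) ℂ, ∃ g : Γ,
        (1 : ℝ) / 2 ≤ hsNorm ((ψ g : Matrix (Fin (n - 1)) (Fin (n - 1)) ℂ)
          - (ρ g : Matrix (Fin (n - 1)) (Fin (n - 1)) ℂ)) := by
  obtain ⟨N, rfl⟩ : ∃ N, n = N + 1 := ⟨n - 1, by omega⟩
  simpa using exists_far_almost_homomorphism (by omega) π hirr
end

section
/- Let Γ be a group, π: Γ → U(n) and ρ: Γ → U(m) unitary representations, and let Γ act on the space M_{m×n}(ℂ) of m×n complex matrices by g·A = ρ(g)Aπ(g)*. If C ⊆ M_{m×n}(ℂ) is a nonempty, closed, bounded, convex subset that is invariant under this Γ-action and does not contain the zero matrix, then there exists a nonzero matrix A ∈ M_{m×n}(ℂ) satisfying ρ(g)A = Aπ(g) for all g ∈ Γ. In particular, if moreover π is irreducible and m < n, no such set C can exist. -/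
open scoped Matrix

open Matrix in
theorem re_trace_mul_conjTranspose_self {m n : ℕ} (A : Matrix (Fin m) (Fin n) ℂ) :
    (trace (A * Aᴴ)).re = ∑ i, ∑ j, ‖A i j‖ ^ 2 := by
  simp [trace, mul_apply, Complex.mul_conj, Complex.normSq_eq_norm_sq, -Complex.ofReal_pow]

open Matrix in
theorem sq_norm_apply_le_re_trace {m n : ℕ} (A : Matrix (Fin m) (Fin n) ℂ) (i : Fin m)
    (j : Fin n) : ‖A i j‖ ^ 2 ≤ (trace (A * Aᴴ)).re := by
  rw [re_trace_mul_conjTranspose_self]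
  calc ‖A i j‖ ^ 2 ≤ ∑ j, ‖A i j‖ ^ 2 :=
        Finset.single_le_sum (f := fun j => ‖A i j‖ ^ 2) (fun _ _ => by positivity)
          (Finset.mem_univ j)
    _ ≤ ∑ i, ∑ j, ‖A i j‖ ^ 2 :=
        Finset.single_le_sum (f := fun i => ∑ j, ‖A i j‖ ^ 2) (fun _ _ => by positivity)
          (Finset.mem_univ i)

open Matrix in
/-- Parallelogram law for the squared Hilbert–Schmidt norm. -/
theorem re_trace_parallelogram {m n : ℕ} (A B : Matrix (Fin m) (Fin n) ℂ) :
    (trace ((A + B) * (A + B)ᴴ)).re + (trace ((A - B) * (A - B)ᴴ)).re =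
      2 * (trace (A * Aᴴ)).re + 2 * (trace (B * Bᴴ)).re := by
  simp only [conjTranspose_add, conjTranspose_sub, Matrix.add_mul, Matrix.mul_add, Matrix.sub_mul,
    Matrix.mul_sub, trace_add, trace_sub, Complex.add_re, Complex.sub_re]
  ring

open Matrix in
theorem trace_unitary_conj_mul_conjTranspose {m n : ℕ} (U : unitaryGroup (Fin m) ℂ)
    (V : unitaryGroup (Fin n) ℂ) (A : Matrix (Fin m) (Fin n) ℂ) :
    trace (((U : Matrix (Fin m) (Fin m) ℂ) * A * (V : Matrix (Fin n) (Fin n) ℂ)ᴴ) *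
      ((U : Matrix (Fin m) (Fin m) ℂ) * A * (V : Matrix (Fin n) (Fin n) ℂ)ᴴ)ᴴ) =
      trace (A * Aᴴ) := by
  have hU : (U : Matrix (Fin m) (Fin m) ℂ)ᴴ * (U : Matrix (Fin m) (Fin m) ℂ) = 1 :=
    UnitaryGroup.star_mul_self U
  have hV : (V : Matrix (Fin n) (Fin n) ℂ)ᴴ * (V : Matrix (Fin n) (Fin n) ℂ) = 1 :=
    UnitaryGroup.star_mul_self V
  generalize (U : Matrix (Fin m) (Fin m) ℂ) = U at *
  generalize (V : Matrix (Fin n) (Fin n) ℂ) = V at *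
  calc trace ((U * A * Vᴴ) * (U * A * Vᴴ)ᴴ)
      = trace (U * (A * (Vᴴ * V) * Aᴴ * Uᴴ)) := by
        simp only [conjTranspose_mul, conjTranspose_conjTranspose, Matrix.mul_assoc]
    _ = trace (A * Aᴴ) := by
        rw [trace_mul_comm, hV, Matrix.mul_assoc, hU, Matrix.mul_one, Matrix.mul_one]

theorem isCompact_of_hsNorm_le {m n : ℕ} {C : Set (Matrix (Fin m) (Fin n) ℂ)}
    (hclosed : IsClosed C) (hbdd : ∃ R : ℝ, ∀ A ∈ C, hsNorm A ≤ R) : IsCompact C := by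
  obtain ⟨R, hR⟩ := hbdd
  have hK : IsCompact (Set.univ.pi fun _ : Fin m => Set.univ.pi fun _ : Fin n =>
      Metric.closedBall (0 : ℂ) (Real.sqrt (m * R ^ 2))) :=
    isCompact_univ_pi fun _ => isCompact_univ_pi fun _ => isCompact_closedBall _ _
  refine IsCompact.of_isClosed_subset hK hclosed fun A hA i _ j _ => ?_
  rw [mem_closedBall_zero_iff]
  apply Real.le_sqrt_of_sq_le
  have hm : (0 : ℝ) < m := Nat.cast_pos.2 (Nat.zero_lt_of_lt i.2)
  have h := (Real.sqrt_le_iff.1 (hR A hA)).2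
  rw [one_div, inv_mul_le_iff₀ hm] at h
  exact (sq_norm_apply_le_re_trace A i j).trans h

open Matrix in
/-- A convex set has at most one element of minimal Hilbert–Schmidt norm. -/
theorem Convex.eq_of_re_trace_minimal {m n : ℕ} {C : Set (Matrix (Fin m) (Fin n) ℂ)}
    (hconv : Convex ℝ C) {A B : Matrix (Fin m) (Fin n) ℂ} (hA : A ∈ C) (hB : B ∈ C)
    (hmin : ∀ D ∈ C, (trace (A * Aᴴ)).re ≤ (trace (D * Dᴴ)).re)
    (hAB : (trace (B * Bᴴ)).re = (trace (A * Aᴴ)).re) : A = B := by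
  have hmid : (1 / 2 : ℝ) • A + (1 / 2 : ℝ) • B ∈ C :=
    hconv hA hB (by norm_num) (by norm_num) (by norm_num)
  have h := hmin _ hmid
  have hscale : (trace (((1 / 2 : ℝ) • A + (1 / 2 : ℝ) • B) *
      ((1 / 2 : ℝ) • A + (1 / 2 : ℝ) • B)ᴴ)).re = 1 / 4 * (trace ((A + B) * (A + B)ᴴ)).re := by
    rw [← smul_add, conjTranspose_smul, Matrix.smul_mul, Matrix.mul_smul, trace_smul, trace_smul,
      star_trivial, Complex.smul_re, Complex.smul_re, smul_eq_mul, smul_eq_mul]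
    ring
  have hpar := re_trace_parallelogram A B
  have hle : (trace ((A - B) * (A - B)ᴴ)).re ≤ 0 := by linarith
  ext i j
  have hij : ‖(A - B) i j‖ ^ 2 = 0 :=
    le_antisymm ((sq_norm_apply_le_re_trace (A - B) i j).trans hle) (by positivity)
  exact sub_eq_zero.1 (norm_eq_zero.1 (pow_eq_zero_iff two_ne_zero |>.1 hij))

/-- Schur's lemma: a nonzero intertwiner out of an irreducible representation is injective. -/
theorem IsIrreducibleRep.mulVecLin_injective {Γ : Type*} [Group Γ] {n m : ℕ}
    {π : Γ →* Matrix.unitaryGroup (Fin n) ℂ} (hπ : IsIrreducibleRep π)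
    (ρ : Γ →* Matrix.unitaryGroup (Fin m) ℂ) {A : Matrix (Fin m) (Fin n) ℂ} (hA : A ≠ 0)
    (hint : ∀ g : Γ,
      (ρ g : Matrix (Fin m) (Fin m) ℂ) * A = A * (π g : Matrix (Fin n) (Fin n) ℂ)) :
    Function.Injective A.mulVecLin := by
  rcases hπ (LinearMap.ker A.mulVecLin) (fun g v hv => by
    rw [LinearMap.mem_ker, Matrix.mulVecLin_apply] at hv ⊢
    rw [Matrix.mulVec_mulVec, ← hint, ← Matrix.mulVec_mulVec, hv, Matrix.mulVec_zero]) with h | h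
  · exact LinearMap.ker_eq_bot.1 h
  · refine absurd ?_ hA
    rw [LinearMap.ker_eq_top] at h
    ext i j
    simpa using congrFun (LinearMap.congr_fun h (Pi.single j 1)) i

/-- If a nonempty closed bounded convex set C of m×n matrices is invariant under
the action g·A = ρ(g)Aπ(g)* and 0 ∉ C, then there is a nonzero intertwiner
ρ(g)A = Aπ(g); in particular, if π is irreducible and m < n, no such C exists. -/
theorem stmt_10 (Γ : Type*) [Group Γ] (n m : ℕ)
    (π : Γ →* Matrix.unitaryGroup (Fin n) ℂ) (ρ : Γ →* Matrix.unitaryGroup (Fin m) ℂ)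
    (C : Set (Matrix (Fin m) (Fin n) ℂ))
    (hne : C.Nonempty) (hclosed : IsClosed C)
    (hbdd : ∃ R : ℝ, ∀ A ∈ C, hsNorm A ≤ R)
    (hconv : Convex ℝ C)
    (hinv : ∀ g : Γ, ∀ A ∈ C,
      (ρ g : Matrix (Fin m) (Fin m) ℂ) * A * (π g : Matrix (Fin n) (Fin n) ℂ)ᴴ ∈ C)
    (h0 : (0 : Matrix (Fin m) (Fin n) ℂ) ∉ C) :
    (∃ A : Matrix (Fin m) (Fin n) ℂ, A ≠ 0 ∧ ∀ g : Γ,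
      (ρ g : Matrix (Fin m) (Fin m) ℂ) * A = A * (π g : Matrix (Fin n) (Fin n) ℂ)) ∧
    (IsIrreducibleRep π → m < n → False) := by
  have hex : ∃ A : Matrix (Fin m) (Fin n) ℂ, A ≠ 0 ∧ ∀ g : Γ,
      (ρ g : Matrix (Fin m) (Fin m) ℂ) * A = A * (π g : Matrix (Fin n) (Fin n) ℂ) := by
    have hcont : Continuous fun A : Matrix (Fin m) (Fin n) ℂ => (Matrix.trace (A * Aᴴ)).re := by
      fun_prop
    obtain ⟨A, hA, hmin⟩ :=
      (isCompact_of_hsNorm_le hclosed hbdd).exists_isMinOn hne hcont.continuousOn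
    refine ⟨A, fun h => h0 (h ▸ hA), fun g => ?_⟩
    have hfix : A = (ρ g : Matrix (Fin m) (Fin m) ℂ) * A * (π g : Matrix (Fin n) (Fin n) ℂ)ᴴ :=
      hconv.eq_of_re_trace_minimal hA (hinv g A hA) (fun D hD => hmin hD)
        (congrArg Complex.re (trace_unitary_conj_mul_conjTranspose (ρ g) (π g) A))
    have hπ : (π g : Matrix (Fin n) (Fin n) ℂ)ᴴ * (π g : Matrix (Fin n) (Fin n) ℂ) = 1 :=
      Matrix.UnitaryGroup.star_mul_self (π g)
    conv_rhs => rw [hfix, Matrix.mul_assoc, hπ, Matrix.mul_one]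
  refine ⟨hex, fun hirr hmn => ?_⟩
  obtain ⟨A, hA, hint⟩ := hex
  have := LinearMap.finrank_le_finrank_of_injective (hirr.mulVecLin_injective ρ hA hint)
  simp only [Module.finrank_fin_fun] at this
  omega
end
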